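/- arXiv:2208.03830 — 7 statements merged into one kernel-verified Lean document; each statement's English description precedes it below -/
import Mathlib

section
/- Let F(x,y) = a*x^3 + b*x^2*y + c*x*y^2 + d*y^3 be an irreducible binary cubic form with integer coefficients and negative discriminant, and let N_F be the number of integer pairs (m,n) with F(m,n) = 1. If N_F = 5, then F is GL_2(Z)-equivalent to x^3 - x*y^2 + y^3; if N_F = 4, then F is GL_2(Z)-equivalent to x^3 + x*y^2 + y^3 or to x^3 - x^2*y + x*y^2 + y^3. -/
open MvPolynomial

/-- The binary cubic form `a*x^3 + b*x^2*y + c*x*y^2 + d*y^3`, viewed as a polynomial in two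
variables over `ℚ`. -/
noncomputable def cubicForm (a b c d : ℤ) : MvPolynomial (Fin 2) ℚ :=
  C (a : ℚ) * X 0 ^ 3 + C (b : ℚ) * X 0 ^ 2 * X 1 + C (c : ℚ) * X 0 * X 1 ^ 2 +
    C (d : ℚ) * X 1 ^ 3

/-- The binary cubic form with integer coefficients `(a, b, c, d)` is `GL₂(ℤ)`-equivalent to
the binary cubic form with integer coefficients `(a', b', c', d')`: there is an integral change
of variables of determinant `±1` taking the first form to the second. -/
def CubicEquiv (a b c d a' b' c' d' : ℤ) : Prop :=
  ∃ α β γ δ : ℤ, (α * δ - β * γ = 1 ∨ α * δ - β * γ = -1) ∧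
    ∀ x y : ℤ,
      a * (α * x + β * y) ^ 3 + b * (α * x + β * y) ^ 2 * (γ * x + δ * y) +
          c * (α * x + β * y) * (γ * x + δ * y) ^ 2 + d * (γ * x + δ * y) ^ 3 =
        a' * x ^ 3 + b' * x ^ 2 * y + c' * x * y ^ 2 + d' * y ^ 3

/-- If `p ^ (e + f)` divides `h * X` and `p ^ f` does not divide `h`, then `p ^ (e + 1)` divides
`X`. -/
theorem Int.pow_succ_dvd_of_pow_add_dvd_mul {p : ℕ} (hp : p.Prime) {h X : ℤ} {e f : ℕ}
    (hd : (p : ℤ) ^ (e + f) ∣ h * X) (hf : ¬ (p : ℤ) ^ f ∣ h) : (p : ℤ) ^ (e + 1) ∣ X := by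
  have hp' : Prime (p : ℤ) := Nat.prime_iff_prime_int.mp hp
  have h0 : h ≠ 0 := by rintro rfl; exact hf (dvd_zero _)
  obtain ⟨g, h', hh', rfl⟩ := WfDvdMonoid.max_power_factor h0 hp'.irreducible
  have hgf : g < f := by
    by_contra hc
    exact hf (Dvd.dvd.mul_right (pow_dvd_pow _ (not_lt.mp hc)) _)
  obtain ⟨j, rfl⟩ := Nat.exists_eq_add_of_lt hgf
  rw [show e + (g + j + 1) = g + (e + 1 + j) by ring, pow_add, mul_assoc] at hd
  have h1 := (mul_dvd_mul_iff_left (pow_ne_zero g hp'.ne_zero)).mp hd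
  exact (pow_dvd_pow _ (Nat.le_add_right _ _)).trans (hp'.pow_dvd_of_dvd_mul_left _ hh' h1)

theorem Nat.Prime.not_pow_pred_dvd {p n : ℕ} (hp : p.Prime) (hn : 2 ≤ n) (h : p ≠ 2 ∨ n ≠ 2) :
    ¬ p ^ (n - 1) ∣ n := by
  intro hd
  have hle := Nat.le_of_dvd (by omega) hd
  have hp2 := hp.two_le
  obtain ⟨k, rfl⟩ := Nat.exists_eq_add_of_le hn
  rw [show 2 + k - 1 = k + 1 by omega] at hle
  have h2k : k < 2 ^ k := Nat.lt_two_pow_self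
  rcases Nat.lt_or_ge 2 p with h3 | h3
  · have : 3 * 2 ^ k ≤ p ^ (k + 1) := by
      rw [pow_succ, mul_comm]
      exact Nat.mul_le_mul (Nat.pow_le_pow_left hp2 k) h3
    omega
  · have hpe : p = 2 := by omega
    subst hpe
    obtain ⟨j, rfl⟩ : ∃ j, k = j + 1 := ⟨k - 1, by omega⟩
    have h2j : j < 2 ^ j := Nat.lt_two_pow_self
    rw [pow_succ, pow_succ] at hle
    omega

theorem Nat.Prime.not_pow_dvd_choose_two {p n : ℕ} (hp : p.Prime) (hn : 3 ≤ n)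
    (h : p ≠ 3 ∨ n ≠ 3) : ¬ p ^ (n - 2) ∣ n.choose 2 := by
  intro hd
  have hp2 := hp.two_le
  obtain rfl | rfl | hn5 : n = 3 ∨ n = 4 ∨ 5 ≤ n := by omega
  · have : p ∣ 3 := by simpa using hd
    have := (Nat.prime_dvd_prime_iff_eq hp Nat.prime_three).mp this
    omega
  · have hd' : p ^ 2 ∣ 6 := by simpa [Nat.choose] using hd
    have := Nat.le_of_dvd (by norm_num) hd'
    have : p < 3 := by nlinarith
    obtain rfl : p = 2 := by omega
    omega
  · obtain ⟨k, rfl⟩ := Nat.exists_eq_add_of_le hn5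
    have h1 : p ^ (k + 3) ∣ (5 + k) * (4 + k) := by
      have h2 : (5 + k) * (4 + k) = (5 + k).choose 2 * 2 := by
        rw [Nat.choose_two_right, Nat.div_mul_cancel (Nat.even_mul_pred_self _).two_dvd]
        congr 1
        omega
      rw [h2, show k + 3 = 5 + k - 2 by omega]
      exact Dvd.dvd.mul_right hd 2
    have hc : Nat.Coprime (5 + k) (4 + k) := by
      rw [show 5 + k = 1 + (4 + k) by ring]
      simp
    have h2 := (Nat.Coprime.isPrimePow_dvd_mul hc (hp.isPrimePow.pow (by omega))).mp h1
    have hle : p ^ (k + 3) ≤ 5 + k := by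
      rcases h2 with h2 | h2
      · exact Nat.le_of_dvd (by omega) h2
      · exact (Nat.le_of_dvd (by omega) h2).trans (by omega)
    have h3 : 2 ^ (k + 3) ≤ p ^ (k + 3) := Nat.pow_le_pow_left hp2 _
    have h4 : k < 2 ^ k := Nat.lt_two_pow_self
    rw [pow_add] at h3
    omega

/-- First order Skolem estimate: if `p` divides `y`, then the sum
`∑ choose m n * x ^ (m - n) * y ^ n * c n` with `c 0 = 0` has the `p`-adic valuation of `m * y`. -/
theorem pow_dvd_of_dvd_sum_choose_first {p : ℕ} (hp : p.Prime) {x y : ℤ} {c : ℕ → ℤ} {m N : ℕ}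
    (hx : ¬ (p : ℤ) ∣ x) (hy : (p : ℤ) ∣ y) (hc0 : c 0 = 0) (hc1 : ¬ (p : ℤ) ∣ c 1)
    (hcond : p ≠ 2 ∨ (4 : ℤ) ∣ y ∨ (2 : ℤ) ∣ c 2)
    (hN : (p : ℤ) ^ N ∣ ∑ n ∈ Finset.range (m + 1), (m.choose n : ℤ) * x ^ (m - n) * y ^ n * c n) :
    (p : ℤ) ^ N ∣ m * y := by
  have hp' : Prime (p : ℤ) := Nat.prime_iff_prime_int.mp hp
  rcases eq_or_ne ((m : ℤ) * y) 0 with h0 | h0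
  · rw [h0]; exact dvd_zero _
  obtain ⟨e, u, hu, he⟩ := WfDvdMonoid.max_power_factor h0 hp'.irreducible
  have hdT : (p : ℤ) ^ e ∣ m * y := ⟨u, he⟩
  obtain ⟨k, rfl⟩ : ∃ k, m = k + 1 := Nat.exists_eq_succ_of_ne_zero (by rintro rfl; simp at h0)
  have key : ∀ n, 2 ≤ n →
      (p : ℤ) ^ (e + 1) ∣ ((k + 1).choose n : ℤ) * x ^ (k + 1 - n) * y ^ n * c n := by
    intro n hn
    have hid : (n : ℤ) * (((k + 1).choose n : ℤ) * y ^ n) =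
        (((k + 1 : ℕ) : ℤ) * y) * (k.choose (n - 1) : ℤ) * y ^ (n - 1) := by
      obtain ⟨j, rfl⟩ : ∃ j, n = j + 1 := ⟨n - 1, by omega⟩
      have := Nat.add_one_mul_choose_eq k j
      zify at this
      rw [Nat.add_sub_cancel, pow_succ]
      push_cast
      linear_combination (- y * y ^ j) * this
    by_cases hs : p ≠ 2 ∨ n ≠ 2
    · have hnd : ¬ (p : ℤ) ^ (n - 1) ∣ (n : ℤ) := by
        have := hp.not_pow_pred_dvd hn hs
        exact_mod_cast this
      have hX : (p : ℤ) ^ (e + 1) ∣ ((k + 1).choose n : ℤ) * y ^ n := by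
        refine Int.pow_succ_dvd_of_pow_add_dvd_mul hp ?_ hnd
        rw [hid, pow_add]
        exact mul_dvd_mul (Dvd.dvd.mul_right hdT _) (pow_dvd_pow_of_dvd hy _)
      obtain ⟨w, hw⟩ := hX
      exact ⟨w * x ^ (k + 1 - n) * c n, by linear_combination (x ^ (k + 1 - n) * c n) * hw⟩
    · push Not at hs
      obtain ⟨rfl, rfl⟩ := hs
      simp only [ne_eq, not_true_eq_false, false_or] at hcond
      have hid' : (2 : ℤ) * (((k + 1).choose 2 : ℤ) * y ^ 2) =
        (((k + 1 : ℕ) : ℤ) * y) * (k : ℤ) * y := by simpa using hid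
      rcases hcond with ⟨w, hw⟩ | ⟨w, hw⟩
      · refine ⟨u * k * x ^ (k + 1 - 2) * c 2 * w, ?_⟩
        generalize x ^ (k + 1 - 2) = z
        have : (2 : ℤ) * (((k + 1).choose 2 : ℤ) * y ^ 2) =
            2 * ((2 : ℤ) ^ (e + 1) * u * k * w) := by
          rw [hid', he, pow_succ]
          conv_lhs => rw [hw]
          push_cast
          ring
        have := mul_left_cancel₀ two_ne_zero this
        push_cast at this ⊢
        linear_combination (z * c 2) * this
      · obtain ⟨v, hv⟩ := hy
        refine ⟨u * k * x ^ (k + 1 - 2) * v * w, ?_⟩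
        generalize x ^ (k + 1 - 2) = z
        have : (2 : ℤ) * (((k + 1).choose 2 : ℤ) * y ^ 2) =
            2 * ((2 : ℤ) ^ e * u * k * v) := by
          rw [hid', he]
          conv_lhs => rw [hv]
          push_cast
          ring
        have := mul_left_cancel₀ two_ne_zero this
        rw [hw]
        push_cast at this ⊢
        linear_combination (z * 2 * w) * this
  rcases Nat.lt_or_ge e N with hlt | hge
  · exfalso
    rw [Finset.sum_range_succ', Finset.sum_range_succ'] at hN
    have h1 := (pow_dvd_pow (p : ℤ) hlt).trans hN
    rw [hc0, mul_zero, add_zero] at h1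
    have h2 := (dvd_add_right (Finset.dvd_sum fun n _ => key (n + 1 + 1) (by omega))).mp h1
    simp only [zero_add, Nat.choose_one_right, Nat.add_sub_cancel, pow_one] at h2
    have h3 : (p : ℤ) ^ (e + 1) ∣ x ^ k * c 1 * (((k + 1 : ℕ) : ℤ) * y) := by
      obtain ⟨w, hw⟩ := h2
      exact ⟨w, by rw [← hw]; push_cast; ring⟩
    have h4 := hp'.pow_dvd_of_dvd_mul_left _
      (fun h => (hp'.dvd_or_dvd h).elim (fun h => hx (hp'.dvd_of_dvd_pow h)) hc1) h3
    rw [he, pow_succ] at h4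
    exact hu ((mul_dvd_mul_iff_left (pow_ne_zero e hp'.ne_zero)).mp h4)
  · exact (pow_dvd_pow _ hge).trans hdT

/-- Second order Skolem estimate: if `p` divides `y`, then the sum
`∑ choose m n * x ^ (m - n) * y ^ n * c n` with `c 0 = c 1 = 0` and `c 2 = 1` has the `p`-adic
valuation of `choose m 2 * y ^ 2`. -/
theorem pow_dvd_of_dvd_sum_choose_second {p : ℕ} (hp : p.Prime) {x y : ℤ} {c : ℕ → ℤ} {m N : ℕ}
    (hx : ¬ (p : ℤ) ∣ x) (hy : (p : ℤ) ∣ y) (hc0 : c 0 = 0) (hc1 : c 1 = 0) (hc2 : c 2 = 1)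
    (hcond : p ≠ 3 ∨ (9 : ℤ) ∣ y ∨ (3 : ℤ) ∣ c 3)
    (hN : (p : ℤ) ^ N ∣ ∑ n ∈ Finset.range (m + 1), (m.choose n : ℤ) * x ^ (m - n) * y ^ n * c n) :
    (p : ℤ) ^ N ∣ m * (m - 1) * y ^ 2 := by
  have hp' : Prime (p : ℤ) := Nat.prime_iff_prime_int.mp hp
  suffices h : (p : ℤ) ^ N ∣ (m.choose 2 : ℤ) * y ^ 2 by
    have h2 : (m : ℤ) * (m - 1) = 2 * (m.choose 2 : ℤ) := by
      rcases m with _ | m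
      · simp
      · have h := Nat.choose_two_right (m + 1)
        have h' := Nat.div_mul_cancel (Nat.even_mul_pred_self (m + 1)).two_dvd
        rw [← h] at h'
        zify at h'
        push_cast at h' ⊢
        linear_combination -h'
    rw [h2, mul_assoc]
    exact Dvd.dvd.mul_left h 2
  rcases eq_or_ne ((m.choose 2 : ℤ) * y ^ 2) 0 with h0 | h0
  · rw [h0]; exact dvd_zero _
  obtain ⟨e, u, hu, he⟩ := WfDvdMonoid.max_power_factor h0 hp'.irreducible
  have hdT : (p : ℤ) ^ e ∣ (m.choose 2 : ℤ) * y ^ 2 := ⟨u, he⟩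
  obtain ⟨k, rfl⟩ : ∃ k, m = k + 2 := by
    refine ⟨m - 2, ?_⟩
    have : 2 ≤ m := by
      by_contra hm
      exact h0 (by rw [Nat.choose_eq_zero_of_lt (by omega)]; simp)
    omega
  have key : ∀ n, 3 ≤ n → n ≤ k + 2 →
      (p : ℤ) ^ (e + 1) ∣ ((k + 2).choose n : ℤ) * x ^ (k + 2 - n) * y ^ n * c n := by
    intro n hn hnk
    have hid : (n.choose 2 : ℤ) * (((k + 2).choose n : ℤ) * y ^ n) =
        (((k + 2).choose 2 : ℤ) * y ^ 2) * (k.choose (n - 2) : ℤ) * y ^ (n - 2) := by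
      have := Nat.choose_mul (n := k + 2) (k := n) (s := 2) (by omega)
      rw [Nat.add_sub_cancel] at this
      zify at this
      obtain ⟨j, rfl⟩ : ∃ j, n = j + 2 := ⟨n - 2, by omega⟩
      rw [Nat.add_sub_cancel] at *
      linear_combination (y ^ (j + 2)) * this
    by_cases hs : p ≠ 3 ∨ n ≠ 3
    · have hnd : ¬ (p : ℤ) ^ (n - 2) ∣ (n.choose 2 : ℤ) := by
        have := hp.not_pow_dvd_choose_two hn hs
        exact_mod_cast this
      have hX : (p : ℤ) ^ (e + 1) ∣ ((k + 2).choose n : ℤ) * y ^ n := by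
        refine Int.pow_succ_dvd_of_pow_add_dvd_mul hp ?_ hnd
        rw [hid, pow_add]
        exact mul_dvd_mul (Dvd.dvd.mul_right hdT _) (pow_dvd_pow_of_dvd hy _)
      obtain ⟨w, hw⟩ := hX
      exact ⟨w * x ^ (k + 2 - n) * c n, by linear_combination (x ^ (k + 2 - n) * c n) * hw⟩
    · push Not at hs
      obtain ⟨rfl, rfl⟩ := hs
      simp only [ne_eq, not_true_eq_false, false_or] at hcond
      have hid' : (3 : ℤ) * (((k + 2).choose 3 : ℤ) * y ^ 3) =
        (((k + 2).choose 2 : ℤ) * y ^ 2) * (k : ℤ) * y := by simpa using hid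
      rcases hcond with ⟨w, hw⟩ | ⟨w, hw⟩
      · refine ⟨u * k * x ^ (k + 2 - 3) * c 3 * w, ?_⟩
        generalize x ^ (k + 2 - 3) = z
        have : (3 : ℤ) * (((k + 2).choose 3 : ℤ) * y ^ 3) =
            3 * ((3 : ℤ) ^ (e + 1) * u * k * w) := by
          rw [hid', he, pow_succ]
          conv_lhs => rw [hw]
          push_cast
          ring
        have := mul_left_cancel₀ three_ne_zero this
        push_cast at this ⊢
        linear_combination (z * c 3) * this
      · obtain ⟨v, hv⟩ := hy
        refine ⟨u * k * x ^ (k + 2 - 3) * v * w, ?_⟩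
        generalize x ^ (k + 2 - 3) = z
        have : (3 : ℤ) * (((k + 2).choose 3 : ℤ) * y ^ 3) =
            3 * ((3 : ℤ) ^ e * u * k * v) := by
          rw [hid', he]
          conv_lhs => rw [hv]
          push_cast
          ring
        have := mul_left_cancel₀ three_ne_zero this
        rw [hw]
        push_cast at this ⊢
        linear_combination (z * 3 * w) * this
  rcases Nat.lt_or_ge e N with hlt | hge
  · exfalso
    rw [Finset.sum_range_succ', Finset.sum_range_succ', Finset.sum_range_succ'] at hN
    have h1 := (pow_dvd_pow (p : ℤ) hlt).trans hN
    simp only [zero_add] at h1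
    rw [hc0, hc1, mul_zero, mul_zero, add_zero, add_zero] at h1
    have h2 := (dvd_add_right (Finset.dvd_sum fun n hn => key (n + 1 + 1 + 1) (by omega)
      (by have := Finset.mem_range.mp hn; omega))).mp h1
    have h3 : (p : ℤ) ^ (e + 1) ∣ x ^ k * (((k + 2).choose 2 : ℤ) * y ^ 2) := by
      rw [hc2, show (1 + 1 : ℕ) = 2 from rfl, Nat.add_sub_cancel] at h2
      obtain ⟨w, hw⟩ := h2
      exact ⟨w, by rw [← hw]; ring⟩
    have h4 := hp'.pow_dvd_of_dvd_mul_left _ (fun h => hx (hp'.dvd_of_dvd_pow h)) h3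
    rw [he, pow_succ] at h4
    exact hu ((mul_dvd_mul_iff_left (pow_ne_zero e hp'.ne_zero)).mp h4)
  · exact (pow_dvd_pow _ hge).trans hdT

/-- Interpolation of a multiplicatively dependent unit by natural powers, `p`-adically. -/
theorem exists_pow_dvd_map_mul_pow {R : Type*} [CommRing R] {p : ℕ} (hp : p.Prime) {a b : Rˣ}
    {k l x y : ℤ} (hab : b ^ k = a ^ l) (hk : ¬ (p : ℤ) ∣ k)
    (ha : (p : R) ∣ (a : R) - x) (hb : (p : R) ∣ (b : R) - y) (hy : ¬ (p : ℤ) ∣ y)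
    (Z : R →+ ℤ) (w : R) (hZ : Z (w * b) = 0) (N : ℕ) :
    ∃ m : ℕ, (p : ℤ) ^ N ∣ k * m - l ∧ (p : ℤ) ^ N ∣ Z (w * (a : R) ^ m) := by
  have hp' : Prime (p : ℤ) := Nat.prime_iff_prime_int.mp hp
  obtain ⟨r, h, hr⟩ : IsCoprime k ((p : ℤ) ^ N) :=
    IsCoprime.pow_right ((hp'.irreducible.coprime_iff_not_dvd.mpr hk).symm)
  obtain ⟨m, hm⟩ : ∃ m : ℕ, (m : ℤ) = l * r + p ^ N * |l * r| := by
    have h1 : (0 : ℤ) ≤ l * r + p ^ N * |l * r| := by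
      have : (1 : ℤ) ≤ p ^ N := one_le_pow₀ (by exact_mod_cast hp.one_le)
      nlinarith [neg_abs_le (l * r), abs_nonneg (l * r)]
    exact ⟨_, Int.toNat_of_nonneg h1⟩
  obtain ⟨g, hg⟩ : ∃ g : ℕ, (g : ℤ) = |l * r| := ⟨(l * r).natAbs, by simp⟩
  obtain ⟨h₁, hh₁⟩ : ∃ h₁ : ℕ, (h₁ : ℤ) = |h| := ⟨h.natAbs, by simp⟩
  obtain ⟨h₂, hh₂⟩ : ∃ h₂ : ℕ, (h₂ : ℤ) = |h| - h :=
    ⟨_, Int.toNat_of_nonneg (by linarith [le_abs_self h])⟩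
  refine ⟨m, ⟨k * |l * r| - l * h, by rw [hm]; linear_combination l * hr⟩, ?_⟩
  have hu : b * (b ^ p ^ N) ^ h₂ * (a ^ p ^ N) ^ g = a ^ m * (b ^ p ^ N) ^ h₁ := by
    have e1 : a ^ (l * r) = b ^ (1 - h * p ^ N) := by
      rw [zpow_mul, ← hab, ← zpow_mul]
      congr 1
      linear_combination hr
    simp only [← zpow_natCast, ← zpow_mul]
    rw [hm, hh₂, hh₁, hg, zpow_add a, e1]
    rw [← zpow_one_add, mul_right_comm, ← zpow_add]
    push_cast
    ring_nf
  set I := Ideal.span {((p : R) ^ N)} with hI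
  have red : ∀ (u : R) (z : ℤ), (p : R) ∣ u - z →
      Ideal.Quotient.mk I (u ^ p ^ N) = Ideal.Quotient.mk I (((z ^ p ^ N : ℤ)) : R) := by
    intro u z huz
    rw [Ideal.Quotient.eq, hI, Ideal.mem_span_singleton]
    push_cast
    exact (pow_dvd_pow _ (Nat.le_succ N)).trans (dvd_sub_pow_of_dvd_sub huz N)
  have hq : Ideal.Quotient.mk I (w * b * (((y ^ p ^ N) ^ h₂ * (x ^ p ^ N) ^ g : ℤ) : R)) =
      Ideal.Quotient.mk I (w * (a : R) ^ m * (((y ^ p ^ N) ^ h₁ : ℤ) : R)) := by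
    have hu' := congrArg (fun u : Rˣ => Ideal.Quotient.mk I (w * (u : R))) hu
    simp only [Units.val_mul, Units.val_pow_eq_pow_val] at hu'
    have ra := red _ _ ha
    have rb := red _ _ hb
    simp only [map_mul, map_pow, Int.cast_mul, Int.cast_pow] at hu' ra rb ⊢
    rw [ra, rb] at hu'
    linear_combination hu'
  rw [Ideal.Quotient.eq, hI, Ideal.mem_span_singleton] at hq
  obtain ⟨v, hv⟩ := hq
  have hmul : ∀ (u : R) (n : ℤ), Z (u * n) = n * Z u := by
    intro u n
    rw [mul_comm, ← zsmul_eq_mul, map_zsmul, smul_eq_mul]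
  have hv' := congrArg Z hv
  rw [map_sub, hmul, hmul, hZ, mul_zero, zero_sub, mul_comm ((p : R) ^ N),
    show (p : R) ^ N = (((p : ℤ) ^ N : ℤ) : R) by push_cast; rfl, hmul] at hv'
  have h3 : (p : ℤ) ^ N ∣ (y ^ p ^ N) ^ h₁ * Z (w * (a : R) ^ m) :=
    ⟨- Z v, by linear_combination -hv'⟩
  exact hp'.pow_dvd_of_dvd_mul_left _
    (fun h => hy (hp'.dvd_of_dvd_pow (hp'.dvd_of_dvd_pow h))) h3

/-- The value `a * x ^ 3 + b * x ^ 2 * y + c * x * y ^ 2 + d * y ^ 3`. -/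
def cubicValue (a b c d x y : ℤ) : ℤ :=
  a * x ^ 3 + b * x ^ 2 * y + c * x * y ^ 2 + d * y ^ 3

/-- The discriminant of the binary cubic form with coefficients `a, b, c, d`. -/
def cubicDiscr (a b c d : ℤ) : ℤ :=
  18 * a * b * c * d - 4 * b ^ 3 * d + b ^ 2 * c ^ 2 - 4 * a * c ^ 3 - 27 * a ^ 2 * d ^ 2

/-- A binary cubic form of negative discriminant without nontrivial integral zeros. -/
structure IsComplexCubic (a b c d : ℤ) : Prop where
  eq_zero : ∀ x y : ℤ, cubicValue a b c d x y = 0 → x = 0 ∧ y = 0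
  discr_neg : cubicDiscr a b c d < 0

/-- The ring `ℤ[θ]`, where `θ ^ 3 = b * θ ^ 2 - c * θ + d`, with elements written as
`x + y * θ + z * θ ^ 2`. -/
@[ext]
structure CubicRing (b c d : ℤ) where
  /-- The constant coordinate. -/
  x : ℤ
  /-- The coordinate of `θ`. -/
  y : ℤ
  /-- The coordinate of `θ ^ 2`. -/
  z : ℤ

namespace CubicRing

variable {b c d : ℤ}

instance : Zero (CubicRing b c d) := ⟨⟨0, 0, 0⟩⟩
instance : One (CubicRing b c d) := ⟨⟨1, 0, 0⟩⟩
instance : Add (CubicRing b c d) := ⟨fun u v => ⟨u.x + v.x, u.y + v.y, u.z + v.z⟩⟩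
instance : Neg (CubicRing b c d) := ⟨fun u => ⟨-u.x, -u.y, -u.z⟩⟩
instance : Mul (CubicRing b c d) := ⟨fun u v =>
  ⟨u.x * v.x + d * (u.y * v.z + u.z * v.y) + b * d * (u.z * v.z),
   u.x * v.y + u.y * v.x - c * (u.y * v.z + u.z * v.y) + (d - b * c) * (u.z * v.z),
   u.x * v.z + u.y * v.y + u.z * v.x + b * (u.y * v.z + u.z * v.y)
    + (b ^ 2 - c) * (u.z * v.z)⟩⟩

@[simp] theorem zero_x : (0 : CubicRing b c d).x = 0 := rfl
@[simp] theorem zero_y : (0 : CubicRing b c d).y = 0 := rfl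
@[simp] theorem zero_z : (0 : CubicRing b c d).z = 0 := rfl
@[simp] theorem one_x : (1 : CubicRing b c d).x = 1 := rfl
@[simp] theorem one_y : (1 : CubicRing b c d).y = 0 := rfl
@[simp] theorem one_z : (1 : CubicRing b c d).z = 0 := rfl
@[simp] theorem add_x (u v : CubicRing b c d) : (u + v).x = u.x + v.x := rfl
@[simp] theorem add_y (u v : CubicRing b c d) : (u + v).y = u.y + v.y := rfl
@[simp] theorem add_z (u v : CubicRing b c d) : (u + v).z = u.z + v.z := rfl
@[simp] theorem neg_x (u : CubicRing b c d) : (-u).x = -u.x := rfl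
@[simp] theorem neg_y (u : CubicRing b c d) : (-u).y = -u.y := rfl
@[simp] theorem neg_z (u : CubicRing b c d) : (-u).z = -u.z := rfl
@[simp] theorem mul_x (u v : CubicRing b c d) :
    (u * v).x = u.x * v.x + d * (u.y * v.z + u.z * v.y) + b * d * (u.z * v.z) := rfl
@[simp] theorem mul_y (u v : CubicRing b c d) :
    (u * v).y = u.x * v.y + u.y * v.x - c * (u.y * v.z + u.z * v.y)
      + (d - b * c) * (u.z * v.z) := rfl
@[simp] theorem mul_z (u v : CubicRing b c d) :
    (u * v).z = u.x * v.z + u.y * v.y + u.z * v.x + b * (u.y * v.z + u.z * v.y)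
      + (b ^ 2 - c) * (u.z * v.z) := rfl

instance : CommRing (CubicRing b c d) where
  add_assoc u v w := by ext <;> simp <;> ring
  zero_add u := by ext <;> simp
  add_zero u := by ext <;> simp
  add_comm u v := by ext <;> simp <;> ring
  neg_add_cancel u := by ext <;> simp
  mul_assoc u v w := by ext <;> simp <;> ring
  one_mul u := by ext <;> simp
  mul_one u := by ext <;> simp
  left_distrib u v w := by ext <;> simp <;> ring
  right_distrib u v w := by ext <;> simp <;> ring
  zero_mul u := by ext <;> simp
  mul_zero u := by ext <;> simp
  mul_comm u v := by ext <;> simp <;> ring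
  nsmul := nsmulRec
  zsmul := zsmulRec

/-- The `θ ^ 2`-coordinate as an additive map. -/
def zHom (b c d : ℤ) : CubicRing b c d →+ ℤ where
  toFun := z
  map_zero' := rfl
  map_add' _ _ := rfl

/-- The generator `θ`. -/
def θ (b c d : ℤ) : CubicRing b c d := ⟨0, 1, 0⟩

theorem intCast_eq (n : ℤ) : (n : CubicRing b c d) = ⟨n, 0, 0⟩ := by
  have hn : ∀ n : ℕ, (n : CubicRing b c d) = ⟨n, 0, 0⟩ := by
    intro n
    induction n with
    | zero => rw [Nat.cast_zero]; rfl
    | succ n ih => rw [Nat.cast_succ, ih]; ext <;> simp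
  obtain ⟨m, rfl | rfl⟩ := n.eq_nat_or_neg
  · rw [Int.cast_natCast, hn]
  · rw [Int.cast_neg, Int.cast_natCast, hn]
    ext <;> simp

@[simp] theorem intCast_x (n : ℤ) : (n : CubicRing b c d).x = n := by rw [intCast_eq]
@[simp] theorem intCast_y (n : ℤ) : (n : CubicRing b c d).y = 0 := by rw [intCast_eq]
@[simp] theorem intCast_z (n : ℤ) : (n : CubicRing b c d).z = 0 := by rw [intCast_eq]

/-- The ring homomorphism sending `θ` to a root of its minimal polynomial. -/
def lift {S : Type*} [CommRing S] (r : S) (hr : r ^ 3 = b * r ^ 2 - c * r + d) :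
    CubicRing b c d →+* S where
  toFun u := u.x + u.y * r + u.z * r ^ 2
  map_zero' := by simp
  map_one' := by simp
  map_add' u v := by simp; ring
  map_mul' u v := by
    simp
    linear_combination (-(u.y * v.z + u.z * v.y : S) - (r + b) * (u.z * v.z : S)) * hr

theorem lift_apply {S : Type*} [CommRing S] (r : S) (hr : r ^ 3 = b * r ^ 2 - c * r + d)
    (u : CubicRing b c d) : lift r hr u = u.x + u.y * r + u.z * r ^ 2 := rfl

/-- The norm form. -/
def norm (u : CubicRing b c d) : ℤ :=
  u.x ^ 3 + b * u.x ^ 2 * u.y + (b ^ 2 - 2 * c) * u.x ^ 2 * u.z + c * u.x * u.y ^ 2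
    + (b * c - 3 * d) * u.x * u.y * u.z + (c ^ 2 - 2 * b * d) * u.x * u.z ^ 2 + d * u.y ^ 3
    + b * d * u.y ^ 2 * u.z + c * d * u.y * u.z ^ 2 + d ^ 2 * u.z ^ 3

/-- A solution of `x ^ 3 + b * x ^ 2 * y + c * x * y ^ 2 + d * y ^ 3 = 1` gives the unit
`x + y * θ`. -/
def unitOfSolution {x y : ℤ} (h : cubicValue 1 b c d x y = 1) : (CubicRing b c d)ˣ where
  val := ⟨x, y, 0⟩
  inv := ⟨x ^ 2 + b * x * y + c * y ^ 2, -x * y - b * y ^ 2, y ^ 2⟩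
  val_inv := by
    unfold cubicValue at h
    ext <;> simp
    · linear_combination h
    · ring
    · ring
  inv_val := by
    unfold cubicValue at h
    ext <;> simp
    · linear_combination h
    · ring
    · ring

@[simp] theorem val_unitOfSolution {x y : ℤ} (h : cubicValue 1 b c d x y = 1) :
    (unitOfSolution h : CubicRing b c d) = ⟨x, y, 0⟩ := rfl

end CubicRing

/-- A real cubic polynomial has a real root. -/
theorem exists_real_root_cubic (b c d : ℝ) : ∃ r : ℝ, r ^ 3 = b * r ^ 2 - c * r + d := by
  set M := 1 + |b| + |c| + |d| with hM
  have hb := abs_nonneg b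
  have hc := abs_nonneg c
  have hd := abs_nonneg d
  have h1 : 1 ≤ M := by linarith
  have hbM : |b| * M ^ 2 + |c| * M + |d| ≤ M ^ 3 := by
    have e : M ^ 3 = (1 + |b| + |c| + |d|) * M ^ 2 := by rw [hM]; ring
    rw [e]
    nlinarith [mul_nonneg hc (by nlinarith : 0 ≤ M ^ 2 - M),
      mul_nonneg hd (by nlinarith : 0 ≤ M ^ 2 - 1), sq_nonneg M]
  have hcont : ContinuousOn (fun r : ℝ => r ^ 3 - (b * r ^ 2 - c * r + d)) (Set.Icc (-M) M) := by
    fun_prop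
  have h2 := intermediate_value_Icc (by linarith : -M ≤ M) hcont
  have hb' := abs_le.mp (le_refl |b|)
  have hc' := abs_le.mp (le_refl |c|)
  have hd' := abs_le.mp (le_refl |d|)
  have hM2 := sq_nonneg M
  obtain ⟨r, -, hr⟩ := h2 (show (0 : ℝ) ∈ Set.Icc _ _ by
    constructor
    · show (-M) ^ 3 - (b * (-M) ^ 2 - c * (-M) + d) ≤ 0
      nlinarith [mul_nonneg hM2 (by linarith : 0 ≤ b + |b|),
        mul_nonneg (by linarith : 0 ≤ M) (by linarith : 0 ≤ |c| + c)]
    · show 0 ≤ M ^ 3 - (b * M ^ 2 - c * M + d)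
      nlinarith [mul_nonneg hM2 (by linarith : 0 ≤ |b| - b),
        mul_nonneg (by linarith : 0 ≤ M) (by linarith : 0 ≤ |c| + c)])
  exact ⟨r, by simpa [sub_eq_zero] using hr⟩

namespace CubicRing

variable {b c d : ℤ}

theorem eq_zero_of_lift_eq_zero (hF : IsComplexCubic 1 b c d) {r : ℝ}
    (hr : r ^ 3 = b * r ^ 2 - c * r + d) {u : CubicRing b c d} (hu : lift r hr u = 0) : u = 0 := by
  obtain ⟨x, y, z⟩ := u
  simp only [lift_apply] at hu
  set A : ℤ := c * z ^ 2 - z * x + b * y * z + y ^ 2 with hA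
  set B : ℤ := - d * z ^ 2 + x * (b * z + y) with hB
  have h1 : (B : ℝ) + A * r = 0 := by
    rw [hA, hB]
    push_cast
    linear_combination (z ^ 2 : ℝ) * hr - (z * r - (b * z + y)) * hu
  have h2 : cubicValue 1 b c d B A = 0 := by
    have : ((cubicValue 1 b c d B A : ℤ) : ℝ) = 0 := by
      unfold cubicValue
      push_cast
      have hB' : (B : ℝ) = - A * r := by linarith
      rw [hB']
      linear_combination (-A ^ 3 : ℝ) * hr
    exact_mod_cast this
  obtain ⟨hB0, hA0⟩ := hF.eq_zero _ _ h2
  have hz : z = 0 := by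
    by_contra hz
    have h3 : z ^ 2 * cubicValue 1 b c d (b * z + y) (-z) = 0 := by
      unfold cubicValue
      linear_combination z ^ 2 * (b * z + y) * (hA.symm.trans hA0) + z ^ 3 * (hB.symm.trans hB0)
    have h4 := (mul_eq_zero.mp h3).resolve_left (pow_ne_zero 2 hz)
    exact hz (by simpa using (hF.eq_zero _ _ h4).2)
  subst hz
  have hy : y = 0 := by
    rw [hA] at hA0
    simpa using hA0
  subst hy
  have hx : x = 0 := by
    have : (x : ℝ) = 0 := by simpa using hu
    exact_mod_cast this
  subst hx
  rfl

theorem lift_injective (hF : IsComplexCubic 1 b c d) {r : ℝ}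
    (hr : r ^ 3 = b * r ^ 2 - c * r + d) : Function.Injective (lift (b := b) (c := c) r hr) :=
  (injective_iff_map_eq_zero _).mpr fun _ hu => eq_zero_of_lift_eq_zero hF hr hu

/-- Existence of the complex place. -/
theorem exists_complex_root (hF : IsComplexCubic 1 b c d) {r : ℝ}
    (hr : r ^ 3 = b * r ^ 2 - c * r + d) :
    ∃ (w : ℂ) (hw : w ^ 3 = b * w ^ 2 - c * w + d),
      ∀ u : CubicRing b c d, (u.norm : ℝ) = lift r hr u * Complex.normSq (lift w hw u) := by
  set p : ℝ := b - r with hp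
  set q : ℝ := c - r * p with hq
  have hpq : 0 < 4 * q - p ^ 2 := by
    have h1 : (p ^ 2 - 4 * q) * (r ^ 2 - p * r + q) ^ 2 = cubicDiscr 1 b c d := by
      unfold cubicDiscr
      have hd : (d : ℝ) = r ^ 3 - b * r ^ 2 + c * r := by linarith
      push_cast
      rw [hd, hq, hp]
      ring
    have h2 : ((cubicDiscr 1 b c d : ℤ) : ℝ) < 0 := by exact_mod_cast hF.discr_neg
    rw [← h1] at h2
    nlinarith [sq_nonneg (r ^ 2 - p * r + q)]
  set s := √(4 * q - p ^ 2) with hs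
  have hs2 : s ^ 2 = 4 * q - p ^ 2 := Real.sq_sqrt hpq.le
  have hd : (d : ℝ) = r * q := by rw [hq, hp]; linear_combination -hr
  have hb : (b : ℝ) = r + p := by rw [hp]; ring
  have hc : (c : ℝ) = q + r * p := by rw [hq]; ring
  have hwe : (⟨p / 2, s / 2⟩ : ℂ) ^ 2 = p * ⟨p / 2, s / 2⟩ - q := by
    apply Complex.ext
    · simp [pow_two]; linear_combination - hs2 / 4
    · simp [pow_two]; ring
  refine ⟨⟨p / 2, s / 2⟩, ?_, ?_⟩
  · generalize (⟨p / 2, s / 2⟩ : ℂ) = w at hwe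
    have hd' := congrArg (fun t : ℝ => (t : ℂ)) hd
    have hb' := congrArg (fun t : ℝ => (t : ℂ)) hb
    have hc' := congrArg (fun t : ℝ => (t : ℂ)) hc
    push_cast at hd' hb' hc'
    rw [hd', hb', hc']
    linear_combination (w - r) * hwe
  · intro u
    rw [lift_apply, lift_apply, hwe, Complex.normSq_apply]
    simp [norm]
    rw [hb, hc, hd]
    linear_combination
      (-(u.x + u.y * r + u.z * r ^ 2) * (u.y + u.z * p) ^ 2 / 4 : ℝ) * hs2

theorem lift_pos_of_solution (hF : IsComplexCubic 1 b c d) {r : ℝ}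
    (hr : r ^ 3 = b * r ^ 2 - c * r + d) {x y : ℤ} (h : cubicValue 1 b c d x y = 1) :
    0 < lift r hr (unitOfSolution h : CubicRing b c d) := by
  obtain ⟨w, hw, hN⟩ := exists_complex_root hF hr
  have h1 := hN (unitOfSolution h)
  have h2 : norm (unitOfSolution h : CubicRing b c d) = 1 := by
    rw [← h]
    simp [norm, cubicValue]
  rw [h2, Int.cast_one] at h1
  exact pos_of_mul_pos_left (h1 ▸ one_pos) (Complex.normSq_nonneg _)

theorem norm_eq_one_of_lift_pos (hF : IsComplexCubic 1 b c d) {r : ℝ}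
    (hr : r ^ 3 = b * r ^ 2 - c * r + d) (u : (CubicRing b c d)ˣ) (hu : 0 < lift r hr u) :
    norm (u : CubicRing b c d) = 1 := by
  obtain ⟨w, hw, hN⟩ := exists_complex_root hF hr
  have h1 : norm (u : CubicRing b c d) * norm ((u⁻¹ : (CubicRing b c d)ˣ) : CubicRing b c d)
      = 1 := by
    have h2 : ((norm (u : CubicRing b c d) * norm ((u⁻¹ : (CubicRing b c d)ˣ) : CubicRing b c d) :
        ℤ) : ℝ) = 1 := by
      rw [Int.cast_mul, hN, hN, mul_mul_mul_comm, ← map_mul, ← map_mul, ← map_mul,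
        Units.mul_inv]
      simp
    exact_mod_cast h2
  refine (Int.isUnit_iff.mp (IsUnit.of_mul_eq_one _ h1)).resolve_right fun h => ?_
  have := hN u
  rw [h] at this
  have := mul_nonneg hu.le (Complex.normSq_nonneg (lift w hw u))
  push_cast at *
  linarith

theorem le_lift_of_one_lt (hF : IsComplexCubic 1 b c d) {r : ℝ}
    (hr : r ^ 3 = b * r ^ 2 - c * r + d) (u : (CubicRing b c d)ˣ) (hu : 1 < lift r hr u) :
    5 / 4 ≤ lift r hr u := by
  obtain ⟨w, hw, hN⟩ := exists_complex_root hF hr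
  have h3 := norm_eq_one_of_lift_pos hF hr u (zero_lt_one.trans hu)
  have h4 := hN u
  rw [h3, Int.cast_one] at h4
  set a := lift r hr (u : CubicRing b c d) with ha
  set v := lift w hw (u : CubicRing b c d) with hv
  have hv0 := Complex.normSq_nonneg v
  have h5 : Complex.normSq v < 1 := by nlinarith
  have h6 : Complex.normSq (1 - v) < 4 ∧ 0 < Complex.normSq (1 - v) := by
    rw [Complex.normSq_eq_norm_sq] at h5 ⊢
    have h7 : ‖v‖ < 1 := by nlinarith [norm_nonneg v]
    have h8 : ‖1 - v‖ ≤ 1 + ‖v‖ := by simpa using norm_sub_le (1 : ℂ) v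
    have h9 : 1 - ‖v‖ ≤ ‖1 - v‖ := by simpa using norm_sub_norm_le (1 : ℂ) v
    constructor <;> nlinarith [norm_nonneg (1 - v), norm_nonneg v]
  have h7 := hN (1 - u)
  rw [map_sub, map_sub, map_one, map_one, ← ha, ← hv] at h7
  have h8 : norm (1 - u : CubicRing b c d) ≤ -1 := by
    have : ((norm (1 - u : CubicRing b c d) : ℤ) : ℝ) < 0 := by
      rw [h7]
      exact mul_neg_of_neg_of_pos (by linarith) h6.2
    have : norm (1 - u : CubicRing b c d) < 0 := by exact_mod_cast this
    omega
  have h9 : ((norm (1 - u : CubicRing b c d) : ℤ) : ℝ) ≤ -1 := by exact_mod_cast h8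
  rw [h7] at h9
  nlinarith [h6.1, h6.2]

/-- The units that are positive at the real place form a cyclic group. -/
theorem exists_fundamental_unit (hF : IsComplexCubic 1 b c d) {r : ℝ}
    (hr : r ^ 3 = b * r ^ 2 - c * r + d) :
    ∃ ε : (CubicRing b c d)ˣ, 0 < lift r hr ε ∧
      ∀ u : (CubicRing b c d)ˣ, 0 < lift r hr u → ∃ k : ℤ, u = ε ^ k := by
  let S : AddSubgroup ℝ :=
    { carrier := {t | ∃ u : (CubicRing b c d)ˣ, 0 < lift r hr u ∧ Real.log (lift r hr u) = t}
      zero_mem' := ⟨1, by simp⟩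
      add_mem' := by
        rintro _ _ ⟨u, hu, rfl⟩ ⟨v, hv, rfl⟩
        exact ⟨u * v, by simpa using mul_pos hu hv, by
          rw [Units.val_mul, map_mul, Real.log_mul hu.ne' hv.ne']⟩
      neg_mem' := by
        rintro _ ⟨u, hu, rfl⟩
        have h1 : lift r hr (u⁻¹ : (CubicRing b c d)ˣ) = (lift r hr u)⁻¹ :=
          eq_inv_of_mul_eq_one_left (by rw [← map_mul, Units.inv_mul, map_one])
        exact ⟨u⁻¹, by rw [h1]; exact inv_pos.mpr hu, by rw [h1, Real.log_inv]⟩ }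
  have hdisj : Disjoint (S : Set ℝ) (Set.Ioo 0 (Real.log (5 / 4))) := by
    rw [Set.disjoint_left]
    rintro _ ⟨u, hu, rfl⟩ ⟨h1, h2⟩
    have h3 := le_lift_of_one_lt hF hr u ((Real.log_pos_iff hu.le).mp h1)
    exact absurd h2 (not_lt.mpr (Real.log_le_log (by norm_num) h3))
  obtain ⟨t, ht⟩ := AddSubgroup.cyclic_of_isolated_zero (Real.log_pos (by norm_num)) hdisj
  obtain ⟨ε, hε, rfl⟩ : t ∈ S := ht ▸ AddSubgroup.subset_closure rfl
  refine ⟨ε, hε, fun u hu => ?_⟩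
  have h1 : Real.log (lift r hr u) ∈ S := ⟨u, hu, rfl⟩
  rw [ht, AddSubgroup.mem_closure_singleton] at h1
  obtain ⟨k, hk⟩ := h1
  refine ⟨k, Units.ext (lift_injective hF hr ?_)⟩
  have h2 : ((lift r hr (ε ^ k : (CubicRing b c d)ˣ)) : ℝ) = (lift r hr ε) ^ k := by
    have := map_zpow (Units.map (lift (b := b) (c := c) (d := d) r hr).toMonoidHom) ε k
    exact (congrArg Units.val this).trans (Units.val_zpow_eq_zpow_val _ _)
  rw [h2]
  apply Real.log_injOn_pos hu (zpow_pos hε k)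
  rw [Real.log_zpow, ← hk]
  simp

end CubicRing

theorem Int.eq_zero_of_forall_pow_dvd {p : ℕ} (hp : p.Prime) {a : ℤ}
    (h : ∀ N : ℕ, (p : ℤ) ^ N ∣ a) : a = 0 := by
  refine Int.eq_zero_of_abs_lt_dvd (h a.natAbs) ?_
  rw [Int.abs_eq_natAbs]
  exact_mod_cast Nat.lt_pow_self hp.one_lt

namespace CubicRing

variable {b c d : ℤ}

theorem z_mul_pow (w : CubicRing b c d) (x y : ℤ) (m : ℕ) :
    zHom b c d (w * ⟨x, y, 0⟩ ^ m) =
      ∑ n ∈ Finset.range (m + 1), (m.choose n : ℤ) * x ^ (m - n) * y ^ n * (w * θ b c d ^ n).z := by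
  have h1 : (⟨x, y, 0⟩ : CubicRing b c d) = y * θ b c d + x := by
    ext <;> simp [θ]
  rw [h1, add_pow, Finset.mul_sum, map_sum]
  refine Finset.sum_congr rfl fun n _ => ?_
  have h2 : w * ((y * θ b c d) ^ n * (x : CubicRing b c d) ^ (m - n) *
        (m.choose n : CubicRing b c d)) =
      (((m.choose n : ℤ) * x ^ (m - n) * y ^ n : ℤ) : CubicRing b c d) * (w * θ b c d ^ n) := by
    push_cast
    ring
  rw [h2, ← zsmul_eq_mul, map_zsmul, smul_eq_mul]
  rfl

theorem natCast_dvd_sub_intCast {p : ℕ} {u : CubicRing b c d} {n : ℤ} (hx : (p : ℤ) ∣ u.x - n)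
    (hy : (p : ℤ) ∣ u.y) (hz : (p : ℤ) ∣ u.z) : (p : CubicRing b c d) ∣ u - n := by
  obtain ⟨i, hi⟩ := hx
  obtain ⟨j, hj⟩ := hy
  obtain ⟨k, hk⟩ := hz
  refine ⟨⟨i, j, k⟩, ?_⟩
  rw [← Int.cast_natCast (R := CubicRing b c d) p, sub_eq_add_neg]
  ext
  · simp [-Int.cast_natCast]; linarith
  · simp [-Int.cast_natCast]; linarith
  · simp [-Int.cast_natCast]; linarith

theorem lift_zpow {r : ℝ} (hr : r ^ 3 = b * r ^ 2 - c * r + d) (u : (CubicRing b c d)ˣ) (k : ℤ) :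
    lift r hr ((u ^ k : (CubicRing b c d)ˣ) : CubicRing b c d) = lift r hr u ^ k :=
  (congrArg Units.val (map_zpow (Units.map (lift (b := b) (c := c) (d := d) r hr).toMonoidHom)
    u k)).trans (Units.val_zpow_eq_zpow_val _ _)

end CubicRing

theorem not_dvd_of_cubicValue_eq_one {p : ℕ} (hp : p.Prime) {a b c d x y : ℤ}
    (h : cubicValue a b c d x y = 1) (hy : (p : ℤ) ∣ y) : ¬ (p : ℤ) ∣ x := by
  intro hx
  have hp' : Prime (p : ℤ) := Nat.prime_iff_prime_int.mp hp
  refine hp'.not_dvd_one (h ▸ ?_)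
  obtain ⟨i, rfl⟩ := hx
  obtain ⟨j, rfl⟩ := hy
  unfold cubicValue
  exact ⟨p ^ 2 * (a * i ^ 3 + b * i ^ 2 * j + c * i * j ^ 2 + d * j ^ 3), by ring⟩

theorem zpow_left_injective_of_pos {x y : ℝ} (hx : 0 < x) (hy : 0 < y) {k : ℤ} (hk : k ≠ 0)
    (h : x ^ k = y ^ k) : x = y := by
  apply Real.log_injOn_pos hx hy
  have := congrArg Real.log h
  rw [Real.log_zpow, Real.log_zpow] at this
  exact mul_left_cancel₀ (by exact_mod_cast hk) this

theorem nine_dvd_or_three_dvd {b c d x y : ℤ} (h : cubicValue 1 b c d x y = 1)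
    (hy : (3 : ℤ) ∣ y) : (9 : ℤ) ∣ y ∨ (3 : ℤ) ∣ b := by
  obtain ⟨z, rfl⟩ := hy
  unfold cubicValue at h
  have hx : x % 3 = 1 := by
    have h1 : x ^ 3 % 3 = 1 := by
      have : x ^ 3 = 1 + 3 * (-(b * x ^ 2 * z + 3 * c * x * z ^ 2 + 9 * d * z ^ 3)) := by
        linear_combination h
      omega
    have : x % 3 = 0 ∨ x % 3 = 1 ∨ x % 3 = 2 := by omega
    rcases this with h2 | h2 | h2 <;> simp [pow_succ, Int.mul_emod, h2] at h1 ⊢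
  obtain ⟨w, rfl⟩ : ∃ w, x = 1 + 3 * w := ⟨x / 3, by omega⟩
  have h3 : (3 : ℤ) ∣ b * z :=
    ⟨-(w + 3 * w ^ 2 + 3 * w ^ 3 + b * z * (2 * w + 3 * w ^ 2) + c * (1 + 3 * w) * z ^ 2
      + 3 * d * z ^ 3), by linarith⟩
  rcases Int.prime_three.dvd_or_dvd h3 with h4 | ⟨v, rfl⟩
  · exact Or.inr h4
  · exact Or.inl ⟨v, by ring⟩

section Monic

open CubicRing

variable {b c d : ℤ}

theorem lift_unitOfSolution {r : ℝ} (hr : r ^ 3 = b * r ^ 2 - c * r + d) {x y : ℤ}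
    (h : cubicValue 1 b c d x y = 1) :
    lift r hr (unitOfSolution h : CubicRing b c d) = x + y * r := by
  simp [lift_apply]

theorem three_solutions_monic (hF : IsComplexCubic 1 b c d) {r : ℝ}
    (hr : r ^ 3 = b * r ^ 2 - c * r + d) {p : ℕ} (hp : p.Prime) {x y X Y k l : ℤ}
    (h₂ : cubicValue 1 b c d x y = 1) (h₃ : cubicValue 1 b c d X Y = 1)
    (hy : (p : ℤ) ∣ y) (hY : (p : ℤ) ∣ Y) (hy0 : y ≠ 0) (hY0 : Y ≠ 0) (hne : (x, y) ≠ (X, Y))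
    (hk : ¬ (p : ℤ) ∣ k) (hkl : (X + Y * r) ^ k = (x + y * r) ^ l) : False := by
  have hφ := lift_injective hF hr
  have hu : unitOfSolution h₃ ^ k = unitOfSolution h₂ ^ l := by
    refine Units.ext (hφ ?_)
    rw [lift_zpow, lift_zpow, lift_unitOfSolution, lift_unitOfSolution, hkl]
  have hk0 : k ≠ 0 := by rintro rfl; exact hk (dvd_zero _)
  have hinj : ∀ {v w : (CubicRing b c d)ˣ}, 0 < lift r hr v → 0 < lift r hr w → v ^ k = w ^ k →
      v = w := by
    intro v w hv hw h
    refine Units.ext (hφ (zpow_left_injective_of_pos hv hw hk0 ?_))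
    rw [← lift_zpow, ← lift_zpow, h]
  have key : l * (l - k) * y ^ 2 = 0 := by
    refine Int.eq_zero_of_forall_pow_dvd hp fun N => ?_
    obtain ⟨m, hm, hZ⟩ := exists_pow_dvd_map_mul_pow hp (x := x) (y := X) hu hk
      (natCast_dvd_sub_intCast (by simp) (by simpa using hy) (by simp))
      (natCast_dvd_sub_intCast (by simp) (by simpa using hY) (by simp))
      (not_dvd_of_cubicValue_eq_one hp h₃ hY) (zHom b c d) 1 (by simp [zHom]) N
    rw [val_unitOfSolution, z_mul_pow] at hZ
    have h4 := pow_dvd_of_dvd_sum_choose_second hp (not_dvd_of_cubicValue_eq_one hp h₂ hy) hy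
      (by simp) (by simp [θ]) (by simp [θ, pow_succ]) (by
        rcases eq_or_ne p 3 with rfl | h3
        · refine Or.inr ((nine_dvd_or_three_dvd h₂ hy).imp id fun h => ?_)
          simpa [θ, pow_succ] using h
        · exact Or.inl h3) hZ
    obtain ⟨i, hi⟩ := hm
    obtain ⟨j, hj⟩ := h4
    exact ⟨k ^ 2 * j - i * (l + k * m - k) * y ^ 2, by
      linear_combination k ^ 2 * hj - (l + k * m - k) * y ^ 2 * hi⟩
  have h2pos := lift_pos_of_solution hF hr h₂
  have h3pos := lift_pos_of_solution hF hr h₃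
  rcases mul_eq_zero.mp ((mul_eq_zero.mp key).resolve_right (pow_ne_zero 2 hy0)) with hl | hl
  · rw [hl, zpow_zero, ← one_zpow k] at hu
    have := congrArg (fun u : (CubicRing b c d)ˣ => (u : CubicRing b c d).y)
      (hinj h3pos (by simp) hu)
    exact hY0 (by simpa using this)
  · rw [sub_eq_zero.mp hl] at hu
    have := congrArg (fun u : (CubicRing b c d)ˣ => (u : CubicRing b c d)) (hinj h3pos h2pos hu)
    simp only [val_unitOfSolution, CubicRing.mk.injEq] at this
    exact hne (by rw [this.1, this.2.1])

theorem four_solutions_monic (hF : IsComplexCubic 1 b c d) {r : ℝ}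
    (hr : r ^ 3 = b * r ^ 2 - c * r + d) {p : ℕ} (hp : p.Prime) {x y A B A' B' k l : ℤ}
    (h₂ : cubicValue 1 b c d x y = 1) (h₃ : cubicValue 1 b c d A B = 1)
    (h₄ : cubicValue 1 b c d A' B' = 1) (hy : (p : ℤ) ∣ y) (hB : ¬ (p : ℤ) ∣ B)
    (hD : (p : ℤ) ∣ A * B' - B * A') (hy0 : y ≠ 0) (hne : (A, B) ≠ (A', B'))
    (hcond : p ≠ 2 ∨ (4 : ℤ) ∣ y ∨ (2 : ℤ) ∣ A + B * b)
    (hk : ¬ (p : ℤ) ∣ k) (hkl : ((A' + B' * r) / (A + B * r)) ^ k = (x + y * r) ^ l) : False := by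
  have hφ := lift_injective hF hr
  have hp' : Prime (p : ℤ) := Nat.prime_iff_prime_int.mp hp
  have h3pos := lift_pos_of_solution hF hr h₃
  have h4pos := lift_pos_of_solution hF hr h₄
  have hdiv : lift r hr ((unitOfSolution h₄ / unitOfSolution h₃ : (CubicRing b c d)ˣ)) =
      (A' + B' * r) / (A + B * r) := by
    rw [← lift_unitOfSolution hr h₃, ← lift_unitOfSolution hr h₄, eq_div_iff h3pos.ne', ← map_mul,
      ← Units.val_mul, div_mul_cancel]
  have hu : (unitOfSolution h₄ / unitOfSolution h₃) ^ k = unitOfSolution h₂ ^ l := by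
    refine Units.ext (hφ ?_)
    rw [lift_zpow, lift_zpow, lift_unitOfSolution, hdiv, hkl]
  have hk0 : k ≠ 0 := by rintro rfl; exact hk (dvd_zero _)
  obtain ⟨n, hn⟩ : ∃ n : ℤ, (p : ℤ) ∣ B' - n * B := by
    obtain ⟨i, j, hij⟩ := (hp'.irreducible.coprime_iff_not_dvd.mpr hB)
    exact ⟨B' * j, B' * i, by linear_combination (-B') * hij⟩
  have hn' : (p : ℤ) ∣ A' - n * A := by
    refine (hp'.dvd_or_dvd (a := B) ?_).resolve_left hB
    obtain ⟨i, hi⟩ := hn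
    obtain ⟨j, hj⟩ := hD
    exact ⟨A * i - j, by linear_combination A * hi - hj⟩
  have hnp : ¬ (p : ℤ) ∣ n := by
    intro h
    refine not_dvd_of_cubicValue_eq_one hp h₄ ?_ ?_
    · exact (dvd_sub_left (Dvd.dvd.mul_right h B)).mp hn
    · exact (dvd_sub_left (Dvd.dvd.mul_right h A)).mp hn'
  have key : l * y = 0 := by
    refine Int.eq_zero_of_forall_pow_dvd hp fun N => ?_
    obtain ⟨m, hm, hZ⟩ := exists_pow_dvd_map_mul_pow hp (x := x) (y := n) hu hk
      (natCast_dvd_sub_intCast (by simp) (by simpa using hy) (by simp))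
      (by
        have h5 : ((unitOfSolution h₄ / unitOfSolution h₃ : (CubicRing b c d)ˣ) : CubicRing b c d)
            - n = (unitOfSolution h₄ - n * unitOfSolution h₃) *
              ((unitOfSolution h₃)⁻¹ : (CubicRing b c d)ˣ) := by
          rw [sub_mul, mul_assoc, Units.mul_inv, mul_one, div_eq_mul_inv, Units.val_mul]
        rw [h5]
        refine Dvd.dvd.mul_right ?_ _
        have := natCast_dvd_sub_intCast (b := b) (c := c) (d := d) (p := p) (n := 0)
          (u := (unitOfSolution h₄ - n * unitOfSolution h₃ : CubicRing b c d))
        simp only [Int.cast_zero, sub_zero] at this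
        refine this ?_ ?_ ?_
        · simpa [sub_eq_add_neg] using hn'
        · simpa [sub_eq_add_neg] using hn
        · simp [sub_eq_add_neg])
      hnp (zHom b c d) (unitOfSolution h₃) (by
        rw [← Units.val_mul, mul_div_cancel]
        simp [zHom]) N
    rw [val_unitOfSolution h₂, z_mul_pow] at hZ
    have h4 := pow_dvd_of_dvd_sum_choose_first hp (not_dvd_of_cubicValue_eq_one hp h₂ hy) hy
      (by simp) (by simpa [θ] using hB) (by simpa [θ, pow_succ, mul_comm b] using hcond) hZ
    obtain ⟨i, hi⟩ := hm
    obtain ⟨j, hj⟩ := h4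
    exact ⟨k * j - i * y, by linear_combination k * hj - y * hi⟩
  have hl := (mul_eq_zero.mp key).resolve_right hy0
  rw [hl, zpow_zero] at hkl
  have h5 := zpow_left_injective_of_pos (by
    rw [← lift_unitOfSolution hr h₃, ← lift_unitOfSolution hr h₄]
    exact div_pos h4pos h3pos) one_pos hk0 (hkl.trans (one_zpow k).symm)
  rw [← lift_unitOfSolution hr h₃, ← lift_unitOfSolution hr h₄, div_eq_one_iff_eq h3pos.ne'] at h5
  have h6 := hφ h5
  simp only [val_unitOfSolution, CubicRing.mk.injEq] at h6
  exact hne (by rw [h6.1, h6.2.1])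

end Monic

/-- The `x ^ 2 * y`-coefficient of the form after the substitution
`x ↦ α * x + β * y`, `y ↦ γ * x + δ * y`. -/
def cubicSubstB (a b c d α β γ δ : ℤ) : ℤ :=
  3 * a * α ^ 2 * β + b * (2 * α * β * γ + α ^ 2 * δ) + c * (β * γ ^ 2 + 2 * α * γ * δ)
    + 3 * d * γ ^ 2 * δ

/-- The `x * y ^ 2`-coefficient of the form after the substitution
`x ↦ α * x + β * y`, `y ↦ γ * x + δ * y`. -/
def cubicSubstC (a b c d α β γ δ : ℤ) : ℤ :=
  3 * a * α * β ^ 2 + b * (β ^ 2 * γ + 2 * α * β * δ) + c * (2 * β * γ * δ + α * δ ^ 2)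
    + 3 * d * γ * δ ^ 2

theorem cubicValue_subst (a b c d α β γ δ x y : ℤ) :
    cubicValue (cubicValue a b c d α γ) (cubicSubstB a b c d α β γ δ)
      (cubicSubstC a b c d α β γ δ) (cubicValue a b c d β δ) x y =
      cubicValue a b c d (α * x + β * y) (γ * x + δ * y) := by
  unfold cubicValue cubicSubstB cubicSubstC
  ring

theorem cubicDiscr_subst (a b c d α β γ δ : ℤ) :
    cubicDiscr (cubicValue a b c d α γ) (cubicSubstB a b c d α β γ δ)
      (cubicSubstC a b c d α β γ δ) (cubicValue a b c d β δ) =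
      (α * δ - β * γ) ^ 6 * cubicDiscr a b c d := by
  unfold cubicDiscr cubicValue cubicSubstB cubicSubstC
  ring

theorem IsComplexCubic.subst {a b c d : ℤ} (hF : IsComplexCubic a b c d) {α β γ δ : ℤ}
    (hdet : (α * δ - β * γ) ^ 2 = 1) :
    IsComplexCubic (cubicValue a b c d α γ) (cubicSubstB a b c d α β γ δ)
      (cubicSubstC a b c d α β γ δ) (cubicValue a b c d β δ) where
  eq_zero x y h := by
    rw [cubicValue_subst] at h
    obtain ⟨h1, h2⟩ := hF.eq_zero _ _ h
    constructor
    · linear_combination (α * δ - β * γ) * δ * h1 - (α * δ - β * γ) * β * h2 - x * hdet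
    · linear_combination (α * δ - β * γ) * α * h2 - (α * δ - β * γ) * γ * h1 - y * hdet
  discr_neg := by
    rw [cubicDiscr_subst, show (6 : ℕ) = 2 * 3 from rfl, pow_mul, hdet, one_pow, one_mul]
    exact hF.discr_neg

theorem isCoprime_of_cubicValue_eq_one {a b c d m n : ℤ} (h : cubicValue a b c d m n = 1) :
    IsCoprime m n :=
  ⟨a * m ^ 2 + b * m * n + c * n ^ 2, d * n ^ 2, by unfold cubicValue at h; linear_combination h⟩

theorem IsComplexCubic.exists_monic {a b c d m n : ℤ} (hF : IsComplexCubic a b c d)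
    (h : cubicValue a b c d m n = 1) {s t : ℝ}
    (hst : a * (-t) ^ 3 + b * (-t) ^ 2 * s + c * (-t) * s ^ 2 + d * s ^ 3 = 0)
    (hL : s * m + t * n ≠ 0) :
    ∃ (b' c' d' β δ : ℤ) (r : ℝ), m * δ - β * n = 1 ∧ IsComplexCubic 1 b' c' d' ∧
      r ^ 3 = b' * r ^ 2 - c' * r + d' ∧
      (∀ x y, cubicValue 1 b' c' d' (δ * x - β * y) (m * y - n * x) = cubicValue a b c d x y) ∧
      cubicDiscr 1 b' c' d' = cubicDiscr a b c d ∧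
      ∀ x y : ℤ, ((δ * x - β * y : ℤ) : ℝ) + ((m * y - n * x : ℤ) : ℝ) * r =
        (s * x + t * y) / (s * m + t * n) := by
  obtain ⟨u, v, huv⟩ := isCoprime_of_cubicValue_eq_one h
  have hdet : m * u - (-v) * n = 1 := by linear_combination huv
  have h1 := hF.subst (α := m) (β := -v) (γ := n) (δ := u) (by rw [hdet, one_pow])
  have h2 := cubicDiscr_subst a b c d m (-v) n u
  have h3 := cubicValue_subst a b c d m (-v) n u
  rw [h] at h1 h2 h3
  rw [hdet, one_pow, one_mul] at h2
  have hdetR : (m : ℝ) * u + v * n = 1 := by exact_mod_cast (by linear_combination huv)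
  refine ⟨_, _, _, -v, u, (-s * v + t * u) / (s * m + t * n), hdet, h1, ?_, ?_, h2, ?_⟩
  · set l := s * m + t * n with hl
    set r := (-s * v + t * u) / l with hr
    have e1 : m * r + v = t / l := by
      rw [hr]; field_simp; rw [hl]; linear_combination t * hdetR
    have e2 : n * r - u = -s / l := by
      rw [hr]; field_simp; rw [hl]; linear_combination -s * hdetR
    have e3 : a * (m * r + v) ^ 3 + b * (m * r + v) ^ 2 * (n * r - u)
        + c * (m * r + v) * (n * r - u) ^ 2 + d * (n * r - u) ^ 3 = 0 := by
      rw [e1, e2]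
      field_simp
      linear_combination -hst
    have h4 : ((cubicValue a b c d m n : ℤ) : ℝ) = 1 := by exact_mod_cast h
    unfold cubicSubstB cubicSubstC
    unfold cubicValue at h4 ⊢
    push_cast at h4 ⊢
    linear_combination e3 - r ^ 3 * h4
  · intro x y
    rw [h3]
    congr 1
    · linear_combination x * huv
    · linear_combination y * huv
  · intro x y
    rw [eq_div_iff hL]
    field_simp
    push_cast
    linear_combination (s * x + t * y) * hdetR

/-- A linear factor `s * x + t * y` of the real form which takes powers of `e` at all the solutions
of the Thue equation. -/
structure IsPowerFactor (a b c d : ℤ) (s t e : ℝ) : Prop where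
  pos : 0 < e
  root : a * (-t) ^ 3 + b * (-t) ^ 2 * s + c * (-t) * s ^ 2 + d * s ^ 3 = 0
  exists_zpow : ∀ x y : ℤ, cubicValue a b c d x y = 1 → ∃ k : ℤ, s * x + t * y = e ^ k

theorem IsComplexCubic.exists_isPowerFactor {a b c d m n : ℤ} (hF : IsComplexCubic a b c d)
    (h : cubicValue a b c d m n = 1) : ∃ s t e : ℝ, IsPowerFactor a b c d s t e := by
  have ha : (a : ℝ) ≠ 0 := by
    rintro h0
    have := hF.eq_zero 1 0 (by unfold cubicValue; simpa using h0)
    simp at this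
  obtain ⟨ρ, hρ⟩ := exists_real_root_cubic (-b / a) (c / a) (-d / a)
  field_simp at hρ
  have hL : (1 : ℝ) * m + (-ρ) * n ≠ 0 := by
    intro h0
    have h1 : ((cubicValue a b c d m n : ℤ) : ℝ) = 1 := by exact_mod_cast h
    have h2 : (m : ℝ) = ρ * n := by linarith
    unfold cubicValue at h1
    push_cast at h1
    rw [h2] at h1
    exact one_ne_zero (α := ℝ) (by linear_combination -h1 + n ^ 3 * hρ)
  obtain ⟨b', c', d', β, δ, r, -, hF', hr, hval, -, hlin⟩ := hF.exists_monic h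
    (s := 1) (t := -ρ) (by linear_combination hρ) hL
  obtain ⟨ε, hε, hgen⟩ := CubicRing.exists_fundamental_unit hF' hr
  refine ⟨1 / (1 * m + (-ρ) * n), (-ρ) / (1 * m + (-ρ) * n), CubicRing.lift r hr ε, hε, ?_, ?_⟩
  · linear_combination (1 / (1 * m + (-ρ) * n)) ^ 3 * hρ
  · intro x y hxy
    rw [← hval] at hxy
    obtain ⟨k, hk⟩ := hgen _ (CubicRing.lift_pos_of_solution hF' hr hxy)
    refine ⟨k, ?_⟩
    rw [← CubicRing.lift_zpow, ← hk, lift_unitOfSolution, hlin]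
    ring

/-- The determinant of two integral vectors. -/
def cross (q q' : ℤ × ℤ) : ℤ := q.1 * q'.2 - q.2 * q'.1

theorem eq_one_of_cubicValue_zero {b c d x : ℤ} (h : cubicValue 1 b c d x 0 = 1) : x = 1 := by
  have h1 : x ^ 3 = 1 := by simpa [cubicValue] using h
  exact (Odd.strictMono_pow (by decide : Odd 3)).injective (by simpa using h1)

theorem exists_mul_eq_mul_of_prime {p : ℕ} (hp : p.Prime) (K L : ℤ) :
    ∃ k l : ℤ, L * k = K * l ∧ (¬ (p : ℤ) ∣ k ∨ ¬ (p : ℤ) ∣ l) := by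
  have hp' : Prime (p : ℤ) := Nat.prime_iff_prime_int.mp hp
  by_cases h0 : K = 0 ∧ L = 0
  · exact ⟨1, 1, by simp [h0.1, h0.2], Or.inl hp'.not_dvd_one⟩
  · obtain ⟨g, k, l, -, hco, hK, hL⟩ := Int.exists_gcd_one' (m := K) (n := L)
      (Int.gcd_pos_iff.mpr (by tauto))
    refine ⟨k, l, by rw [hK, hL]; ring, ?_⟩
    by_contra! hc
    exact hp'.not_dvd_one (by
      have := Int.dvd_coe_gcd hc.1 hc.2
      rwa [hco] at this)

section General

variable {a b c d : ℤ} {s t e : ℝ}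

theorem three_solutions_of_zpow (hF : IsComplexCubic a b c d) (hP : IsPowerFactor a b c d s t e)
    {p : ℕ} (hp : p.Prime) {q₁ q₂ q₃ : ℤ × ℤ} {k l : ℤ} (h₁ : cubicValue a b c d q₁.1 q₁.2 = 1)
    (h₂ : cubicValue a b c d q₂.1 q₂.2 = 1) (h₃ : cubicValue a b c d q₃.1 q₃.2 = 1)
    (h₁₂ : (p : ℤ) ∣ cross q₁ q₂) (h₁₃ : (p : ℤ) ∣ cross q₁ q₃) (n₁₂ : q₁ ≠ q₂) (n₁₃ : q₁ ≠ q₃)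
    (n₂₃ : q₂ ≠ q₃) (hk : ¬ (p : ℤ) ∣ k)
    (hkl : ((s * q₃.1 + t * q₃.2) / (s * q₁.1 + t * q₁.2)) ^ k =
      ((s * q₂.1 + t * q₂.2) / (s * q₁.1 + t * q₁.2)) ^ l) : False := by
  obtain ⟨k₁, hk₁⟩ := hP.exists_zpow _ _ h₁
  obtain ⟨b', c', d', β, δ, r, hdet, hF', hr, hval, -, hlin⟩ := hF.exists_monic h₁ hP.root
    (hk₁ ▸ (zpow_pos hP.pos k₁).ne')
  rw [← hlin, ← hlin] at hkl
  rw [← hval] at h₂ h₃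
  have hback : ∀ q : ℤ × ℤ, q₁.1 * (δ * q.1 - β * q.2) + β * (q₁.1 * q.2 - q₁.2 * q.1) = q.1 ∧
      q₁.2 * (δ * q.1 - β * q.2) + δ * (q₁.1 * q.2 - q₁.2 * q.1) = q.2 := fun q =>
    ⟨by linear_combination q.1 * hdet, by linear_combination q.2 * hdet⟩
  have hne : ∀ q : ℤ × ℤ, cubicValue 1 b' c' d' (δ * q.1 - β * q.2) (q₁.1 * q.2 - q₁.2 * q.1) = 1 →
      q₁ ≠ q → q₁.1 * q.2 - q₁.2 * q.1 ≠ 0 := by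
    intro q hq hqn h0
    rw [h0] at hq
    have h1 := eq_one_of_cubicValue_zero hq
    have h2 := hback q
    rw [h0, h1] at h2
    exact hqn (Prod.ext (by linarith [h2.1]) (by linarith [h2.2]))
  refine three_solutions_monic hF' hr hp h₂ h₃ h₁₂ h₁₃ (hne _ h₂ n₁₂) (hne _ h₃ n₁₃) ?_ hk hkl
  intro h
  obtain ⟨e1, e2⟩ := Prod.mk.injEq .. ▸ h
  have h2 := hback q₂
  rw [e1, e2, (hback q₃).1, (hback q₃).2] at h2
  exact n₂₃ (Prod.ext h2.1.symm h2.2.symm)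

/-- Three distinct solutions cannot be proportional modulo a prime. -/
theorem IsComplexCubic.three_solutions (hF : IsComplexCubic a b c d)
    {p : ℕ} (hp : p.Prime) {q₁ q₂ q₃ : ℤ × ℤ} (h₁ : cubicValue a b c d q₁.1 q₁.2 = 1)
    (h₂ : cubicValue a b c d q₂.1 q₂.2 = 1) (h₃ : cubicValue a b c d q₃.1 q₃.2 = 1)
    (h₁₂ : (p : ℤ) ∣ cross q₁ q₂) (h₁₃ : (p : ℤ) ∣ cross q₁ q₃) (n₁₂ : q₁ ≠ q₂) (n₁₃ : q₁ ≠ q₃)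
    (n₂₃ : q₂ ≠ q₃) : False := by
  obtain ⟨s, t, e, hP⟩ := hF.exists_isPowerFactor h₁
  obtain ⟨k₁, hk₁⟩ := hP.exists_zpow _ _ h₁
  obtain ⟨k₂, hk₂⟩ := hP.exists_zpow _ _ h₂
  obtain ⟨k₃, hk₃⟩ := hP.exists_zpow _ _ h₃
  obtain ⟨k, l, hkl, hd⟩ := exists_mul_eq_mul_of_prime hp (k₂ - k₁) (k₃ - k₁)
  have key : ((s * q₃.1 + t * q₃.2) / (s * q₁.1 + t * q₁.2)) ^ k =
      ((s * q₂.1 + t * q₂.2) / (s * q₁.1 + t * q₁.2)) ^ l := by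
    rw [hk₁, hk₂, hk₃, ← zpow_sub₀ hP.pos.ne', ← zpow_sub₀ hP.pos.ne', ← zpow_mul, ← zpow_mul, hkl]
  rcases hd with hd | hd
  · exact three_solutions_of_zpow hF hP hp h₁ h₂ h₃ h₁₂ h₁₃ n₁₂ n₁₃ n₂₃ hd key
  · exact three_solutions_of_zpow hF hP hp h₁ h₃ h₂ h₁₃ h₁₂ n₁₃ n₁₂ n₂₃.symm hd key.symm

theorem two_dvd_add_mul {b c d x y : ℤ} (h : cubicValue 1 b c d x y = 1) (hy : ¬ (2 : ℤ) ∣ y)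
    (h' : (2 : ℤ) ∣ cubicValue 1 b c d (1 + x) y) (hD : ¬ (2 : ℤ) ∣ cubicDiscr 1 b c d) :
    (2 : ℤ) ∣ x + y * b := by
  have hz : ∀ z : ℤ, (2 : ℤ) ∣ z ↔ ((z : ℤ) : ZMod 2) = 0 := fun z =>
    ((ZMod.intCast_zmod_eq_zero_iff_dvd z 2)).symm
  have h1 : ((cubicValue 1 b c d x y : ℤ) : ZMod 2) = 1 := by rw [h]; simp
  rw [hz] at *
  unfold cubicValue at *
  unfold cubicDiscr at hD
  push_cast at *
  generalize (b : ZMod 2) = b at *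
  generalize (c : ZMod 2) = c at *
  generalize (d : ZMod 2) = d at *
  generalize (x : ZMod 2) = x at *
  generalize (y : ZMod 2) = y at *
  revert b c d x y
  decide

theorem four_solutions_of_zpow (hF : IsComplexCubic a b c d) (hP : IsPowerFactor a b c d s t e)
    {p : ℕ} (hp : p.Prime) {q₁ q₂ q₃ q₄ : ℤ × ℤ} {k l : ℤ} (h₁ : cubicValue a b c d q₁.1 q₁.2 = 1)
    (h₂ : cubicValue a b c d q₂.1 q₂.2 = 1) (h₃ : cubicValue a b c d q₃.1 q₃.2 = 1)
    (h₄ : cubicValue a b c d q₄.1 q₄.2 = 1)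
    (h₁₂ : (p : ℤ) ∣ cross q₁ q₂) (h₃₄ : (p : ℤ) ∣ cross q₃ q₄) (h₁₃ : ¬ (p : ℤ) ∣ cross q₁ q₃)
    (n₁₂ : q₁ ≠ q₂) (n₃₄ : q₃ ≠ q₄)
    (hcond : p ≠ 2 ∨ (4 : ℤ) ∣ cross q₁ q₂ ∨
      ((2 : ℤ) ∣ cubicValue a b c d (q₁.1 + q₃.1) (q₁.2 + q₃.2) ∧ ¬ (2 : ℤ) ∣ cubicDiscr a b c d))
    (hk : ¬ (p : ℤ) ∣ k)
    (hkl : ((s * q₄.1 + t * q₄.2) / (s * q₃.1 + t * q₃.2)) ^ k =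
      ((s * q₂.1 + t * q₂.2) / (s * q₁.1 + t * q₁.2)) ^ l) : False := by
  obtain ⟨k₁, hk₁⟩ := hP.exists_zpow _ _ h₁
  have hL := (hk₁ ▸ (zpow_pos hP.pos k₁).ne' : s * q₁.1 + t * q₁.2 ≠ 0)
  obtain ⟨b', c', d', β, δ, r, hdet, hF', hr, hval, hdisc, hlin⟩ := hF.exists_monic h₁ hP.root hL
  have hdiv : (s * q₄.1 + t * q₄.2) / (s * q₃.1 + t * q₃.2) =
    ((s * q₄.1 + t * q₄.2) / (s * q₁.1 + t * q₁.2)) /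
      ((s * q₃.1 + t * q₃.2) / (s * q₁.1 + t * q₁.2)) := by
    rw [div_div_div_cancel_right₀ hL]
  rw [hdiv, ← hlin, ← hlin, ← hlin] at hkl
  rw [← hval] at h₂ h₃ h₄
  have hback : ∀ q : ℤ × ℤ, q₁.1 * (δ * q.1 - β * q.2) + β * (q₁.1 * q.2 - q₁.2 * q.1) = q.1 ∧
      q₁.2 * (δ * q.1 - β * q.2) + δ * (q₁.1 * q.2 - q₁.2 * q.1) = q.2 := fun q =>
    ⟨by linear_combination q.1 * hdet, by linear_combination q.2 * hdet⟩
  have h₁₃' : ¬ (p : ℤ) ∣ q₁.1 * q₃.2 - q₁.2 * q₃.1 := h₁₃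
  refine four_solutions_monic hF' hr hp h₂ h₃ h₄ h₁₂ h₁₃' ?_ ?_ ?_ ?_ hk hkl
  · have : (δ * q₃.1 - β * q₃.2) * (q₁.1 * q₄.2 - q₁.2 * q₄.1) -
        (q₁.1 * q₃.2 - q₁.2 * q₃.1) * (δ * q₄.1 - β * q₄.2) = cross q₃ q₄ := by
      unfold cross
      linear_combination (q₃.1 * q₄.2 - q₃.2 * q₄.1) * hdet
    rwa [this]
  · intro h0
    rw [h0] at h₂
    have h1 := eq_one_of_cubicValue_zero h₂
    have h2 := hback q₂
    rw [h0, h1] at h2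
    exact n₁₂ (Prod.ext (by linarith [h2.1]) (by linarith [h2.2]))
  · intro h
    obtain ⟨e1, e2⟩ := Prod.mk.injEq .. ▸ h
    have h2 := hback q₃
    rw [e1, e2, (hback q₄).1, (hback q₄).2] at h2
    exact n₃₄ (Prod.ext h2.1.symm h2.2.symm)
  · rcases eq_or_ne p 2 with rfl | hp2
    · refine Or.inr ((hcond.resolve_left (by simp)).imp id fun h => ?_)
      rw [← hdisc, ← hval] at h
      refine two_dvd_add_mul h₃ h₁₃' ?_ h.2
      convert h.1 using 2
      · linear_combination -hdet
      · ring
    · exact Or.inl hp2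

/-- There is at most one pair of solutions in a common class modulo a prime. -/
theorem IsComplexCubic.four_solutions (hF : IsComplexCubic a b c d)
    {p : ℕ} (hp : p.Prime) {q₁ q₂ q₃ q₄ : ℤ × ℤ} (h₁ : cubicValue a b c d q₁.1 q₁.2 = 1)
    (h₂ : cubicValue a b c d q₂.1 q₂.2 = 1) (h₃ : cubicValue a b c d q₃.1 q₃.2 = 1)
    (h₄ : cubicValue a b c d q₄.1 q₄.2 = 1)
    (h₁₂ : (p : ℤ) ∣ cross q₁ q₂) (h₃₄ : (p : ℤ) ∣ cross q₃ q₄) (h₁₃ : ¬ (p : ℤ) ∣ cross q₁ q₃)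
    (n₁₂ : q₁ ≠ q₂) (n₃₄ : q₃ ≠ q₄)
    (hcond : p ≠ 2 ∨ ((4 : ℤ) ∣ cross q₁ q₂ ∧ (4 : ℤ) ∣ cross q₃ q₄) ∨
      ((2 : ℤ) ∣ cubicValue a b c d (q₁.1 + q₃.1) (q₁.2 + q₃.2) ∧
        ¬ (2 : ℤ) ∣ cubicDiscr a b c d)) : False := by
  obtain ⟨s, t, e, hP⟩ := hF.exists_isPowerFactor h₁
  obtain ⟨k₁, hk₁⟩ := hP.exists_zpow _ _ h₁
  obtain ⟨k₂, hk₂⟩ := hP.exists_zpow _ _ h₂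
  obtain ⟨k₃, hk₃⟩ := hP.exists_zpow _ _ h₃
  obtain ⟨k₄, hk₄⟩ := hP.exists_zpow _ _ h₄
  obtain ⟨k, l, hkl, hd⟩ := exists_mul_eq_mul_of_prime hp (k₂ - k₁) (k₄ - k₃)
  have key : ((s * q₄.1 + t * q₄.2) / (s * q₃.1 + t * q₃.2)) ^ k =
      ((s * q₂.1 + t * q₂.2) / (s * q₁.1 + t * q₁.2)) ^ l := by
    rw [hk₁, hk₂, hk₃, hk₄, ← zpow_sub₀ hP.pos.ne', ← zpow_sub₀ hP.pos.ne', ← zpow_mul,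
      ← zpow_mul, hkl]
  have h₃₁ : ¬ (p : ℤ) ∣ cross q₃ q₁ := by
    rwa [show cross q₃ q₁ = - cross q₁ q₃ by unfold cross; ring, dvd_neg]
  rcases hd with hd | hd
  · exact four_solutions_of_zpow hF hP hp h₁ h₂ h₃ h₄ h₁₂ h₃₄ h₁₃ n₁₂ n₃₄
      (hcond.imp_right (Or.imp_left And.left)) hd key
  · refine four_solutions_of_zpow hF hP hp h₃ h₄ h₁ h₂ h₃₄ h₁₂ h₃₁ n₃₄ n₁₂
      (hcond.imp_right (Or.imp And.right ?_)) hd key.symm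
    rw [add_comm q₁.1, add_comm q₁.2]
    exact id

end General

theorem CubicEquiv.trans {a b c d a' b' c' d' a'' b'' c'' d'' : ℤ}
    (h : CubicEquiv a b c d a' b' c' d') (h' : CubicEquiv a' b' c' d' a'' b'' c'' d'') :
    CubicEquiv a b c d a'' b'' c'' d'' := by
  obtain ⟨α, β, γ, δ, hdet, hval⟩ := h
  obtain ⟨α', β', γ', δ', hdet', hval'⟩ := h'
  refine ⟨α * α' + β * γ', α * β' + β * δ', γ * α' + δ * γ', γ * β' + δ * δ', ?_, fun x y => ?_⟩
  · have e : (α * α' + β * γ') * (γ * β' + δ * δ') - (α * β' + β * δ') * (γ * α' + δ * γ') =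
        (α * δ - β * γ) * (α' * δ' - β' * γ') := by ring
    rw [e]
    rcases hdet with h | h <;> rcases hdet' with h' | h' <;> simp [h, h']
  · rw [← hval', ← hval]
    congr 1 <;> ring

theorem CubicEquiv.isComplexCubic {a b c d a' b' c' d' : ℤ} (h : CubicEquiv a b c d a' b' c' d')
    (hF : IsComplexCubic a b c d) : IsComplexCubic a' b' c' d' := by
  obtain ⟨α, β, γ, δ, hdet, hval⟩ := h
  have hG := hF.subst (α := α) (β := β) (γ := γ) (δ := δ) (by rcases hdet with h | h <;> simp [h])
  have hv : ∀ x y, cubicValue (cubicValue a b c d α γ) (cubicSubstB a b c d α β γ δ)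
      (cubicSubstC a b c d α β γ δ) (cubicValue a b c d β δ) x y = cubicValue a' b' c' d' x y :=
    fun x y => (cubicValue_subst ..).trans (hval x y)
  generalize cubicValue a b c d α γ = A at *
  generalize cubicSubstB a b c d α β γ δ = B at *
  generalize cubicSubstC a b c d α β γ δ = C at *
  generalize cubicValue a b c d β δ = D at *
  have h1 := hv 1 0
  have h2 := hv 0 1
  have h3 := hv 1 1
  have h4 := hv 1 (-1)
  simp only [cubicValue] at h1 h2 h3 h4
  obtain rfl : a' = A := by linarith
  obtain rfl : d' = D := by linarith
  obtain rfl : b' = B := by linarith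
  obtain rfl : c' = C := by linarith
  exact hG

/-- The substitution matches the solutions of the two Thue equations. -/
theorem CubicEquiv.ncard_eq {a b c d a' b' c' d' : ℤ} (h : CubicEquiv a b c d a' b' c' d') :
    {q : ℤ × ℤ | cubicValue a b c d q.1 q.2 = 1}.ncard =
      {q : ℤ × ℤ | cubicValue a' b' c' d' q.1 q.2 = 1}.ncard := by
  obtain ⟨α, β, γ, δ, hdet, hval⟩ := h
  have hdet2 : (α * δ - β * γ) ^ 2 = 1 := by rcases hdet with h | h <;> simp [h]
  have hval' : ∀ x y : ℤ, cubicValue a b c d (α * x + β * y) (γ * x + δ * y) =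
      cubicValue a' b' c' d' x y := hval
  symm
  refine Set.ncard_congr (fun q _ => (α * q.1 + β * q.2, γ * q.1 + δ * q.2)) ?_ ?_ ?_
  · intro q hq
    exact (hval' q.1 q.2).trans hq
  · intro q q' _ _ h
    obtain ⟨h1, h2⟩ := Prod.mk.injEq .. ▸ h
    refine Prod.ext ?_ ?_
    · linear_combination (α * δ - β * γ) * (δ * h1 - β * h2) - (q.1 - q'.1) * hdet2
    · linear_combination (α * δ - β * γ) * (α * h2 - γ * h1) - (q.2 - q'.2) * hdet2
  · intro q hq
    have h1 : α * ((α * δ - β * γ) * (δ * q.1 - β * q.2)) +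
        β * ((α * δ - β * γ) * (α * q.2 - γ * q.1)) = q.1 := by linear_combination q.1 * hdet2
    have h2 : γ * ((α * δ - β * γ) * (δ * q.1 - β * q.2)) +
        δ * ((α * δ - β * γ) * (α * q.2 - γ * q.1)) = q.2 := by linear_combination q.2 * hdet2
    refine ⟨((α * δ - β * γ) * (δ * q.1 - β * q.2), (α * δ - β * γ) * (α * q.2 - γ * q.1)), ?_,
      Prod.ext h1 h2⟩
    show cubicValue a' b' c' d' _ _ = 1
    rw [← hval', h1, h2]
    exact hq

/-- If the solutions fall into few classes modulo a prime, then there are few solutions. -/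
theorem IsComplexCubic.card_le_of_coloring {a b c d : ℤ} (hF : IsComplexCubic a b c d)
    {T : Finset (ℤ × ℤ)} (hT : ∀ q ∈ T, cubicValue a b c d q.1 q.2 = 1) {p : ℕ} (hp : p.Prime)
    {n : ℕ} (f : ℤ × ℤ → ℕ) (hfn : ∀ q ∈ T, f q < n)
    (hf : ∀ q ∈ T, ∀ q' ∈ T, f q = f q' → (p : ℤ) ∣ cross q q')
    (hcond : p ≠ 2 ∨ (∀ q ∈ T, ∀ q' ∈ T, f q = f q' → (4 : ℤ) ∣ cross q q') ∨
      ((∀ q ∈ T, ∀ q' ∈ T, ¬ (2 : ℤ) ∣ cross q q' →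
        (2 : ℤ) ∣ cubicValue a b c d (q.1 + q'.1) (q.2 + q'.2)) ∧ ¬ (2 : ℤ) ∣ cubicDiscr a b c d)) :
    T.card ≤ n + 1 := by
  by_contra! hcard
  obtain ⟨q₁, h₁, q₂, h₂, n₁₂, e₁₂⟩ := Finset.exists_ne_map_eq_of_card_lt_of_maps_to
    (s := T) (t := Finset.range n) (f := f) (by rw [Finset.card_range]; omega)
    (fun q hq => by simpa using hfn q hq)
  obtain ⟨q₃, h₃, q₄, h₄, n₃₄, e₃₄⟩ := Finset.exists_ne_map_eq_of_card_lt_of_maps_to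
    (s := T.erase q₁) (t := Finset.range n) (f := f)
    (by rw [Finset.card_range, Finset.card_erase_of_mem h₁]; omega)
    (fun q hq => by simpa using hfn q (Finset.mem_of_mem_erase hq))
  have n₁₃ := (Finset.ne_of_mem_erase h₃).symm
  have n₁₄ := (Finset.ne_of_mem_erase h₄).symm
  replace h₃ := Finset.mem_of_mem_erase h₃
  replace h₄ := Finset.mem_of_mem_erase h₄
  by_cases h13 : (p : ℤ) ∣ cross q₁ q₃
  · rcases eq_or_ne q₂ q₃ with rfl | n₂₃
    · exact hF.three_solutions hp (hT _ h₂) (hT _ h₁) (hT _ h₄) (hf _ h₂ _ h₁ e₁₂.symm)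
        (hf _ h₂ _ h₄ e₃₄) n₁₂.symm n₃₄ n₁₄
    · exact hF.three_solutions hp (hT _ h₁) (hT _ h₂) (hT _ h₃) (hf _ h₁ _ h₂ e₁₂) h13 n₁₂ n₁₃ n₂₃
  · refine hF.four_solutions hp (hT _ h₁) (hT _ h₂) (hT _ h₃) (hT _ h₄) (hf _ h₁ _ h₂ e₁₂)
      (hf _ h₃ _ h₄ e₃₄) h13 n₁₂ n₃₄ ?_
    rcases eq_or_ne p 2 with rfl | hp2
    · exact hcond.imp_right (Or.imp (fun h => ⟨h _ h₁ _ h₂ e₁₂, h _ h₃ _ h₄ e₃₄⟩)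
        (And.imp_left fun h => h _ h₁ _ h₃ h13))
    · exact Or.inl hp2

namespace CubicRing

variable {b c d : ℤ}

/-- The second elementary symmetric function of the conjugates. -/
def traceTwo (u : CubicRing b c d) : ℤ :=
  3 * u.x ^ 2 + 2 * b * u.x * u.y + 2 * (b ^ 2 - 2 * c) * u.x * u.z + c * u.y ^ 2
    + (b * c - 3 * d) * u.y * u.z + (c ^ 2 - 2 * b * d) * u.z ^ 2

/-- The trace. -/
def trace (u : CubicRing b c d) : ℤ :=
  3 * u.x + b * u.y + (b ^ 2 - 2 * c) * u.z

theorem cayleyHamilton (u : CubicRing b c d) :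
    u ^ 3 = (trace u : ℤ) * u ^ 2 - (traceTwo u : ℤ) * u + (norm u : ℤ) := by
  rw [sub_eq_add_neg]
  ext <;> simp [pow_succ] <;> simp only [trace, traceTwo, norm] <;> ring

/-- The index form: the index of `ℤ[u]`. -/
def index (u : CubicRing b c d) : ℤ :=
  u.y ^ 3 + 2 * b * u.y ^ 2 * u.z + (b ^ 2 + c) * u.y * u.z ^ 2 + (b * c - d) * u.z ^ 3

theorem dvd_of_dvd_index {p : ℤ} (hp : Prime p) {u : CubicRing b c d} (hu : p ∣ index u)
    {A B C : ℤ} (hz : ((A : CubicRing b c d) + B * u + C * u ^ 2).z = 0) :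
    p ∣ ((A : CubicRing b c d) + B * u + C * u ^ 2).y := by
  obtain ⟨a0, b0, c0⟩ := u
  simp [index, pow_succ] at *
  set y := B * b0 + C * (a0 * b0 + b0 * a0 - c * (b0 * c0 + c0 * b0) + (d - b * c) * (c0 * c0))
    with hy
  by_contra hpy
  have h1 : p ∣ c0 := by
    refine (hp.dvd_or_dvd (a := c0) (b := y) ?_).resolve_right hpy
    have e : c0 * y = -C * (b0 * b0 * b0 + 2 * b * (b0 * b0) * c0 + (b * b + c) * b0 * (c0 * c0)
        + (b * c - d) * (c0 * c0 * c0)) := by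
      rw [hy]
      linear_combination b0 * hz
    rw [e]
    exact Dvd.dvd.mul_left hu _
  have h2 : p ∣ b0 := by
    have h3 : p ∣ b0 * b0 * b0 := by
      have h4 := dvd_sub hu (Dvd.dvd.mul_right h1 (2 * b * (b0 * b0) + (b * b + c) * b0 * c0
        + (b * c - d) * (c0 * c0)))
      refine (congrArg (p ∣ ·) ?_).mp h4
      ring
    rcases hp.dvd_or_dvd h3 with h4 | h4
    · exact (hp.dvd_or_dvd h4).elim id id
    · exact h4
  refine hpy ?_
  rw [hy]
  obtain ⟨i, rfl⟩ := h1
  obtain ⟨j, rfl⟩ := h2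
  exact ⟨B * j + C * (a0 * j + j * a0 - c * (j * (p * i) + i * (p * j))
    + (d - b * c) * (i * (p * i))), by ring⟩

theorem cubicEquiv_of_index {u : CubicRing b c d} (hI : index u ^ 2 = 1) (hN : norm u = 1) :
    CubicEquiv 1 b c d 1 (trace u) (traceTwo u) 1 := by
  refine ⟨index u * (u.y + b * u.z), index u * ((u.y + b * u.z) * u.x - d * u.z ^ 2),
    -index u * u.z, index u * ((u.y + b * u.z) * u.y - u.z * u.x + c * u.z ^ 2), ?_, ?_⟩
  · have h1 : (u.y + b * u.z) * ((u.y + b * u.z) * u.y - u.z * u.x + c * u.z ^ 2) +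
        ((u.y + b * u.z) * u.x - d * u.z ^ 2) * u.z = index u := by
      unfold index
      ring
    exact (sq_eq_one_iff.mp hI).imp
      (fun h => by linear_combination index u ^ 2 * h1 + index u * hI + h)
      (fun h => by linear_combination index u ^ 2 * h1 + index u * hI + h)
  · intro x y
    have key : cubicValue 1 b c d ((u.y + b * u.z) * x + ((u.y + b * u.z) * u.x - d * u.z ^ 2) * y)
        (-u.z * x + ((u.y + b * u.z) * u.y - u.z * u.x + c * u.z ^ 2) * y) =
        index u * (x ^ 3 + trace u * x ^ 2 * y + traceTwo u * x * y ^ 2 + norm u * y ^ 3) := by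
      unfold index trace traceTwo norm cubicValue
      ring
    unfold cubicValue at key
    linear_combination index u ^ 3 * key + (index u ^ 2 + 1) * (x ^ 3 + trace u * x ^ 2 * y
      + traceTwo u * x * y ^ 2 + norm u * y ^ 3) * hI + y ^ 3 * hN

theorem index_sq_eq_one {u : CubicRing b c d} (hF : IsComplexCubic 1 b c d) {q q' : ℤ × ℤ}
    (h : cubicValue 1 b c d q.1 q.2 = 1) (h' : cubicValue 1 b c d q'.1 q'.2 = 1) (hne : q ≠ (1, 0))
    (hne' : q' ≠ (1, 0)) (hqq' : q ≠ q')
    (hu : ∀ (x y : ℤ) (h : cubicValue 1 b c d x y = 1), ∃ A B C : ℤ,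
      (unitOfSolution h : CubicRing b c d) = A + B * u + C * u ^ 2) : index u ^ 2 = 1 := by
  by_contra hI
  obtain ⟨p, hp, hpI⟩ := Nat.exists_prime_and_dvd (n := (index u).natAbs) (by
    intro h1
    refine hI ?_
    rw [← Int.natAbs_sq, h1]
    norm_num)
  have hdvd : ∀ (x y : ℤ) (h : cubicValue 1 b c d x y = 1), (p : ℤ) ∣ y := by
    intro x y h
    obtain ⟨A, B, C, hABC⟩ := hu x y h
    rw [val_unitOfSolution] at hABC
    have h2 := dvd_of_dvd_index (Nat.prime_iff_prime_int.mp hp) (Int.natCast_dvd.mpr hpI)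
      (A := A) (B := B) (C := C) (by rw [← hABC])
    rwa [← hABC] at h2
  exact hF.three_solutions hp (q₁ := (1, 0)) (by simp [cubicValue]) h h'
    (by simpa [cross] using hdvd _ _ h) (by simpa [cross] using hdvd _ _ h') hne.symm hne'.symm hqq'

end CubicRing

/-- A property expressing that all solutions of `x ^ 3 + s * x ^ 2 * y + t * x * y ^ 2 + y ^ 3 = 1`
are powers of `θ`. -/
def SolutionsArePowers (s t : ℤ) : Prop :=
  ∀ (x y : ℤ) (h : cubicValue 1 s t 1 x y = 1), ∃ k : ℤ, CubicRing.unitOfSolution h =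
    CubicRing.unitOfSolution (show cubicValue 1 s t 1 0 1 = 1 by simp [cubicValue]) ^ k

open CubicRing in
theorem IsComplexCubic.exists_solutionsArePowers_of_monic {b c d : ℤ} (hF : IsComplexCubic 1 b c d)
    {q q' : ℤ × ℤ} (h : cubicValue 1 b c d q.1 q.2 = 1) (h' : cubicValue 1 b c d q'.1 q'.2 = 1)
    (hne : q ≠ (1, 0)) (hne' : q' ≠ (1, 0)) (hqq' : q ≠ q') :
    ∃ s t, CubicEquiv 1 b c d 1 s t 1 ∧ SolutionsArePowers s t := by
  obtain ⟨r, hr⟩ := exists_real_root_cubic b c d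
  obtain ⟨ε, hε, hall⟩ := exists_fundamental_unit hF hr
  have hN := norm_eq_one_of_lift_pos hF hr ε hε
  have hroot := cayleyHamilton (ε : CubicRing b c d)
  rw [hN] at hroot
  set Λ := lift (ε : CubicRing b c d) hroot with hΛ
  set u₀ := unitOfSolution (show cubicValue 1 (trace (ε : CubicRing b c d)) (traceTwo
    (ε : CubicRing b c d)) 1 0 1 = 1 by simp [cubicValue]) with hu₀
  have hΛu : Units.map Λ.toMonoidHom u₀ = ε := by
    ext1
    simp [hΛ, hu₀, lift_apply]
  have hpow : ∀ k : ℤ, ((ε ^ k : (CubicRing b c d)ˣ) : CubicRing b c d) =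
      Λ ((u₀ ^ k : (CubicRing _ _ _)ˣ) : CubicRing _ _ _) := by
    intro k
    have h1 := (map_zpow (Units.map Λ.toMonoidHom) u₀ k).trans (congrArg (· ^ k) hΛu)
    exact congrArg Units.val h1.symm
  have hI : index (ε : CubicRing b c d) ^ 2 = 1 := by
    refine index_sq_eq_one hF h h' hne hne' hqq' fun x y h => ?_
    obtain ⟨k, hk⟩ := hall _ (lift_pos_of_solution hF hr h)
    rw [hk, hpow]
    exact ⟨_, _, _, rfl⟩
  have hE := cubicEquiv_of_index hI hN
  refine ⟨_, _, hE, fun x y hxy => ?_⟩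
  have hF' := hE.isComplexCubic hF
  have hr' : (lift r hr ε) ^ 3 = (trace (ε : CubicRing b c d) : ℤ) * (lift r hr ε) ^ 2
      - (traceTwo (ε : CubicRing b c d) : ℤ) * (lift r hr ε) + (1 : ℤ) := by
    have := congrArg (lift r hr) hroot
    simpa only [map_pow, map_add, map_sub, map_mul, map_intCast] using this
  have hcomp : ∀ v, lift r hr (Λ v) = lift (lift r hr ε) hr' v := by
    intro v
    simp [hΛ, lift_apply (ε : CubicRing b c d) hroot, lift_apply (lift r hr ε) hr']
  obtain ⟨k, hk⟩ := hall (Units.map Λ.toMonoidHom (unitOfSolution hxy)) (by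
    have := lift_pos_of_solution hF' hr' hxy
    rw [← hcomp] at this
    exact this)
  refine ⟨k, Units.ext (lift_injective hF' hr' ?_)⟩
  rw [← hcomp, ← hcomp, ← hpow, ← hk]
  rfl

theorem IsComplexCubic.exists_solutionsArePowers {a b c d : ℤ} (hF : IsComplexCubic a b c d)
    {T : Finset (ℤ × ℤ)} (hT : ∀ q ∈ T, cubicValue a b c d q.1 q.2 = 1) (hcard : 3 ≤ T.card) :
    ∃ s t, CubicEquiv a b c d 1 s t 1 ∧ SolutionsArePowers s t := by
  obtain ⟨q₁, q₂, q₃, h₁, h₂, h₃, n₁₂, n₁₃, n₂₃⟩ := Finset.two_lt_card_iff.mp hcard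
  have e₁ := hT _ h₁
  obtain ⟨u, v, huv⟩ := isCoprime_of_cubicValue_eq_one e₁
  have hdet : q₁.1 * u - (-v) * q₁.2 = 1 := by linear_combination huv
  have hE : CubicEquiv a b c d 1 (cubicSubstB a b c d q₁.1 (-v) q₁.2 u)
      (cubicSubstC a b c d q₁.1 (-v) q₁.2 u) (cubicValue a b c d (-v) u) :=
    ⟨q₁.1, -v, q₁.2, u, Or.inl hdet, fun x y => by
      have := cubicValue_subst a b c d q₁.1 (-v) q₁.2 u x y
      rw [e₁] at this
      exact this.symm⟩
  have hback : ∀ q : ℤ × ℤ, cubicValue a b c d q.1 q.2 = 1 →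
      cubicValue 1 (cubicSubstB a b c d q₁.1 (-v) q₁.2 u) (cubicSubstC a b c d q₁.1 (-v) q₁.2 u)
        (cubicValue a b c d (-v) u) (u * q.1 + v * q.2) (q₁.1 * q.2 - q₁.2 * q.1) = 1 := by
    intro q hq
    have := cubicValue_subst a b c d q₁.1 (-v) q₁.2 u (u * q.1 + v * q.2) (q₁.1 * q.2 - q₁.2 * q.1)
    rw [e₁] at this
    rw [this, ← hq]
    congr 1
    · linear_combination q.1 * huv
    · linear_combination q.2 * huv
  have hinj : ∀ q q' : ℤ × ℤ, ((u * q.1 + v * q.2, q₁.1 * q.2 - q₁.2 * q.1) : ℤ × ℤ) =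
      (u * q'.1 + v * q'.2, q₁.1 * q'.2 - q₁.2 * q'.1) → q = q' := by
    intro q q' h
    obtain ⟨h1, h2⟩ := Prod.mk.injEq .. ▸ h
    refine Prod.ext ?_ ?_
    · linear_combination q₁.1 * h1 - v * h2 - (q.1 - q'.1) * huv
    · linear_combination q₁.2 * h1 + u * h2 - (q.2 - q'.2) * huv
  have hbase : ((u * q₁.1 + v * q₁.2, q₁.1 * q₁.2 - q₁.2 * q₁.1) : ℤ × ℤ) = (1, 0) := by
    rw [huv, mul_comm, sub_self]
  obtain ⟨s, t, hE', hP⟩ := (hE.isComplexCubic hF).exists_solutionsArePowers_of_monic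
    (hback q₂ (hT _ h₂)) (hback q₃ (hT _ h₃)) (fun h => n₁₂ (hinj _ _ (hbase.trans h.symm)))
    (fun h => n₁₃ (hinj _ _ (hbase.trans h.symm))) (fun h => n₂₃ (hinj _ _ h))
  exact ⟨s, t, hE.trans hE', hP⟩

namespace CubicRing

variable {b c d : ℤ}

theorem dvd_coords_of_dvd_sub {m : ℤ} {u v : CubicRing b c d} (h : (m : CubicRing b c d) ∣ u - v) :
    m ∣ u.x - v.x ∧ m ∣ u.y - v.y ∧ m ∣ u.z - v.z := by
  obtain ⟨w, hw⟩ := h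
  rw [sub_eq_iff_eq_add] at hw
  rw [hw]
  exact ⟨⟨w.x, by simp⟩, ⟨w.y, by simp⟩, ⟨w.z, by simp⟩⟩

end CubicRing

theorem dvd_zpow_sub_pow_emod {R : Type*} [CommRing R] {m : R} {u : Rˣ} {n : ℕ} (hn : n ≠ 0)
    (hu : m ∣ (u : R) ^ n - 1) (k : ℤ) :
    m ∣ ((u ^ k : Rˣ) : R) - (u : R) ^ (k % n).toNat := by
  have hmap := fun v : R => Ideal.Quotient.eq_zero_iff_mem (I := Ideal.span {m}) (a := v)
  simp only [Ideal.mem_span_singleton] at hmap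
  rw [← hmap, map_sub, map_pow, sub_eq_zero] at hu ⊢
  set φ := Ideal.Quotient.mk (Ideal.span {m})
  have h1 : (Units.map φ.toMonoidHom u) ^ n = 1 := Units.ext (by simpa using hu)
  have h2 : (Units.map φ.toMonoidHom u) ^ k = (Units.map φ.toMonoidHom u) ^ (k % n).toNat := by
    have h3 : (((k % n).toNat : ℕ) : ℤ) = k % n :=
      Int.toNat_of_nonneg (Int.emod_nonneg _ (by exact_mod_cast hn))
    rw [← zpow_natCast _ (k % n).toNat, h3]
    conv_lhs => rw [← Int.emod_add_mul_ediv k n, zpow_add, zpow_mul, zpow_natCast, h1, one_zpow,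
      mul_one]
  have h4 := congrArg Units.val ((map_zpow (Units.map φ.toMonoidHom) u k).trans h2)
  rw [Units.val_pow_eq_pow_val] at h4
  exact h4

/-- If all solutions are congruent to `(1, 0)` or `(0, 1)` modulo a prime, there are at most three
of them. -/
theorem IsComplexCubic.card_le_three_of_residues {a b c d : ℤ} (hF : IsComplexCubic a b c d)
    {T : Finset (ℤ × ℤ)} (hT : ∀ q ∈ T, cubicValue a b c d q.1 q.2 = 1) {p : ℕ} (hp : p.Prime)
    (hres : ∀ q ∈ T, ((p : ℤ) ∣ q.1 - 1 ∧ (p : ℤ) ∣ q.2) ∨ ((p : ℤ) ∣ q.1 ∧ (p : ℤ) ∣ q.2 - 1))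
    (hcond : p ≠ 2 ∨ ((2 : ℤ) ∣ a + b + c + d ∧ ¬ (2 : ℤ) ∣ cubicDiscr a b c d)) :
    T.card ≤ 3 := by
  have hp1 := (Nat.prime_iff_prime_int.mp hp).not_dvd_one
  refine hF.card_le_of_coloring hT hp (n := 2) (fun q => if (p : ℤ) ∣ q.2 then 0 else 1)
    (fun q _ => by split_ifs <;> norm_num) ?_ ?_
  · intro q hq q' hq' h
    unfold cross
    by_cases h1 : (p : ℤ) ∣ q.2 <;> by_cases h2 : (p : ℤ) ∣ q'.2 <;> simp [h1, h2] at h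
    · exact dvd_sub (h2.mul_left _) (h1.mul_right _)
    · have h3 := ((hres q hq).resolve_left fun h => h1 h.2).1
      have h4 := ((hres q' hq').resolve_left fun h => h2 h.2).1
      exact dvd_sub (h3.mul_right _) (h4.mul_left _)
  · rcases eq_or_ne p 2 with rfl | hp2
    · obtain ⟨h1, h2⟩ := hcond.resolve_left (not_not.mpr rfl)
      refine Or.inr <| Or.inr ⟨fun q hq q' hq' h => ?_, h2⟩
      have key : (2 : ℤ) ∣ (q.1 + q'.1) - 1 ∧ (2 : ℤ) ∣ (q.2 + q'.2) - 1 := by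
        rcases hres q hq with ⟨h3, h4⟩ | ⟨h3, h4⟩ <;>
          rcases hres q' hq' with ⟨h5, h6⟩ | ⟨h5, h6⟩
        · exact absurd (dvd_sub (h6.mul_left _) (h4.mul_right _)) h
        · push_cast at *
          constructor <;> omega
        · push_cast at *
          constructor <;> omega
        · exact absurd (dvd_sub (h3.mul_right _) (h5.mul_left _)) h
      obtain ⟨⟨i, hi⟩, ⟨j, hj⟩⟩ := key
      rw [sub_eq_iff_eq_add] at hi hj
      rw [hi, hj]
      have e : cubicValue a b c d (2 * i + 1) (2 * j + 1) = a + b + c + d +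
          2 * (a * (4 * i ^ 3 + 6 * i ^ 2 + 3 * i) + b * (4 * i ^ 2 * j + 4 * i * j + j + 2 * i ^ 2
            + 2 * i) + c * (4 * j ^ 2 * i + 4 * i * j + i + 2 * j ^ 2 + 2 * j)
            + d * (4 * j ^ 3 + 6 * j ^ 2 + 3 * j)) := by
        unfold cubicValue
        ring
      rw [e]
      exact dvd_add h1 (Dvd.intro _ rfl)
    · exact Or.inl hp2

/-- If the solutions fall into `n` classes modulo a prime, then there are at most `n * 2`
solutions. -/
theorem IsComplexCubic.card_le_two_mul_of_coloring {a b c d : ℤ} (hF : IsComplexCubic a b c d)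
    {T : Finset (ℤ × ℤ)} (hT : ∀ q ∈ T, cubicValue a b c d q.1 q.2 = 1) {p : ℕ} (hp : p.Prime)
    {n : ℕ} (f : ℤ × ℤ → ℕ) (hfn : ∀ q ∈ T, f q < n)
    (hf : ∀ q ∈ T, ∀ q' ∈ T, f q = f q' → (p : ℤ) ∣ cross q q') : T.card ≤ n * 2 := by
  by_contra! hcard
  obtain ⟨y, -, hy⟩ := Finset.exists_lt_card_fiber_of_mul_lt_card_of_maps_to
    (s := T) (t := Finset.range n) (f := f) (n := 2) (fun q hq => by simpa using hfn q hq)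
    (by simpa using hcard)
  obtain ⟨q₁, q₂, q₃, h₁, h₂, h₃, n₁₂, n₁₃, n₂₃⟩ := Finset.two_lt_card_iff.mp hy
  rw [Finset.mem_filter] at h₁ h₂ h₃
  exact hF.three_solutions hp (hT _ h₁.1) (hT _ h₂.1) (hT _ h₃.1)
    (hf _ h₁.1 _ h₂.1 (h₁.2.trans h₂.2.symm)) (hf _ h₁.1 _ h₃.1 (h₁.2.trans h₃.2.symm)) n₁₂ n₁₃ n₂₃

section Powers

open CubicRing

variable {s t : ℤ}

theorem SolutionsArePowers.swap (hP : SolutionsArePowers s t) : SolutionsArePowers t s := by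
  intro x y h
  set v := unitOfSolution (show cubicValue 1 t s 1 0 1 = 1 by simp [cubicValue])
  have hv : ((v⁻¹ : (CubicRing t s 1)ˣ) : CubicRing t s 1) = ⟨s, -t, 1⟩ := by
    ext <;> simp [v, unitOfSolution]
  obtain ⟨k, hk⟩ := hP y x (by unfold cubicValue at h ⊢; linear_combination h)
  let Ψ := lift (b := s) (c := t) (d := 1) ((v⁻¹ : (CubicRing t s 1)ˣ) : CubicRing t s 1) (by
    rw [hv, sub_eq_add_neg]
    ext <;> simp [pow_succ] <;> ring)
  have h1 : Units.map Ψ.toMonoidHom (unitOfSolution (show cubicValue 1 s t 1 0 1 = 1 by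
      simp [cubicValue])) = v⁻¹ := by
    ext1
    simp [Ψ, lift_apply]
  have h2 := (congrArg (Units.map Ψ.toMonoidHom) hk).trans (map_zpow _ _ k)
  rw [h1] at h2
  refine ⟨1 - k, ?_⟩
  rw [zpow_sub, ← inv_zpow, zpow_one, ← h2]
  ext1
  change (⟨x, y, 0⟩ : CubicRing t s 1) = v * Ψ ⟨y, x, 0⟩
  simp only [Ψ, lift_apply]
  rw [hv]
  ext <;> simp [v, pow_succ] <;> ring

/-- The exponents of the solutions. -/
theorem SolutionsArePowers.exists_exponent (hP : SolutionsArePowers s t) :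
    ∃ e : ℤ × ℤ → ℤ, ∀ q : ℤ × ℤ, cubicValue 1 s t 1 q.1 q.2 = 1 →
      ((unitOfSolution (show cubicValue 1 s t 1 0 1 = 1 by simp [cubicValue]) ^ e q :
        (CubicRing s t 1)ˣ) : CubicRing s t 1) = ⟨q.1, q.2, 0⟩ := by
  have : ∀ q : ℤ × ℤ, ∃ k : ℤ, cubicValue 1 s t 1 q.1 q.2 = 1 →
      ((unitOfSolution (show cubicValue 1 s t 1 0 1 = 1 by simp [cubicValue]) ^ k :
        (CubicRing s t 1)ˣ) : CubicRing s t 1) = ⟨q.1, q.2, 0⟩ := by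
    intro q
    by_cases h : cubicValue 1 s t 1 q.1 q.2 = 1
    · obtain ⟨k, hk⟩ := hP _ _ h
      exact ⟨k, fun _ => by rw [← hk]; rfl⟩
    · exact ⟨0, fun h' => absurd h' h⟩
  exact ⟨fun q => (this q).choose, fun q => (this q).choose_spec⟩

/-- Even powers of `θ` have `θ`-coordinate divisible by `s * t - 1`. -/
theorem dvd_y_of_even_power (k : ℤ) :
    s * t - 1 ∣ ((unitOfSolution (show cubicValue 1 s t 1 0 1 = 1 by simp [cubicValue]) ^ (2 * k) :
      (CubicRing s t 1)ˣ) : CubicRing s t 1).y := by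
  let M : Submonoid (CubicRing s t 1) :=
    { carrier := {v | s * t - 1 ∣ v.y}
      one_mem' := by simp
      mul_mem' := by
        rintro u v ⟨i, hi⟩ ⟨j, hj⟩
        change s * t - 1 ∣ (u * v).y
        rw [mul_y, hi, hj]
        exact ⟨u.x * j + i * v.x - t * (i * v.z + u.z * j) - u.z * v.z, by ring⟩ }
  set v := unitOfSolution (show cubicValue 1 s t 1 0 1 = 1 by simp [cubicValue])
  have hv : ((v⁻¹ : (CubicRing s t 1)ˣ) : CubicRing s t 1) = ⟨t, -s, 1⟩ := by
    ext <;> simp [v, unitOfSolution]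
  change _ ∈ M
  obtain ⟨n, rfl | rfl⟩ := k.eq_nat_or_neg
  · rw [zpow_mul, zpow_natCast, Units.val_pow_eq_pow_val]
    refine pow_mem ?_ n
    change s * t - 1 ∣ ((v ^ 2 : (CubicRing s t 1)ˣ) : CubicRing s t 1).y
    simp [v, pow_succ]
  · rw [mul_neg, ← mul_neg_one, mul_right_comm, zpow_mul, zpow_natCast, Units.val_pow_eq_pow_val,
      mul_comm, zpow_mul, zpow_neg_one]
    refine pow_mem ?_ n
    change s * t - 1 ∣ ((v⁻¹ ^ (2 : ℕ) : (CubicRing s t 1)ˣ) : CubicRing s t 1).y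
    rw [pow_two, Units.val_mul, hv, mul_y]
    exact ⟨-1, by ring⟩

theorem dvd_cross_of_mul_eq {q q' : ℤ × ℤ} (h : cubicValue 1 s t 1 q.1 q.2 = 1)
    {v : CubicRing s t 1} (hv : (⟨q'.1, q'.2, 0⟩ : CubicRing s t 1) = ⟨q.1, q.2, 0⟩ * v)
    (hy : s * t - 1 ∣ v.y) : s * t - 1 ∣ cross q q' := by
  have h1 := congrArg CubicRing.x hv
  have h2 := congrArg CubicRing.y hv
  have h3 := congrArg CubicRing.z hv
  simp at h1 h2 h3
  have hco : IsCoprime (s * t - 1) (q.1 + s * q.2) :=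
    ⟨-q.2 ^ 3, q.1 ^ 2 + t * q.2 ^ 2, by unfold cubicValue at h; linear_combination h⟩
  have hz : s * t - 1 ∣ v.z := by
    refine hco.dvd_of_dvd_mul_left ?_
    obtain ⟨i, hi⟩ := hy
    exact ⟨-q.2 * i, by rw [hi] at h3; linear_combination -h3⟩
  unfold cross
  have e : q.1 * q'.2 - q.2 * q'.1 = q.1 ^ 2 * v.y - q.2 * (t * q.1 + q.2) * v.z := by
    rw [h1, h2]
    ring
  rw [e]
  exact dvd_sub (hy.mul_left _) (hz.mul_left _)

theorem IsComplexCubic.card_le_three_of_dvd (hF : IsComplexCubic 1 s t 1)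
    (hP : SolutionsArePowers s t) {T : Finset (ℤ × ℤ)}
    (hT : ∀ q ∈ T, cubicValue 1 s t 1 q.1 q.2 = 1) {p : ℕ} (hp : p.Prime)
    (hpJ : (p : ℤ) ∣ s * t - 1) (hcond : p ≠ 2 ∨ (4 : ℤ) ∣ s * t - 1) : T.card ≤ 3 := by
  obtain ⟨e, he⟩ := hP.exists_exponent
  have hcross : ∀ q ∈ T, ∀ q' ∈ T, (e q % 2).toNat = (e q' % 2).toNat →
      s * t - 1 ∣ cross q q' := by
    intro q hq q' hq' h
    obtain ⟨j, hj⟩ : ∃ j, e q' = e q + 2 * j := ⟨(e q' - e q) / 2, by omega⟩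
    refine dvd_cross_of_mul_eq (hT q hq) ?_ (dvd_y_of_even_power j)
    rw [← he q (hT q hq), ← Units.val_mul, ← zpow_add, ← hj, he q' (hT q' hq')]
  exact hF.card_le_of_coloring hT hp (n := 2) (fun q => (e q % 2).toNat)
    (fun q _ => by omega) (fun q hq q' hq' h => hpJ.trans (hcross q hq q' hq' h))
    (hcond.imp_right fun h4 => Or.inl fun q hq q' hq' h => h4.trans (hcross q hq q' hq' h))

theorem IsComplexCubic.mul_sub_one_cases (hF : IsComplexCubic 1 s t 1)
    (hP : SolutionsArePowers s t) {T : Finset (ℤ × ℤ)}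
    (hT : ∀ q ∈ T, cubicValue 1 s t 1 q.1 q.2 = 1) (hcard : 4 ≤ T.card) :
    s * t = 0 ∨ s * t = 2 ∨ s * t = -1 ∨ s * t = 3 := by
  have hodd : ∀ p : ℕ, p.Prime → (p : ℤ) ∣ s * t - 1 → p = 2 := fun p hp hd => by
    by_contra h
    have := hF.card_le_three_of_dvd hP hT hp hd (Or.inl h)
    omega
  have h4 : ¬ (4 : ℤ) ∣ s * t - 1 := fun h => by
    have := hF.card_le_three_of_dvd hP hT Nat.prime_two ((by norm_num : (2 : ℤ) ∣ 4).trans h)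
      (Or.inr h)
    omega
  rcases Nat.eq_two_pow_or_exists_odd_prime_and_dvd (s * t - 1).natAbs with
    ⟨k, hk⟩ | ⟨p, hp, hd, ho⟩
  · rcases k with _ | _ | k
    · omega
    · omega
    · refine absurd (Int.natCast_dvd.mpr (?_ : 4 ∣ _)) h4
      rw [hk]
      exact ⟨2 ^ k, by ring⟩
  · rw [hodd p hp (Int.natCast_dvd.mpr hd)] at ho
    exact absurd ho (by decide)

/-- The exponents of solutions modulo the multiplicative order of `θ` modulo `m`. -/
theorem SolutionsArePowers.exists_dvd (hP : SolutionsArePowers s t) {x y : ℤ}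
    (h : cubicValue 1 s t 1 x y = 1) :
    ∃ k : ℤ, ∀ (m : ℤ) (n : ℕ), n ≠ 0 → (m : CubicRing s t 1) ∣ θ s t 1 ^ n - 1 →
      m ∣ x - (θ s t 1 ^ (k % n).toNat).x ∧ m ∣ y - (θ s t 1 ^ (k % n).toNat).y ∧
        m ∣ (θ s t 1 ^ (k % n).toNat).z := by
  obtain ⟨k, hk⟩ := hP x y h
  refine ⟨k, fun m n hn hd => ?_⟩
  have h1 := dvd_coords_of_dvd_sub (dvd_zpow_sub_pow_emod (u := unitOfSolution
    (show cubicValue 1 s t 1 0 1 = 1 by simp [cubicValue])) hn hd k)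
  rw [← hk] at h1
  exact ⟨h1.1, h1.2.1, dvd_neg.mp (by rw [← zero_sub]; exact h1.2.2)⟩

theorem IsComplexCubic.card_le_three_zero (hF : IsComplexCubic 1 0 t 1)
    (hP : SolutionsArePowers 0 t) {T : Finset (ℤ × ℤ)}
    (hT : ∀ q ∈ T, cubicValue 1 0 t 1 q.1 q.2 = 1) (ht : 2 ≤ t) : T.card ≤ 3 := by
  obtain ⟨p, hp, hpt⟩ := Nat.exists_prime_and_dvd (n := t.natAbs) (by omega)
  rw [← Int.natCast_dvd] at hpt
  refine hF.card_le_three_of_residues hT hp (fun q hq => ?_) ?_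
  · obtain ⟨k, hk⟩ := hP.exists_dvd (hT q hq)
    obtain ⟨h1, h2, h3⟩ := hk p 3 (by norm_num) (by
      obtain ⟨i, rfl⟩ := hpt
      refine ⟨⟨0, -i, 0⟩, ?_⟩
      rw [sub_eq_iff_eq_add]
      ext <;> simp [θ, pow_succ, -Int.cast_natCast])
    have h4 : (k % 3).toNat < 3 := by omega
    push_cast at h1 h2 h3
    generalize (k % 3).toNat = r at h1 h2 h3 h4
    interval_cases r
    · exact Or.inl (by simpa using And.intro h1 h2)
    · exact Or.inr (by simpa [θ] using And.intro h1 h2)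
    · simp [θ, pow_succ] at h3
      exact absurd h3 (Nat.prime_iff_prime_int.mp hp).not_dvd_one
  · refine or_iff_not_imp_left.mpr fun h => ?_
    rw [not_not.mp h] at hpt
    obtain ⟨i, rfl⟩ := hpt
    refine ⟨⟨1 + i, by push_cast; ring⟩, ?_⟩
    have e : cubicDiscr 1 0 ((2 : ℕ) * i) 1 = 2 * (-16 * i ^ 3 - 14) + 1 := by
      unfold cubicDiscr
      push_cast
      ring
    rw [e]
    omega

theorem IsComplexCubic.card_le_three_one_three (hF : IsComplexCubic 1 1 3 1)
    (hP : SolutionsArePowers 1 3) {T : Finset (ℤ × ℤ)}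
    (hT : ∀ q ∈ T, cubicValue 1 1 3 1 q.1 q.2 = 1) : T.card ≤ 3 := by
  refine hF.card_le_three_of_residues hT Nat.prime_three (fun q hq => ?_) (Or.inl (by norm_num))
  obtain ⟨k, hk⟩ := hP.exists_dvd (hT q hq)
  obtain ⟨h1, h2, h3⟩ := hk 3 8 (by norm_num) ⟨⟨4, -12, 0⟩, by
    rw [sub_eq_iff_eq_add]
    ext <;> simp [θ, pow_succ, -Int.cast_ofNat]⟩
  obtain ⟨-, -, h6⟩ := hk 2 4 (by norm_num) ⟨⟨0, -1, -1⟩, by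
    rw [sub_eq_iff_eq_add]
    ext <;> simp [θ, pow_succ, -Int.cast_ofNat]⟩
  have h4 : (k % 8).toNat < 8 := by omega
  have h7 : (k % 4).toNat = (k % 8).toNat % 4 := by omega
  push_cast at h1 h2 h3 h6
  rw [h7] at h6
  generalize (k % 8).toNat = r at h1 h2 h3 h4 h6
  interval_cases r
  · exact Or.inl (by simpa using And.intro h1 h2)
  · exact Or.inr (by simpa [θ] using And.intro h1 h2)
  all_goals simp [θ, pow_succ] at h3 h6

theorem IsComplexCubic.equiv_of_mul_eq_zero (hF : IsComplexCubic 1 0 t 1)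
    (hP : SolutionsArePowers 0 t) {T : Finset (ℤ × ℤ)}
    (hT : ∀ q ∈ T, cubicValue 1 0 t 1 q.1 q.2 = 1) (hcard : 4 ≤ T.card) : t = -1 ∨ t = 1 := by
  have h2 : t < 2 := by
    by_contra! h
    have := hF.card_le_three_zero hP hT h
    omega
  have h0 : t ≠ 0 := by
    rintro rfl
    simpa using hF.eq_zero 1 (-1) (by simp [cubicValue])
  have h1 : -2 < t := by
    by_contra! h
    have := hF.discr_neg
    unfold cubicDiscr at this
    nlinarith [mul_nonneg (sq_nonneg t) (by linarith : 0 ≤ -2 - t),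
      mul_nonneg (by linarith : 0 ≤ -t) (by linarith : 0 ≤ -2 - t)]
  omega

end Powers

/-- A form with at least four solutions is equivalent to one of three explicit forms. -/
theorem IsComplexCubic.equiv_of_four_solutions {a b c d : ℤ} (hF : IsComplexCubic a b c d)
    (hcard : 4 ≤ {q : ℤ × ℤ | cubicValue a b c d q.1 q.2 = 1}.ncard) :
    CubicEquiv a b c d 1 0 (-1) 1 ∨ CubicEquiv a b c d 1 0 1 1 ∨
      CubicEquiv a b c d 1 (-1) 1 1 := by
  have hT : ∀ a b c d : ℤ, 4 ≤ {q : ℤ × ℤ | cubicValue a b c d q.1 q.2 = 1}.ncard →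
      ∃ T : Finset (ℤ × ℤ), (∀ q ∈ T, cubicValue a b c d q.1 q.2 = 1) ∧ 4 ≤ T.card := by
    intro a b c d h
    have hfin : {q : ℤ × ℤ | cubicValue a b c d q.1 q.2 = 1}.Finite :=
      Set.finite_of_ncard_pos (by omega)
    exact ⟨hfin.toFinset, fun q hq => by simpa using hq,
      by rwa [← Set.ncard_eq_toFinset_card _ hfin]⟩
  obtain ⟨T, hT₁, hTcard⟩ := hT _ _ _ _ hcard
  obtain ⟨s, t, hE, hP⟩ := hF.exists_solutionsArePowers hT₁ (by omega)
  have hF' := hE.isComplexCubic hF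
  obtain ⟨T', hT', hcard'⟩ := hT 1 s t 1 (hE.ncard_eq ▸ hcard)
  have hswap : ∀ s t : ℤ, CubicEquiv 1 s t 1 1 t s 1 := fun s t =>
    ⟨0, 1, 1, 0, by norm_num, fun x y => by ring⟩
  obtain ⟨S', hS', hScard'⟩ := hT 1 t s 1 ((hE.trans (hswap s t)).ncard_eq ▸ hcard)
  have hG := (hE.trans (hswap s t)).isComplexCubic hF
  have hbound : ∀ n : ℤ, s * t = n → n ≠ 0 → |n| ≤ 3 → -3 ≤ s ∧ s ≤ 3 := fun n h hn h3 =>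
    abs_le.mp ((Int.le_of_dvd (abs_pos.mpr hn) ((abs_dvd_abs s n).mpr ⟨t, h.symm⟩)).trans h3)
  have hdisc := hF'.discr_neg
  unfold cubicDiscr at hdisc
  rcases hF'.mul_sub_one_cases hP hT' hcard' with h | h | h | h
  · rcases mul_eq_zero.mp h with rfl | rfl
    · rcases hF'.equiv_of_mul_eq_zero hP hT' hcard' with rfl | rfl
      · exact Or.inl hE
      · exact Or.inr (Or.inl hE)
    · rcases hG.equiv_of_mul_eq_zero hP.swap hS' hScard' with rfl | rfl
      · exact Or.inl (hE.trans (hswap _ _))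
      · exact Or.inr (Or.inl (hE.trans (hswap _ _)))
  · have hs : s = 1 ∧ t = 2 ∨ s = 2 ∧ t = 1 := by
      obtain ⟨h₁, h₂⟩ := hbound _ h (by norm_num) (by norm_num)
      have ht : -3 ≤ t ∧ t ≤ 3 := by
        interval_cases s <;> omega
      obtain ⟨h₃, h₄⟩ := ht
      interval_cases s <;> interval_cases t <;> omega
    refine Or.inl (hE.trans ?_)
    rcases hs with ⟨rfl, rfl⟩ | ⟨rfl, rfl⟩
    · exact ⟨1, 0, -1, 1, by norm_num, fun x y => by ring⟩
    · exact ⟨-1, 1, 1, 0, by norm_num, fun x y => by ring⟩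
  · have hs : s = 1 ∧ t = -1 ∨ s = -1 ∧ t = 1 := by
      obtain ⟨h₁, h₂⟩ := hbound _ h (by norm_num) (by norm_num)
      have ht : -3 ≤ t ∧ t ≤ 3 := by
        interval_cases s <;> omega
      obtain ⟨h₃, h₄⟩ := ht
      interval_cases s <;> interval_cases t <;> omega
    refine Or.inr (Or.inr ?_)
    rcases hs with ⟨rfl, rfl⟩ | ⟨rfl, rfl⟩
    · exact hE.trans (hswap _ _)
    · exact hE
  · have hs : s = 1 ∧ t = 3 ∨ s = 3 ∧ t = 1 := by
      obtain ⟨h₁, h₂⟩ := hbound _ h (by norm_num) (by norm_num)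
      have ht : -3 ≤ t ∧ t ≤ 3 := by
        interval_cases s <;> omega
      obtain ⟨h₃, h₄⟩ := ht
      interval_cases s <;> interval_cases t <;> omega
    rcases hs with ⟨rfl, rfl⟩ | ⟨rfl, rfl⟩
    · have := hF'.card_le_three_one_three hP hT'
      omega
    · have := hG.card_le_three_one_three hP.swap hS'
      omega

theorem ncard_ne_four : {q : ℤ × ℤ | cubicValue 1 0 (-1) 1 q.1 q.2 = 1}.ncard ≠ 4 := by
  intro h
  have hfin := Set.finite_of_ncard_pos (h ▸ (by norm_num : 0 < 4))
  have := Set.ncard_le_ncard (s := (({(1, 0), (0, 1), (1, 1), (-1, 1), (4, -3)} :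
    Finset (ℤ × ℤ)) : Set (ℤ × ℤ))) (by
      intro q hq
      simp only [Finset.coe_insert, Finset.coe_singleton, Set.mem_insert_iff,
        Set.mem_singleton_iff] at hq
      rcases hq with rfl | rfl | rfl | rfl | rfl <;> simp [cubicValue]) hfin
  rw [Set.ncard_coe_finset, h] at this
  exact absurd this (by decide)

theorem card_le_four_of_one_zero_one_one (hF : IsComplexCubic 1 0 1 1) {T : Finset (ℤ × ℤ)}
    (hT : ∀ q ∈ T, cubicValue 1 0 1 1 q.1 q.2 = 1) : T.card ≤ 4 := by
  have key : ∀ x y : ZMod 3, x ^ 3 + x * y ^ 2 + y ^ 3 = 1 →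
      (x = 1 ∧ y = 0) ∨ (x = 0 ∧ y = 1) ∨ (x = 1 ∧ y = 2) := by decide
  have hval : ∀ q ∈ T, (q.1 : ZMod 3) ^ 3 + q.1 * q.2 ^ 2 + q.2 ^ 3 = 1 := by
    intro q hq
    have := congrArg (fun z : ℤ => (z : ZMod 3)) (hT q hq)
    simpa [cubicValue] using this
  refine hF.card_le_of_coloring hT Nat.prime_three (n := 3) (fun q => (q.2 : ZMod 3).val)
    (fun q _ => ZMod.val_lt _) (fun q hq q' hq' h => ?_) (Or.inl (by norm_num))
  have h := ZMod.val_injective 3 h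
  rw [← ZMod.intCast_zmod_eq_zero_iff_dvd]
  unfold cross
  push_cast
  generalize hx : (q.1 : ZMod 3) = x
  have h1 := key _ _ (hval q hq)
  have h2 := key _ _ (hval q' hq')
  revert h h1 h2
  generalize (q.1 : ZMod 3) = x at *
  generalize (q.2 : ZMod 3) = y
  generalize (q'.1 : ZMod 3) = x'
  generalize (q'.2 : ZMod 3) = y'
  subst hx
  revert x y x' y'
  decide

theorem card_le_four_of_one_neg_one_one_one (hF : IsComplexCubic 1 (-1) 1 1) {T : Finset (ℤ × ℤ)}
    (hT : ∀ q ∈ T, cubicValue 1 (-1) 1 1 q.1 q.2 = 1) : T.card ≤ 4 := by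
  have key : ∀ x y x' y' : ZMod 2, x ^ 3 + -(x ^ 2 * y) + x * y ^ 2 + y ^ 3 = 1 →
      x' ^ 3 + -(x' ^ 2 * y') + x' * y' ^ 2 + y' ^ 3 = 1 → y = y' → x * y' - y * x' = 0 := by decide
  have hval : ∀ q ∈ T, (q.1 : ZMod 2) ^ 3 + -(q.1 ^ 2 * q.2) + q.1 * q.2 ^ 2 + q.2 ^ 3 = 1 := by
    intro q hq
    have := congrArg (fun z : ℤ => (z : ZMod 2)) (hT q hq)
    simpa [cubicValue] using this
  refine hF.card_le_two_mul_of_coloring hT Nat.prime_two (n := 2) (fun q => (q.2 : ZMod 2).val)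
    (fun q _ => ZMod.val_lt _) (fun q hq q' hq' h => ?_)
  rw [← ZMod.intCast_zmod_eq_zero_iff_dvd]
  unfold cross
  push_cast
  exact key _ _ _ _ (hval q hq) (hval q' hq') (ZMod.val_injective 2 h)

theorem cubicForm_ne_zero {a b c d : ℤ} (h : cubicDiscr a b c d < 0) : cubicForm a b c d ≠ 0 := by
  intro h0
  have hval : ∀ x y : ℤ, cubicValue a b c d x y = 0 := fun x y => by
    have := congrArg (eval ![(x : ℚ), (y : ℚ)]) h0
    simp only [cubicForm, map_add, map_mul, eval_C, map_pow, eval_X, map_zero,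
      Matrix.cons_val_zero, Matrix.cons_val_one] at this
    unfold cubicValue
    exact_mod_cast this
  have h1 := hval 1 0
  have h2 := hval 0 1
  have h3 := hval 1 1
  have h4 := hval 1 (-1)
  unfold cubicValue at h1 h2 h3 h4
  obtain rfl : a = 0 := by linarith
  obtain rfl : d = 0 := by linarith
  obtain rfl : b = 0 := by linarith
  obtain rfl : c = 0 := by linarith
  simp [cubicDiscr] at h

/-- A binary cubic form that is a product of a linear and a quadratic form is reducible. -/
theorem not_cubicForm_eq_mul {a b c d : ℤ}
    (hirr : ¬ ∃ (G H : MvPolynomial (Fin 2) ℚ) (i j : ℕ),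
      G.IsHomogeneous i ∧ H.IsHomogeneous j ∧
      0 < G.totalDegree ∧ 0 < H.totalDegree ∧ cubicForm a b c d = G * H)
    (hdisc : cubicDiscr a b c d < 0) (u v p q r : ℚ) :
    cubicForm a b c d ≠
      (C u * X 0 + C v * X 1) * (C p * X 0 ^ 2 + C q * (X 0 * X 1) + C r * X 1 ^ 2) := by
  intro h
  have hne := cubicForm_ne_zero hdisc
  rw [h] at hne
  have hlin : (C u * X 0 + C v * X 1 : MvPolynomial (Fin 2) ℚ).IsHomogeneous 1 :=
    ((isHomogeneous_X ℚ 0).C_mul u).add ((isHomogeneous_X ℚ 1).C_mul v)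
  have hquad : (C p * X 0 ^ 2 + C q * (X 0 * X 1) + C r * X 1 ^ 2 :
      MvPolynomial (Fin 2) ℚ).IsHomogeneous 2 :=
    ((((isHomogeneous_X ℚ 0).pow 2).C_mul p).add
      (((isHomogeneous_X ℚ 0).mul (isHomogeneous_X ℚ 1)).C_mul q)).add
      (((isHomogeneous_X ℚ 1).pow 2).C_mul r)
  refine hirr ⟨_, _, 1, 2, hlin, hquad, ?_, ?_, h⟩
  · rw [hlin.totalDegree (left_ne_zero_of_mul hne)]
    norm_num
  · rw [hquad.totalDegree (right_ne_zero_of_mul hne)]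
    norm_num

theorem isComplexCubic_of_irreducible {a b c d : ℤ}
    (hirr : ¬ ∃ (G H : MvPolynomial (Fin 2) ℚ) (i j : ℕ),
      G.IsHomogeneous i ∧ H.IsHomogeneous j ∧
      0 < G.totalDegree ∧ 0 < H.totalDegree ∧ cubicForm a b c d = G * H)
    (hdisc : cubicDiscr a b c d < 0) : IsComplexCubic a b c d := by
  refine ⟨fun x y h => ?_, hdisc⟩
  have hred := not_cubicForm_eq_mul hirr hdisc
  have h' : (a : ℚ) * x ^ 3 + b * x ^ 2 * y + c * x * y ^ 2 + d * y ^ 3 = 0 := by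
    unfold cubicValue at h
    exact_mod_cast h
  by_contra hxy
  by_cases hy : y = 0
  · subst hy
    have hx : (x : ℚ) ≠ 0 := by
      intro hx
      exact hxy ⟨by exact_mod_cast hx, rfl⟩
    have ha : (a : ℚ) = 0 := by simpa [hx] using h'
    refine hred 0 1 b c d ?_
    simp only [cubicForm, ha, C_0, C_1]
    ring
  · have hy' : (y : ℚ) ≠ 0 := by exact_mod_cast hy
    set p : ℚ := a / y with hp
    set q : ℚ := (b + x * p) / y with hq
    set r : ℚ := (c + x * q) / y with hr
    have hp' : (a : ℚ) = y * p := by rw [hp]; field_simp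
    have hq' : (b : ℚ) = y * q - x * p := by rw [hq]; field_simp; ring
    have hr' : (c : ℚ) = y * r - x * q := by rw [hr]; field_simp; ring
    have hd' : (d : ℚ) = -(x * r) := by
      rw [hp', hq', hr'] at h'
      have : (y : ℚ) ^ 3 * (d + x * r) = 0 := by linear_combination h'
      have := (mul_eq_zero.mp this).resolve_left (pow_ne_zero 3 hy')
      linear_combination this
    refine hred y (-x) p q r ?_
    unfold cubicForm
    rw [hp', hq', hr', hd']
    simp only [C_mul, C_sub, C_neg]
    ring

/-- **Theorem (Delone, Nagell).** Let `F` be an irreducible binary cubic form with integer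
coefficients and negative discriminant, and let `N_F` be the number of integer pairs `(m, n)`
with `F(m, n) = 1`. If `N_F = 5` then `F` is equivalent to `x^3 - x*y^2 + y^3`; if `N_F = 4`
then `F` is equivalent to `x^3 + x*y^2 + y^3` or to `x^3 - x^2*y + x*y^2 + y^3`. -/
theorem cubic_thue_four_or_five_solutions (a b c d : ℤ)
    (hirr : ¬ ∃ (G H : MvPolynomial (Fin 2) ℚ) (i j : ℕ),
      G.IsHomogeneous i ∧ H.IsHomogeneous j ∧
      0 < G.totalDegree ∧ 0 < H.totalDegree ∧ cubicForm a b c d = G * H)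
    (hdisc : 18 * a * b * c * d - 4 * b ^ 3 * d + b ^ 2 * c ^ 2 - 4 * a * c ^ 3
        - 27 * a ^ 2 * d ^ 2 < 0) :
    ({q : ℤ × ℤ | a * q.1 ^ 3 + b * q.1 ^ 2 * q.2 + c * q.1 * q.2 ^ 2 + d * q.2 ^ 3 = 1}.ncard
        = 5 → CubicEquiv a b c d 1 0 (-1) 1) ∧
    ({q : ℤ × ℤ | a * q.1 ^ 3 + b * q.1 ^ 2 * q.2 + c * q.1 * q.2 ^ 2 + d * q.2 ^ 3 = 1}.ncard
        = 4 → CubicEquiv a b c d 1 0 1 1 ∨ CubicEquiv a b c d 1 (-1) 1 1) := by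
  have hF := isComplexCubic_of_irreducible hirr hdisc
  change ({q : ℤ × ℤ | cubicValue a b c d q.1 q.2 = 1}.ncard = 5 → _) ∧
    ({q : ℤ × ℤ | cubicValue a b c d q.1 q.2 = 1}.ncard = 4 → _)
  refine ⟨fun h => ?_, fun h => ?_⟩
  · have hfive : ∀ s t : ℤ, CubicEquiv a b c d 1 s t 1 →
        ∃ T : Finset (ℤ × ℤ), (∀ q ∈ T, cubicValue 1 s t 1 q.1 q.2 = 1) ∧ T.card = 5 := by
      intro s t hE
      rw [hE.ncard_eq] at h
      have hfin : {q : ℤ × ℤ | cubicValue 1 s t 1 q.1 q.2 = 1}.Finite :=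
        Set.finite_of_ncard_pos (by omega)
      exact ⟨hfin.toFinset, fun q hq => by simpa using hq,
        by rwa [← Set.ncard_eq_toFinset_card _ hfin]⟩
    rcases hF.equiv_of_four_solutions (by omega) with hE | hE | hE
    · exact hE
    · obtain ⟨T, hT, hcard⟩ := hfive _ _ hE
      have := card_le_four_of_one_zero_one_one (hE.isComplexCubic hF) hT
      omega
    · obtain ⟨T, hT, hcard⟩ := hfive _ _ hE
      have := card_le_four_of_one_neg_one_one_one (hE.isComplexCubic hF) hT
      omega
  · rcases hF.equiv_of_four_solutions h.ge with hE | hE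
    · exact absurd (hE.ncard_eq ▸ h) ncard_ne_four
    · exact hE
end

section
/- Let p be a prime and let (a_n) be a sequence of p-adic numbers (elements of Q_p) such that v_p(a_n) → ∞ as n → ∞ (equivalently, ‖a_n‖_p → 0) and not all a_n are zero. Let r = min_n v_p(a_n) and N = max{ n : v_p(a_n) = r } (both of which exist under these hypotheses). Then for every x in Z_p the series f(x) = Σ_{n≥0} a_n x^n converges in Q_p, and the set { x ∈ Z_p : f(x) = 0 } is finite of cardinality at most N. -/
open Filter

section Ultrametric

open scoped Topology

theorem IsUltrametricDist.norm_tsum_lt_of_forall_lt {ι E : Type*} [NormedAddCommGroup E]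
    [IsUltrametricDist E] {f : ι → E} {r : ℝ} (hr : 0 < r) (h : ∀ i, ‖f i‖ < r) :
    ‖∑' i, f i‖ < r := by
  by_cases hf : Summable f
  · have hmem : ∑' i, f i ∈ Metric.ball (0 : E) r :=
      (IsUltrametricDist.isClosed_ball (0 : E) r).mem_of_tendsto hf.hasSum <|
        Eventually.of_forall fun s ↦
          sum_mem (S := IsUltrametricDist.ball_openAddSubgroup E hr)
            fun i _ ↦ mem_ball_zero_iff.2 (h i)
    exact mem_ball_zero_iff.1 hmem
  · rwa [tsum_eq_zero_of_not_summable hf, norm_zero]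

variable {K : Type*} [NormedField K]

theorem norm_mul_pow_le_of_norm_le_one {x : K} (hx : ‖x‖ ≤ 1) (y : K) (n : ℕ) :
    ‖y * x ^ n‖ ≤ ‖y‖ := by
  rw [norm_mul, norm_pow]
  exact mul_le_of_le_one_right (norm_nonneg y) (pow_le_one₀ (norm_nonneg x) hx)

/-- The coefficients of the quotient of `∑ aₙ Xⁿ` by `X - c`. -/
noncomputable def divXSubCoeff (a : ℕ → K) (c : K) (j : ℕ) : K :=
  ∑' k, a (j + 1 + k) * c ^ k

variable [IsUltrametricDist K]

theorem summable_mul_pow_of_tendsto_zero [CompleteSpace K] {a : ℕ → K}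
    (ha : Tendsto a atTop (𝓝 0)) {x : K} (hx : ‖x‖ ≤ 1) : Summable fun n ↦ a n * x ^ n := by
  refine NonarchimedeanAddGroup.summable_of_tendsto_cofinite_zero ?_
  rw [Nat.cofinite_eq_atTop]
  exact squeeze_zero_norm (fun n ↦ norm_mul_pow_le_of_norm_le_one hx (a n) n)
    (tendsto_zero_iff_norm_tendsto_zero.1 ha)

theorem norm_divXSubCoeff_lt {a : ℕ → K} {c : K} (hc : ‖c‖ ≤ 1) {j : ℕ} {r : ℝ}
    (h : ∀ n, j < n → ‖a n‖ < r) : ‖divXSubCoeff a c j‖ < r :=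
  IsUltrametricDist.norm_tsum_lt_of_forall_lt ((norm_nonneg _).trans_lt (h _ j.lt_succ_self))
    fun k ↦ (norm_mul_pow_le_of_norm_le_one hc _ k).trans_lt (h _ (by omega))

theorem norm_divXSubCoeff_le {a : ℕ → K} {c : K} (hc : ‖c‖ ≤ 1) {r : ℝ}
    (h : ∀ n, ‖a n‖ ≤ r) (j : ℕ) : ‖divXSubCoeff a c j‖ ≤ r :=
  IsUltrametricDist.norm_tsum_le_of_forall_le
    fun k ↦ (norm_mul_pow_le_of_norm_le_one hc _ k).trans (h _)

theorem tendsto_divXSubCoeff {a : ℕ → K} (ha : Tendsto a atTop (𝓝 0)) {c : K} (hc : ‖c‖ ≤ 1) :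
    Tendsto (divXSubCoeff a c) atTop (𝓝 0) := by
  simp only [NormedAddCommGroup.tendsto_atTop, sub_zero] at ha ⊢
  intro ε hε
  obtain ⟨M, hM⟩ := ha ε hε
  exact ⟨M, fun j hj ↦ norm_divXSubCoeff_lt hc fun n hn ↦ hM n (hj.trans hn.le)⟩

variable [CompleteSpace K]

theorem divXSubCoeff_eq_add {a : ℕ → K} (ha : Tendsto a atTop (𝓝 0)) {c : K} (hc : ‖c‖ ≤ 1)
    (j : ℕ) : divXSubCoeff a c j = a (j + 1) + c * divXSubCoeff a c (j + 1) := by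
  have hs : Summable fun k ↦ a (j + 1 + k) * c ^ k :=
    summable_mul_pow_of_tendsto_zero (a := fun k ↦ a (j + 1 + k))
      (ha.comp (tendsto_atTop_mono (Nat.le_add_left · (j + 1)) tendsto_id)) hc
  rw [divXSubCoeff, hs.tsum_eq_zero_add, divXSubCoeff, ← tsum_mul_left]
  simp only [add_zero, pow_zero, mul_one]
  congr 1
  refine tsum_congr fun k ↦ ?_
  rw [show j + 1 + (k + 1) = j + 1 + 1 + k by ring]
  ring

theorem tsum_eq_add_mul_divXSubCoeff {a : ℕ → K} (ha : Tendsto a atTop (𝓝 0)) {c : K}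
    (hc : ‖c‖ ≤ 1) : ∑' n, a n * c ^ n = a 0 + c * divXSubCoeff a c 0 := by
  rw [(summable_mul_pow_of_tendsto_zero ha hc).tsum_eq_zero_add, divXSubCoeff, ← tsum_mul_left,
    pow_zero, mul_one]
  congr 1
  refine tsum_congr fun k ↦ ?_
  rw [show 0 + 1 + k = k + 1 by ring]
  ring

theorem tsum_sub_tsum_eq_mul_tsum_divXSubCoeff {a : ℕ → K} (ha : Tendsto a atTop (𝓝 0))
    {c x : K} (hc : ‖c‖ ≤ 1) (hx : ‖x‖ ≤ 1) :
    ∑' n, a n * x ^ n - ∑' n, a n * c ^ n = (x - c) * ∑' n, divXSubCoeff a c n * x ^ n := by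
  have hb := summable_mul_pow_of_tendsto_zero (tendsto_divXSubCoeff ha hc) hx
  have hb' := (summable_nat_add_iff 1).2 hb
  have key : ∑' n, a (n + 1) * x ^ (n + 1) = x * ∑' n, divXSubCoeff a c n * x ^ n
      - c * ∑' n, divXSubCoeff a c (n + 1) * x ^ (n + 1) := by
    rw [← tsum_mul_left, ← tsum_mul_left, ← (hb.mul_left x).tsum_sub (hb'.mul_left c)]
    refine tsum_congr fun n ↦ ?_
    rw [divXSubCoeff_eq_add ha hc n]
    ring
  have h0 := hb.tsum_eq_zero_add
  rw [tsum_eq_add_mul_divXSubCoeff ha hc,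
    (summable_mul_pow_of_tendsto_zero ha hx).tsum_eq_zero_add, key]
  rw [pow_zero, mul_one] at h0 ⊢
  linear_combination c * h0

/-- Strassmann's theorem over a complete ultrametric field. -/
theorem encard_setOf_tsum_eq_zero_le {N : ℕ} {a : ℕ → K} (ha : Tendsto a atTop (𝓝 0))
    (hmax : ∀ n, ‖a n‖ ≤ ‖a N‖) (hlast : ∀ n, N < n → ‖a n‖ < ‖a N‖) :
    {x : K | ‖x‖ ≤ 1 ∧ ∑' n, a n * x ^ n = 0}.encard ≤ N := by
  induction N generalizing a with
  | zero =>
    rw [Nat.cast_zero, nonpos_iff_eq_zero, Set.encard_eq_zero, Set.eq_empty_iff_forall_notMem]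
    rintro x ⟨hx, h⟩
    rw [tsum_eq_add_mul_divXSubCoeff ha hx] at h
    have hlt : ‖x * divXSubCoeff a x 0‖ < ‖a 0‖ := by
      rw [norm_mul]
      exact (mul_le_of_le_one_left (norm_nonneg _) hx).trans_lt (norm_divXSubCoeff_lt hx hlast)
    rw [eq_neg_of_add_eq_zero_left h, norm_neg] at hlt
    exact hlt.false
  | succ N ih =>
    obtain hS | ⟨c, hc, hc0⟩ := {x : K | ‖x‖ ≤ 1 ∧ ∑' n, a n * x ^ n = 0}.eq_empty_or_nonempty
    · simp [hS]
    have hlt : ‖c * divXSubCoeff a c (N + 1)‖ < ‖a (N + 1)‖ := by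
      rw [norm_mul]
      exact (mul_le_of_le_one_left (norm_nonneg _) hc).trans_lt (norm_divXSubCoeff_lt hc hlast)
    have hN : ‖divXSubCoeff a c N‖ = ‖a (N + 1)‖ := by
      rw [divXSubCoeff_eq_add ha hc, IsUltrametricDist.norm_add_eq_max_of_norm_ne_norm hlt.ne',
        max_eq_left hlt.le]
    have hquot := ih (tendsto_divXSubCoeff ha hc)
      (fun n ↦ hN ▸ norm_divXSubCoeff_le hc hmax n)
      (fun n hn ↦ hN ▸ norm_divXSubCoeff_lt hc fun m hm ↦ hlast m (by omega))
    have hsub : {x : K | ‖x‖ ≤ 1 ∧ ∑' n, a n * x ^ n = 0} ⊆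
        insert c {x : K | ‖x‖ ≤ 1 ∧ ∑' n, divXSubCoeff a c n * x ^ n = 0} := by
      rintro x ⟨hx, h⟩
      have hfac := tsum_sub_tsum_eq_mul_tsum_divXSubCoeff ha hc hx
      rw [h, hc0, sub_zero, eq_comm, mul_eq_zero, sub_eq_zero] at hfac
      exact hfac.imp_right fun h' ↦ ⟨hx, h'⟩
    rw [Nat.cast_add, Nat.cast_one]
    exact (Set.encard_le_encard hsub).trans ((Set.encard_insert_le _ _).trans (by gcongr))

end Ultrametric

/-- **Theorem (Strassmann).** Let `f = Σ a_n x^n` be a power series with coefficients in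
`ℚ_[p]`. Suppose that `v_p(a_n) → ∞` (equivalently `‖a_n‖ → 0`) and that not all `a_n` vanish.
Let `r = min_n v_p(a_n)` and `N = max {n : v_p(a_n) = r}`; equivalently, `N` is an index with
`a_N ≠ 0`, `‖a_n‖ ≤ ‖a_N‖` for all `n`, and `‖a_n‖ < ‖a_N‖` for all `n > N`. Then the series
converges for every `x ∈ ℤ_[p]`, and `f(x) = 0` has at most `N` solutions in `ℤ_[p]`. -/
theorem strassmann (p : ℕ) [Fact p.Prime] (a : ℕ → ℚ_[p])
    (htend : Tendsto (fun n => ‖a n‖) atTop (nhds 0))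
    (N : ℕ) (hN : a N ≠ 0)
    (hmax : ∀ n, ‖a n‖ ≤ ‖a N‖)
    (hlast : ∀ n, N < n → ‖a n‖ < ‖a N‖) :
    (∀ x : ℤ_[p], Summable (fun n => a n * (x : ℚ_[p]) ^ n)) ∧
      {x : ℤ_[p] | ∑' n : ℕ, a n * (x : ℚ_[p]) ^ n = 0}.Finite ∧
      {x : ℤ_[p] | ∑' n : ℕ, a n * (x : ℚ_[p]) ^ n = 0}.ncard ≤ N := by
  have ha : Tendsto a atTop (nhds 0) := tendsto_zero_iff_norm_tendsto_zero.2 htend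
  have hcard : {x : ℤ_[p] | ∑' n : ℕ, a n * (x : ℚ_[p]) ^ n = 0}.encard ≤ N := by
    have hinj : Function.Injective ((↑) : ℤ_[p] → ℚ_[p]) := fun _ _ ↦ PadicInt.ext
    refine (hinj.encard_image _).ge.trans <|
      (Set.encard_le_encard ?_).trans (encard_setOf_tsum_eq_zero_le ha hmax hlast)
    rintro _ ⟨x, hx, rfl⟩
    exact ⟨x.2, hx⟩
  exact ⟨fun x ↦ summable_mul_pow_of_tendsto_zero ha x.2,
    Set.finite_of_encard_le_coe hcard, ENat.toNat_le_of_le_natCast hcard⟩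
end

section
/- Let p be a prime and set q = 4 if p = 2 and q = p if p > 2, and let R be as in the context. For every n ≥ 1 the rational number q^n/n lies in Z_p, and for every x in R the series log(1 + q*x) := Σ_{n≥1} (-1)^{n+1} · (q^n/n) · x^n converges in R (where (q^n/n) · x^n denotes the action of the element q^n/n of Z_p on R); moreover its sum lies in the topological closure of the ideal q*R of R. -/
/-- The inverse of the `p`-adic norm of a positive natural number is at most that number. -/
theorem Padic.inv_norm_natCast_le (p : ℕ) [Fact p.Prime] {n : ℕ} (hn : n ≠ 0) :
    ‖(n : ℚ_[p])‖⁻¹ ≤ n := by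
  have hp : (p : ℝ) ≠ 0 := by exact_mod_cast (Fact.out : p.Prime).ne_zero
  rw [Padic.norm_eq_zpow_neg_valuation (by exact_mod_cast hn), Padic.valuation_natCast,
    zpow_neg, inv_inv, zpow_natCast]
  exact_mod_cast Nat.le_of_dvd (Nat.pos_of_ne_zero hn) pow_padicValNat_dvd

/-- A `p`-adic number `a` of norm at most `1 / 2` satisfies
`‖a ^ n / n‖ ≤ n * (1 / 2) ^ (n - 1) * ‖a‖` for `n ≥ 1`, written here with `n + 1` in place of `n`. -/
theorem Padic.norm_pow_succ_div_natCast_le (p : ℕ) [Fact p.Prime] {a : ℚ_[p]}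
    (ha : ‖a‖ ≤ 1 / 2) (n : ℕ) :
    ‖a ^ (n + 1) / ((n + 1 : ℕ) : ℚ_[p])‖ ≤ (n + 1 : ℕ) * (1 / 2 : ℝ) ^ n * ‖a‖ := by
  rw [norm_div, norm_pow, div_eq_mul_inv, pow_succ]
  calc ‖a‖ ^ n * ‖a‖ * ‖((n + 1 : ℕ) : ℚ_[p])‖⁻¹
      ≤ (1 / 2 : ℝ) ^ n * ‖a‖ * (n + 1 : ℕ) := by
        gcongr
        exact Padic.inv_norm_natCast_le p n.succ_ne_zero
    _ = _ := by ring

theorem succ_mul_half_pow_le_one (n : ℕ) : ((n + 1 : ℕ) : ℝ) * (1 / 2 : ℝ) ^ n ≤ 1 := by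
  have h : ((n + 1 : ℕ) : ℝ) ≤ 2 ^ n := by exact_mod_cast Nat.succ_le_of_lt n.lt_two_pow_self
  rw [one_div, inv_pow, ← div_eq_mul_inv]
  exact div_le_one_of_le₀ h (by positivity)

theorem tendsto_succ_mul_half_pow :
    Filter.Tendsto (fun n : ℕ => ((n + 1 : ℕ) : ℝ) * (1 / 2 : ℝ) ^ n) Filter.atTop (nhds 0) := by
  have h := (tendsto_self_mul_const_pow_of_lt_one (r := (1 / 2 : ℝ))
    (by norm_num) (by norm_num)).add
    (tendsto_pow_atTop_nhds_zero_of_lt_one (r := (1 / 2 : ℝ)) (by norm_num) (by norm_num))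
  rw [add_zero] at h
  refine h.congr fun n => ?_
  push_cast
  ring

theorem PadicInt.dvd_of_norm_le {p : ℕ} [Fact p.Prime] {a b : ℤ_[p]} (hb : b ≠ 0)
    (h : ‖a‖ ≤ ‖b‖) : b ∣ a := by
  have hb' : (b : ℚ_[p]) ≠ 0 := fun h0 => hb (Subtype.ext h0)
  refine ⟨⟨(a : ℚ_[p]) / b, ?_⟩, ?_⟩
  · rw [norm_div]
    exact div_le_one_of_le₀ h (norm_nonneg _)
  · apply Subtype.ext
    change (a : ℚ_[p]) = b * (a / b)
    field_simp


/-- Let `p` be a prime, `q = 4` if `p = 2` and `q = p` otherwise, and let `R` be a complete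
nonarchimedean commutative normed ring with `‖x‖ ≤ 1` for all `x`, which is a `ℤ_[p]`-algebra
whose structure map is norm-nonincreasing. Then the rational numbers `q^n/n` (for `n ≥ 1`) lie
in `ℤ_[p]`, and for every `x ∈ R` the series
`log(1 + q*x) = Σ_{n≥1} (-1)^{n+1} (q^n/n) x^n` converges in `R`, with sum lying in the
topological closure of the ideal `qR`. -/
theorem padic_log_one_add_converges (p : ℕ) [Fact p.Prime] (q : ℕ)
    (hq : q = if p = 2 then 4 else p)
    (R : Type*) [NormedCommRing R] [CompleteSpace R] [Algebra ℤ_[p] R]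
    (hna : ∀ x y : R, ‖x + y‖ ≤ max ‖x‖ ‖y‖)
    (hbd : ∀ x : R, ‖x‖ ≤ 1)
    (hmap : ∀ c : ℤ_[p], ‖algebraMap ℤ_[p] R c‖ ≤ ‖c‖) :
    (∀ n : ℕ, 1 ≤ n → ‖(q : ℚ_[p]) ^ n / (n : ℚ_[p])‖ ≤ 1) ∧
      ∀ c : ℕ → ℤ_[p],
        (∀ n : ℕ, 1 ≤ n →
          ((c n : ℚ_[p])) = (-1) ^ (n + 1) * (q : ℚ_[p]) ^ n / (n : ℚ_[p])) →
        ∀ x : R,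
          Summable (fun n : ℕ => c (n + 1) • x ^ (n + 1)) ∧
          (∑' n : ℕ, c (n + 1) • x ^ (n + 1)) ∈
            closure ((Ideal.span {(q : R)} : Ideal R) : Set R) := by
  have hp : p.Prime := Fact.out
  have hpn : ‖(p : ℚ_[p])‖ ≤ 1 / 2 := by
    rw [Padic.norm_p, one_div]
    have : (2 : ℝ) ≤ p := by exact_mod_cast hp.two_le
    gcongr
  have hpq : p ∣ q := by
    rw [hq]
    split_ifs with h
    · rw [h]; norm_num
    · exact dvd_rfl
  have hq0 : q ≠ 0 := by
    rw [hq]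
    split_ifs
    · norm_num
    · exact hp.ne_zero
  have hqn : ‖(q : ℚ_[p])‖ ≤ 1 / 2 := by
    obtain ⟨k, rfl⟩ := hpq
    rw [Nat.cast_mul, norm_mul]
    have hk : ‖(k : ℚ_[p])‖ ≤ 1 := by exact_mod_cast Padic.norm_int_le_one (p := p) k
    nlinarith [norm_nonneg (p : ℚ_[p]), norm_nonneg (k : ℚ_[p])]
  have hbound := Padic.norm_pow_succ_div_natCast_le p hqn
  refine ⟨fun n hn => ?_, fun c hc x => ?_⟩
  · obtain ⟨n, rfl⟩ := Nat.exists_eq_add_of_le' hn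
    refine (hbound n).trans (mul_le_one₀ (succ_mul_half_pow_le_one n) (norm_nonneg _) ?_)
    linarith
  have hcn (n : ℕ) : ‖c (n + 1)‖ ≤ (n + 1 : ℕ) * (1 / 2 : ℝ) ^ n * ‖(q : ℚ_[p])‖ := by
    refine le_trans (le_of_eq ?_) (hbound n)
    rw [PadicInt.norm_def, hc (n + 1) (by omega), mul_div_assoc, norm_mul, norm_pow, norm_neg,
      norm_one, one_pow, one_mul]
  have hsmul (a : ℤ_[p]) (y : R) : ‖a • y‖ ≤ ‖a‖ := by
    rw [Algebra.smul_def]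
    exact (norm_mul_le _ _).trans
      ((mul_le_of_le_one_right (norm_nonneg _) (hbd y)).trans (hmap a))
  have : IsUltrametricDist R :=
    IsUltrametricDist.isUltrametricDist_of_forall_norm_add_le_max_norm hna
  have hsum : Summable (fun n : ℕ => c (n + 1) • x ^ (n + 1)) := by
    apply NonarchimedeanAddGroup.summable_of_tendsto_cofinite_zero
    rw [Nat.cofinite_eq_atTop]
    refine squeeze_zero_norm (fun n => (hsmul _ _).trans (hcn n)) ?_
    simpa using tendsto_succ_mul_half_pow.mul_const ‖(q : ℚ_[p])‖
  refine ⟨hsum, mem_closure_of_tendsto hsum.hasSum (Filter.Eventually.of_forall fun s => ?_)⟩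
  refine Ideal.sum_mem _ fun n _ => Ideal.mem_span_singleton.2 ?_
  have hdvd : (q : ℤ_[p]) ∣ c (n + 1) := by
    apply PadicInt.dvd_of_norm_le (by exact_mod_cast hq0)
    refine (hcn n).trans ?_
    rw [PadicInt.norm_def, PadicInt.coe_natCast]
    exact mul_le_of_le_one_left (norm_nonneg _) (succ_mul_half_pow_le_one n)
  rw [Algebra.smul_def]
  have := map_dvd (algebraMap ℤ_[p] R) hdvd
  rw [map_natCast] at this
  exact this.mul_right _
end

section
/- Let p be a prime and set q = 4 if p = 2 and q = p if p > 2, and let R be as in the context. Define, for x in R, ℓ(x) := Σ_{n≥1} (-1)^{n+1} · (q^{n-1}/n) · x^n (the coefficients q^{n-1}/n lie in Z_p and the series converges in R), so that q·ℓ(x) = log(1+q*x), and define exp(q*y) := Σ_{n≥0} (q^n/n!) · y^n for y in R. Then: (1) for all x in R, exp(q·ℓ(x)) = 1 + q*x, i.e., Σ_{n≥0} (q^n/n!) · ℓ(x)^n = 1 + q*x; and (2) for all x, y in R, exp(q*(x+y)) = exp(q*x) · exp(q*y). -/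
open Filter Topology PowerSeries

theorem NonarchimedeanRing.of_isUltrametricDist (S : Type*) [NormedCommRing S]
    [IsUltrametricDist S] : NonarchimedeanRing S where
  is_nonarchimedean := NonarchimedeanAddGroup.is_nonarchimedean

theorem tsum_mul_tsum_eq_tsum_sum_antidiagonal_of_isUltrametricDist {R : Type*}
    [NormedCommRing R] [IsUltrametricDist R] {f g : ℕ → R}
    (hf : Summable f) (hg : Summable g) :
    (∑' n, f n) * (∑' n, g n) =
      ∑' n, ∑ kl ∈ Finset.HasAntidiagonal.antidiagonal n, f kl.1 * g kl.2 :=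
  haveI := NonarchimedeanRing.of_isUltrametricDist R
  hf.tsum_mul_tsum_eq_tsum_sum_antidiagonal hg (hf.mul_of_nonarchimedean hg)

section PowerSeriesEvaluation

variable {A R : Type*} [NormedCommRing A] [NormedCommRing R] [Algebra A R]

theorem norm_smul_le_of_norm_algebraMap_le (hbd : ∀ x : R, ‖x‖ ≤ 1)
    (hmap : ∀ a : A, ‖algebraMap A R a‖ ≤ ‖a‖) (a : A) (x : R) : ‖a • x‖ ≤ ‖a‖ := by
  rw [Algebra.smul_def]
  calc ‖algebraMap A R a * x‖ ≤ ‖algebraMap A R a‖ * ‖x‖ := norm_mul_le _ _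
    _ ≤ ‖a‖ * 1 := mul_le_mul (hmap a) (hbd x) (norm_nonneg _) (norm_nonneg _)
    _ = ‖a‖ := mul_one _

variable [IsUltrametricDist R] [CompleteSpace R]

theorem summable_smul_of_tendsto_zero (hbd : ∀ x : R, ‖x‖ ≤ 1)
    (hmap : ∀ a : A, ‖algebraMap A R a‖ ≤ ‖a‖) {c : ℕ → A} (hc : Tendsto c atTop (𝓝 0))
    (f : ℕ → R) : Summable fun n ↦ c n • f n := by
  apply NonarchimedeanAddGroup.summable_of_tendsto_cofinite_zero
  rw [Nat.cofinite_eq_atTop]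
  exact squeeze_zero_norm (fun n ↦ norm_smul_le_of_norm_algebraMap_le hbd hmap _ _)
    (tendsto_zero_iff_norm_tendsto_zero.1 hc)

theorem tsum_coeff_mul_smul_pow (hbd : ∀ x : R, ‖x‖ ≤ 1)
    (hmap : ∀ a : A, ‖algebraMap A R a‖ ≤ ‖a‖) {F G : A⟦X⟧}
    (hF : Tendsto (fun n ↦ coeff n F) atTop (𝓝 0))
    (hG : Tendsto (fun n ↦ coeff n G) atTop (𝓝 0)) (x : R) :
    ∑' n, coeff n (F * G) • x ^ n = (∑' n, coeff n F • x ^ n) * ∑' n, coeff n G • x ^ n := by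
  rw [tsum_mul_tsum_eq_tsum_sum_antidiagonal_of_isUltrametricDist
    (summable_smul_of_tendsto_zero hbd hmap hF _) (summable_smul_of_tendsto_zero hbd hmap hG _)]
  refine tsum_congr fun n ↦ ?_
  rw [coeff_mul, Finset.sum_smul]
  refine Finset.sum_congr rfl fun kl hkl ↦ ?_
  rw [smul_mul_smul_comm, ← pow_add, Finset.HasAntidiagonal.mem_antidiagonal.1 hkl]

theorem tendsto_coeff_pow_zero [IsUltrametricDist A] {F : A⟦X⟧}
    (hF : Tendsto (fun n ↦ coeff n F) atTop (𝓝 0)) (k : ℕ) :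
    Tendsto (fun n ↦ coeff n (F ^ k)) atTop (𝓝 0) := by
  have restricted_iff (G : A⟦X⟧) :
      IsRestricted 1 G ↔ Tendsto (fun n ↦ coeff n G) atTop (𝓝 0) := by
    simp [isRestricted_iff', tendsto_zero_iff_norm_tendsto_zero (f := fun n ↦ coeff n G)]
  rw [← restricted_iff] at hF ⊢
  induction k with
  | zero => simpa using isRestricted_one (R := A) 1
  | succ k ih => rw [pow_succ]; exact isRestricted.mul 1 ih hF

theorem tsum_coeff_pow_smul_pow [IsUltrametricDist A] (hbd : ∀ x : R, ‖x‖ ≤ 1)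
    (hmap : ∀ a : A, ‖algebraMap A R a‖ ≤ ‖a‖) {F : A⟦X⟧}
    (hF : Tendsto (fun n ↦ coeff n F) atTop (𝓝 0)) (x : R) (k : ℕ) :
    ∑' n, coeff n (F ^ k) • x ^ n = (∑' n, coeff n F • x ^ n) ^ k := by
  induction k with
  | zero =>
    rw [tsum_eq_single 0 fun n hn ↦ by simp [coeff_one, hn]]
    simp
  | succ k ih =>
    rw [pow_succ, tsum_coeff_mul_smul_pow hbd hmap (tendsto_coeff_pow_zero hF k) hF, ih, pow_succ]

theorem tsum_smul_tsum_pow_eq_tsum_coeff_subst [IsUltrametricDist A] (hbd : ∀ x : R, ‖x‖ ≤ 1)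
    (hmap : ∀ a : A, ‖algebraMap A R a‖ ≤ ‖a‖) {F G : A⟦X⟧}
    (hF : Tendsto (fun n ↦ coeff n F) atTop (𝓝 0))
    (hG : Tendsto (fun n ↦ coeff n G) atTop (𝓝 0)) (hG₀ : constantCoeff G = 0) (x : R) :
    ∑' n, coeff n F • (∑' m, coeff m G • x ^ m) ^ n = ∑' m, coeff m (F.subst G) • x ^ m := by
  have row (n : ℕ) : Summable fun m ↦ coeff m (G ^ n) • x ^ m :=
    summable_smul_of_tendsto_zero hbd hmap (tendsto_coeff_pow_zero hG n) _
  have row_smul (n : ℕ) : Summable fun m ↦ coeff n F • coeff m (G ^ n) • x ^ m := by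
    simpa only [Algebra.smul_def (coeff n F)] using (row n).mul_left (algebraMap A R (coeff n F))
  have double : Summable
      (Function.uncurry fun n m ↦ coeff n F • coeff m (G ^ n) • x ^ m) := by
    apply NonarchimedeanAddGroup.summable_of_tendsto_cofinite_zero
    rw [Metric.tendsto_nhds]
    intro ε hε
    obtain ⟨N, hN⟩ := Metric.tendsto_atTop.1 hF ε hε
    rw [eventually_cofinite]
    refine ((Set.finite_lt_nat N).biUnion fun n _ ↦
      ((eventually_cofinite.1 (Metric.tendsto_nhds.1
        (row_smul n).tendsto_cofinite_zero ε hε)).image fun m ↦ (n, m))).subset ?_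
    rintro ⟨n, m⟩ hnm
    simp only [Set.mem_iUnion]
    refine ⟨n, ?_, m, hnm, rfl⟩
    by_contra hn
    refine hnm (lt_of_le_of_lt ?_ (hN n (not_lt.1 hn)))
    rw [dist_zero_right, dist_zero_right]
    exact norm_smul_le_of_norm_algebraMap_le hbd hmap _ _
  have hsubst : HasSubst G := HasSubst.of_constantCoeff_zero' hG₀
  calc ∑' n, coeff n F • (∑' m, coeff m G • x ^ m) ^ n
      = ∑' n, ∑' m, coeff n F • coeff m (G ^ n) • x ^ m := by
        refine tsum_congr fun n ↦ ?_
        rw [← tsum_coeff_pow_smul_pow hbd hmap hG]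
        simp only [Algebra.smul_def (coeff n F)]
        exact ((row n).tsum_mul_left _).symm
    _ = ∑' m, ∑' n, coeff n F • coeff m (G ^ n) • x ^ m := double.tsum_comm.symm
    _ = ∑' m, coeff m (F.subst G) • x ^ m := by
        refine tsum_congr fun m ↦ ?_
        have finite := coeff_subst_finite' hsubst F m
        let φ : A →+ R := (LinearMap.toSpanSingleton A R (x ^ m)).toAddMonoidHom
        have hφ (n : ℕ) :
            coeff n F • coeff m (G ^ n) • x ^ m = φ (coeff n F • coeff m (G ^ n)) :=
          (smul_assoc _ _ _).symm
        simp only [hφ]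
        rw [tsum_eq_finsum (Set.Finite.subset finite fun n hn h ↦
            hn ((congrArg φ h).trans (map_zero φ))),
          ← AddMonoidHom.map_finsum φ finite, ← coeff_subst' hsubst]
        rfl

end PowerSeriesEvaluation

/-- If `dE = qE`, `(1 + qX) dL = 1`, `E(0) = 1` and `L(0) = 0`, then `E(L(X)) = 1 + qX`. -/
theorem PowerSeries.subst_eq_one_add_C_mul_X {A : Type*} [CommRing A] [IsDomain A] [CharZero A]
    {E L : A⟦X⟧} {q : A} (hE : d⁄dX A E = C q * E) (hL : (1 + C q * X) * d⁄dX A L = 1)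
    (hE₀ : constantCoeff E = 1) (hL₀ : constantCoeff L = 0) : E.subst L = 1 + C q * X := by
  have hsubst : HasSubst L := HasSubst.of_constantCoeff_zero' hL₀
  have subst_C_mul : (C q * E).subst L = C q * E.subst L := by
    rw [← smul_eq_C_mul, subst_smul hsubst, smul_eq_C_mul]
  have ode : (1 + C q * X) * d⁄dX A (E.subst L) = C q * E.subst L := by
    rw [derivative_subst hsubst, hE, subst_C_mul]
    linear_combination (C q * E.subst L) * hL
  have zero : coeff 0 (E.subst L) = 1 := by
    rw [coeff_subst' hsubst, finsum_eq_single _ 0 fun n hn ↦ by simp [hL₀, hn]]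
    simp [hE₀]
  have step (n : ℕ) : coeff (n + 1) (E.subst L) * (n + 1) = q * (1 - n) * coeff n (E.subst L) := by
    have h := congrArg (coeff n) ode
    rw [add_mul, one_mul, mul_assoc, map_add, coeff_C_mul, coeff_C_mul, coeff_derivative] at h
    cases n with
    | zero => simpa using h
    | succ n =>
      rw [coeff_succ_X_mul, coeff_derivative] at h
      push_cast at h ⊢
      linear_combination h
  have one : coeff 1 (E.subst L) = q := by simpa [zero] using step 0
  have vanish (n : ℕ) : coeff (n + 2) (E.subst L) = 0 := by
    have ne (k : ℕ) : (k : A) + 1 ≠ 0 := Nat.cast_add_one_ne_zero k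
    induction n with
    | zero => exact (mul_eq_zero.1 ((step 1).trans (by simp))).resolve_right (ne 1)
    | succ n ih =>
      exact (mul_eq_zero.1 ((step (n + 2)).trans (by simp [ih]))).resolve_right (ne (n + 2))
  ext n
  match n with
  | 0 => simpa using zero
  | 1 => simp [one, coeff_one]
  | n + 2 => simp [vanish, coeff_one]

theorem PadicInt.tendsto_zero_of_factorial_mul_eq_pow (p : ℕ) [Fact p.Prime] {q : ℕ}
    (hq : q = if p = 2 then 4 else p) {c : ℕ → ℤ_[p]}
    (hc : ∀ n, (n.factorial : ℤ_[p]) * c n = q ^ n) :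
    Tendsto c atTop (𝓝 0) := by
  have hp := (Fact.out : p.Prime)
  have p_pos : (0 : ℝ) < p := by exact_mod_cast hp.pos
  have bound (n : ℕ) : ‖c n‖ ^ 2 ≤ ((p : ℝ)⁻¹) ^ n := by
    set v := padicValNat p n.factorial with hv
    have norm_factorial : ‖(n.factorial : ℤ_[p])‖ = ((p : ℝ)⁻¹) ^ v := by
      rw [PadicInt.norm_def, PadicInt.coe_natCast,
        Padic.norm_eq_zpow_neg_valuation (by exact_mod_cast n.factorial_ne_zero),
        Padic.valuation_natCast, zpow_neg, zpow_natCast, inv_pow]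
    have legendre : (p - 1) * v ≤ n := by
      rw [hv, sub_one_mul_padicValNat_factorial]
      exact Nat.sub_le _ _
    have key : ∃ a : ℕ, ‖(q : ℤ_[p])‖ = ((p : ℝ)⁻¹) ^ a ∧ 2 * v + n ≤ 2 * (a * n) := by
      by_cases h2 : p = 2
      · subst h2
        refine ⟨2, ?_, by omega⟩
        have : (q : ℤ_[2]) = ((2 : ℕ) : ℤ_[2]) ^ 2 := by rw [hq]; norm_num
        rw [this, norm_pow, PadicInt.norm_p]
      · refine ⟨1, ?_, ?_⟩
        · rw [hq, if_neg h2, PadicInt.norm_p, pow_one]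
        · have : 2 ≤ p - 1 := by have := hp.two_le; omega
          nlinarith [Nat.mul_le_mul_right v this]
    obtain ⟨a, hqa, ha⟩ := key
    have h := congrArg (fun z ↦ ‖z‖) (hc n)
    simp only [norm_mul, norm_pow, norm_factorial, hqa] at h
    have r_pos : 0 < (p : ℝ)⁻¹ := inv_pos.2 p_pos
    have r_le : (p : ℝ)⁻¹ ≤ 1 := inv_le_one_of_one_le₀ (by exact_mod_cast hp.one_le)
    refine le_of_mul_le_mul_left ?_ (pow_pos r_pos (2 * v))
    calc (p : ℝ)⁻¹ ^ (2 * v) * ‖c n‖ ^ 2 = ((p : ℝ)⁻¹ ^ v * ‖c n‖) ^ 2 := by ring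
      _ = (p : ℝ)⁻¹ ^ (2 * (a * n)) := by rw [h]; ring
      _ ≤ (p : ℝ)⁻¹ ^ (2 * v + n) := pow_le_pow_of_le_one r_pos.le r_le ha
      _ = _ := pow_add _ _ _
  have sq : Tendsto (fun n ↦ ‖c n‖ ^ 2) atTop (𝓝 0) :=
    squeeze_zero (fun n ↦ by positivity) bound
      (tendsto_pow_atTop_nhds_zero_of_lt_one (by positivity)
        (inv_lt_one_of_one_lt₀ (by exact_mod_cast hp.one_lt)))
  rw [tendsto_zero_iff_norm_tendsto_zero]
  simpa [Real.sqrt_sq] using sq.sqrt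


/-- Let `p` be a prime, `q = 4` if `p = 2` and `q = p` otherwise, and let `R` be a complete
nonarchimedean commutative normed ring with `‖x‖ ≤ 1` for all `x`, which is a `ℤ_[p]`-algebra
whose structure map is norm-nonincreasing. Define
`ℓ(x) = Σ_{n≥1} (-1)^{n+1} (q^{n-1}/n) x^n` (the coefficients lie in `ℤ_[p]` and the series
converges), so that `q·ℓ(x) = log(1+q*x)`, and `exp(q*y) = Σ_{n≥0} (q^n/n!) y^n`. Then
(1) `exp(q·ℓ(x)) = 1 + q*x` for all `x ∈ R`, and
(2) `exp(q*(x+y)) = exp(q*x) * exp(q*y)` for all `x, y ∈ R`. -/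
theorem padic_exp_log (p : ℕ) [Fact p.Prime] (q : ℕ)
    (hq : q = if p = 2 then 4 else p)
    (R : Type*) [NormedCommRing R] [CompleteSpace R] [Algebra ℤ_[p] R]
    (hna : ∀ x y : R, ‖x + y‖ ≤ max ‖x‖ ‖y‖)
    (hbd : ∀ x : R, ‖x‖ ≤ 1)
    (hmap : ∀ c : ℤ_[p], ‖algebraMap ℤ_[p] R c‖ ≤ ‖c‖)
    (cl ce : ℕ → ℤ_[p])
    (hcl : ∀ n : ℕ, 1 ≤ n →
      ((cl n : ℚ_[p])) = (-1) ^ (n + 1) * (q : ℚ_[p]) ^ (n - 1) / (n : ℚ_[p]))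
    (hce : ∀ n : ℕ, ((ce n : ℚ_[p])) = (q : ℚ_[p]) ^ n / (n.factorial : ℚ_[p])) :
    (∀ x : R, Summable (fun n : ℕ => cl (n + 1) • x ^ (n + 1))) ∧
    (∀ x : R,
      (∑' n : ℕ, ce n • (∑' m : ℕ, cl (m + 1) • x ^ (m + 1)) ^ n) = 1 + (q : R) * x) ∧
    (∀ x y : R,
      (∑' n : ℕ, ce n • (x + y) ^ n) =
        (∑' n : ℕ, ce n • x ^ n) * (∑' n : ℕ, ce n • y ^ n)) := by
  have := IsUltrametricDist.isUltrametricDist_of_forall_norm_add_le_max_norm hna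
  have q_ne : (q : ℤ_[p]) ≠ 0 := by
    rw [hq]
    split_ifs
    · norm_num
    · exact_mod_cast (Fact.out : p.Prime).ne_zero
  have factorial_ne (n : ℕ) : (n.factorial : ℤ_[p]) ≠ 0 := by exact_mod_cast n.factorial_ne_zero
  have factorial_mul_ce (n : ℕ) : (n.factorial : ℤ_[p]) * ce n = q ^ n := by
    have h : (n.factorial : ℚ_[p]) ≠ 0 := by exact_mod_cast n.factorial_ne_zero
    apply PadicInt.ext
    push_cast
    rw [hce]
    field_simp
  have mul_cl (n : ℕ) : cl (n + 1) * (n + 1) = (-1) ^ n * q ^ n := by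
    have h : (n : ℚ_[p]) + 1 ≠ 0 := Nat.cast_add_one_ne_zero n
    apply PadicInt.ext
    push_cast
    rw [hcl (n + 1) (by omega)]
    push_cast
    rw [div_mul_cancel₀ _ h]
    ring
  have ce_succ (n : ℕ) : ce (n + 1) * (n + 1) = q * ce n := by
    apply mul_left_cancel₀ (factorial_ne n)
    have h := factorial_mul_ce (n + 1)
    rw [Nat.factorial_succ] at h
    push_cast at h
    linear_combination h - q * factorial_mul_ce n
  have ce_tendsto : Tendsto ce atTop (𝓝 0) :=
    PadicInt.tendsto_zero_of_factorial_mul_eq_pow p hq factorial_mul_ce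
  have cl_eq (n : ℕ) : q * cl (n + 1) = (-1) ^ n * n.factorial * ce (n + 1) := by
    apply mul_right_cancel₀ (Nat.cast_add_one_ne_zero n : (n : ℤ_[p]) + 1 ≠ 0)
    linear_combination (q : ℤ_[p]) * mul_cl n - (-1) ^ n * n.factorial * ce_succ n
      - (-1) ^ n * q * factorial_mul_ce n
  have cl_tendsto : Tendsto (fun n ↦ cl (n + 1)) atTop (𝓝 0) := by
    have q_norm_pos : 0 < ‖(q : ℤ_[p])‖ := norm_pos_iff.2 q_ne
    refine squeeze_zero_norm (a := fun n ↦ ‖ce (n + 1)‖ / ‖(q : ℤ_[p])‖) (fun n ↦ ?_) ?_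
    · rw [le_div_iff₀ q_norm_pos, mul_comm, ← norm_mul, cl_eq, norm_mul]
      exact mul_le_of_le_one_left (norm_nonneg _) (PadicInt.norm_le_one _)
    · simpa using ((tendsto_zero_iff_norm_tendsto_zero.1 ce_tendsto).comp
        (tendsto_add_atTop_nat 1)).div_const ‖(q : ℤ_[p])‖
  refine ⟨fun x ↦ summable_smul_of_tendsto_zero hbd hmap cl_tendsto _, fun x ↦ ?_, fun x y ↦ ?_⟩
  · let E : ℤ_[p]⟦X⟧ := mk ce
    let L : ℤ_[p]⟦X⟧ := X * mk fun n ↦ cl (n + 1)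
    have L_succ (n : ℕ) : coeff (n + 1) L = cl (n + 1) := by
      rw [coeff_succ_X_mul, coeff_mk]
    have L_zero : constantCoeff L = 0 := by simp [L]
    have coeff_deriv_L (n : ℕ) : coeff n (d⁄dX ℤ_[p] L) = (-1) ^ n * q ^ n := by
      rw [coeff_derivative, L_succ, mul_cl]
    have subst_eq : E.subst L = 1 + C (q : ℤ_[p]) * X := by
      refine subst_eq_one_add_C_mul_X ?_ ?_ ?_ L_zero
      · ext n
        rw [coeff_derivative, coeff_C_mul, coeff_mk, coeff_mk, ce_succ]
      · ext n
        rw [add_mul, one_mul, mul_assoc, map_add, coeff_C_mul, coeff_deriv_L]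
        cases n with
        | zero => simp
        | succ n =>
          rw [coeff_succ_X_mul, coeff_deriv_L, coeff_one, if_neg n.succ_ne_zero]
          ring
      · simpa [E] using factorial_mul_ce 0
    have E_tendsto : Tendsto (fun n ↦ coeff n E) atTop (𝓝 0) := by simpa [E] using ce_tendsto
    have L_tendsto : Tendsto (fun n ↦ coeff n L) atTop (𝓝 0) := by
      rw [← tendsto_add_atTop_iff_nat 1]
      simpa only [L_succ] using cl_tendsto
    have tsum_L : ∑' m, coeff m L • x ^ m = ∑' m, cl (m + 1) • x ^ (m + 1) := by
      rw [(summable_smul_of_tendsto_zero hbd hmap L_tendsto _).tsum_eq_zero_add]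
      simp [L_succ, L_zero]
    have h := tsum_smul_tsum_pow_eq_tsum_coeff_subst hbd hmap E_tendsto L_tendsto L_zero x
    rw [tsum_L, subst_eq] at h
    simp only [E, coeff_mk] at h
    rw [h, tsum_eq_sum (s := Finset.range 2) fun n hn ↦ ?_]
    · simp [Finset.sum_range_succ, coeff_one, Algebra.smul_def]
    · rw [Finset.mem_range, not_lt] at hn
      have h0 : n ≠ 0 := by omega
      have h1 : n ≠ 1 := by omega
      simp only [map_add, coeff_C_mul, coeff_one, coeff_X, h0, h1, if_false, mul_zero, add_zero,
        zero_smul]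
  · rw [tsum_mul_tsum_eq_tsum_sum_antidiagonal_of_isUltrametricDist
      (summable_smul_of_tendsto_zero hbd hmap ce_tendsto _)
      (summable_smul_of_tendsto_zero hbd hmap ce_tendsto _)]
    refine tsum_congr fun n ↦ ?_
    rw [(Commute.all x y).add_pow', Finset.smul_sum]
    refine Finset.sum_congr rfl fun kl hkl ↦ ?_
    rw [smul_mul_smul_comm, ← Nat.cast_smul_eq_nsmul ℤ_[p], smul_smul]
    congr 1
    obtain ⟨k, l⟩ := kl
    obtain rfl : k + l = n := Finset.HasAntidiagonal.mem_antidiagonal.1 hkl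
    apply mul_left_cancel₀ (mul_ne_zero (factorial_ne k) (factorial_ne l))
    have choose_eq : ((k + l).choose k : ℤ_[p]) * k.factorial * l.factorial = (k + l).factorial := by
      rw [Nat.choose_symm_add]
      exact_mod_cast Nat.add_choose_mul_factorial_mul_factorial k l
    linear_combination ce (k + l) * choose_eq + factorial_mul_ce (k + l)
      - l.factorial * ce l * factorial_mul_ce k - q ^ k * factorial_mul_ce l
end

section
/- Let p be a prime, q = 4 if p = 2 and q = p if p > 2, and let R be as in the context. Let ε_1, ..., ε_k be units of R, and suppose that E_1, ..., E_k are positive integers and s_1, ..., s_k are elements of R with ε_j^{E_j} = 1 + q*s_j for each j. For each tuple i = (i_1, ..., i_k) with 0 ≤ i_j < E_j, define f_i : Z_p^k → R by f_i(t_1, ..., t_k) = (Π_{j=1}^k ε_j^{i_j}) · exp( q · (t_1·ℓ(s_1) + ... + t_k·ℓ(s_k)) ), where ℓ(s) := Σ_{n≥1} (-1)^{n+1}·(q^{n-1}/n)·s^n and exp(q*y) := Σ_{n≥0} (q^n/n!)·y^n. Then the topological closure in R of the set Y_0 = { ε_1^{e_1} · ... · ε_k^{e_k} : e_1, ..., e_k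 ∈ Z } equals the union over all such tuples i of the images f_i(Z_p^k). -/
theorem norm_natCast_eq (p : ℕ) [Fact p.Prime] {n : ℕ} (hn : n ≠ 0) :
    ‖(n : ℤ_[p])‖ = ((p : ℝ) ^ padicValNat p n)⁻¹ := by
  rw [PadicInt.norm_def, PadicInt.coe_natCast,
    Padic.norm_eq_zpow_neg_valuation (by exact_mod_cast hn), Padic.valuation_natCast,
    zpow_neg, zpow_natCast]

theorem one_le_natCast_mul_norm (p : ℕ) [hp : Fact p.Prime] {n : ℕ} (hn : n ≠ 0) :
    1 ≤ (n : ℝ) * ‖(n : ℤ_[p])‖ := by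
  rw [norm_natCast_eq p hn, ← div_eq_mul_inv,
    one_le_div (pow_pos (by exact_mod_cast hp.out.pos) _)]
  exact_mod_cast Nat.le_of_dvd (Nat.pos_of_ne_zero hn) pow_padicValNat_dvd

theorem inv_pow_le_norm_factorial_pow (p : ℕ) [hp : Fact p.Prime] (n : ℕ) :
    ((p : ℝ) ^ n)⁻¹ ≤ ‖(n.factorial : ℤ_[p])‖ ^ (p - 1) := by
  have hp1 : (1 : ℝ) ≤ p := by exact_mod_cast hp.out.one_le
  rw [norm_natCast_eq p n.factorial_ne_zero, inv_pow, ← pow_mul, mul_comm,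
    sub_one_mul_padicValNat_factorial]
  exact inv_anti₀ (by positivity) (pow_le_pow_right₀ hp1 (Nat.sub_le _ _))

section Coefficients

variable {p : ℕ} [hp : Fact p.Prime] {q : ℕ} (hq : q = if p = 2 then 4 else p)
include hq

theorem norm_natCast_le_half : ‖(q : ℤ_[p])‖ ≤ 1 / 2 := by
  have hdvd : p ∣ q := by
    split_ifs at hq with h
    · exact h ▸ hq ▸ ⟨2, rfl⟩
    · exact hq ▸ dvd_rfl
  obtain ⟨c, rfl⟩ := hdvd
  have hp2 : (2 : ℝ) ≤ p := by exact_mod_cast hp.out.two_le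
  rw [Nat.cast_mul, norm_mul, PadicInt.norm_p]
  calc (p : ℝ)⁻¹ * ‖(c : ℤ_[p])‖ ≤ 2⁻¹ * 1 := by
        gcongr
        exact PadicInt.norm_le_one _
    _ = 1 / 2 := by norm_num

theorem norm_pow_sq_le_half_pow_mul_norm_factorial_sq (n : ℕ) :
    (‖(q : ℤ_[p])‖ ^ n) ^ 2 ≤ (1 / 2) ^ n * ‖(n.factorial : ℤ_[p])‖ ^ 2 := by
  have hfac := inv_pow_le_norm_factorial_pow p n
  have hle := PadicInt.norm_le_one (n.factorial : ℤ_[p])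
  split_ifs at hq with h
  · subst h hq
    have h4 : ‖((4 : ℕ) : ℤ_[2])‖ = (1 / 2) ^ 2 := by
      have := PadicInt.norm_p (p := 2)
      rw [show ((4 : ℕ) : ℤ_[2]) = ((2 : ℕ) : ℤ_[2]) ^ 2 by norm_num, norm_pow, this]
      norm_num
    have hfac2 : ((1 / 2 : ℝ) ^ n) ^ 2 ≤ ‖(n.factorial : ℤ_[2])‖ ^ 2 := by
      gcongr
      simpa using hfac
    calc (‖((4 : ℕ) : ℤ_[2])‖ ^ n) ^ 2 = ((1 / 2) ^ n) ^ 2 * ((1 / 2 : ℝ) ^ n) ^ 2 := by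
          rw [h4, ← pow_mul, ← pow_mul, ← pow_mul, ← pow_add]; congr 1; ring
      _ ≤ (1 / 2) ^ n * ‖(n.factorial : ℤ_[2])‖ ^ 2 := by
          refine mul_le_mul ?_ hfac2 (by positivity) (by positivity)
          rw [sq]
          exact mul_le_of_le_one_left (by positivity) (pow_le_one₀ (by norm_num) (by norm_num))
  · subst hq
    have hp3 : 2 ≤ q - 1 := by have := hp.out.two_le; omega
    have hp2 : (2 : ℝ) ≤ q := by exact_mod_cast hp.out.two_le
    have hfac2 : ((q : ℝ) ^ n)⁻¹ ≤ ‖(n.factorial : ℤ_[q])‖ ^ 2 :=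
      hfac.trans (pow_le_pow_of_le_one (norm_nonneg _) hle hp3)
    rw [PadicInt.norm_p]
    calc ((q : ℝ)⁻¹ ^ n) ^ 2 = (q : ℝ)⁻¹ ^ n * ((q : ℝ) ^ n)⁻¹ := by rw [sq, inv_pow]
      _ ≤ (1 / 2) ^ n * ‖(n.factorial : ℤ_[q])‖ ^ 2 := by
          gcongr
          rw [one_div]
          gcongr

theorem summable_norm_exp_coeff {ce : ℕ → ℤ_[p]}
    (hce : ∀ n, ce n * (n.factorial : ℤ_[p]) = (q : ℤ_[p]) ^ n) :
    Summable fun n ↦ ‖ce n‖ := by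
  refine Summable.of_nonneg_of_le (fun _ ↦ norm_nonneg _) (fun n ↦ ?_)
    (summable_geometric_of_lt_one (Real.sqrt_nonneg (1 / 2)) ?_)
  · have hpos : 0 < ‖(n.factorial : ℤ_[p])‖ ^ 2 := by
      have := norm_pos_iff.mpr
        (show (n.factorial : ℤ_[p]) ≠ 0 by exact_mod_cast n.factorial_ne_zero)
      positivity
    refine le_of_sq_le_sq ?_ (by positivity)
    refine le_of_mul_le_mul_right ?_ hpos
    rw [← mul_pow, ← norm_mul, hce, norm_pow, ← pow_mul √(1 / 2), mul_comm n, pow_mul,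
      Real.sq_sqrt (by norm_num)]
    exact norm_pow_sq_le_half_pow_mul_norm_factorial_sq hq n
  · rw [Real.sqrt_lt' one_pos]; norm_num

theorem summable_norm_log_coeff {cl : ℕ → ℤ_[p]}
    (hcl : ∀ n, cl (n + 1) * ((n + 1 : ℕ) : ℤ_[p]) = (-(q : ℤ_[p])) ^ n) :
    Summable fun n ↦ ‖cl (n + 1)‖ := by
  have hr : ‖(1 / 2 : ℝ)‖ < 1 := by norm_num
  have h1 := summable_pow_mul_geometric_of_norm_lt_one 1 hr
  have h0 := summable_pow_mul_geometric_of_norm_lt_one 0 hr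
  refine Summable.of_nonneg_of_le (fun _ ↦ norm_nonneg _) (fun n ↦ ?_) (h1.add h0)
  calc ‖cl (n + 1)‖ ≤ ‖cl (n + 1)‖ * (((n + 1 : ℕ) : ℝ) * ‖((n + 1 : ℕ) : ℤ_[p])‖) :=
        le_mul_of_one_le_right (norm_nonneg _) (one_le_natCast_mul_norm p n.succ_ne_zero)
    _ = ‖(q : ℤ_[p])‖ ^ n * (n + 1) := by
        rw [mul_left_comm, ← norm_mul, hcl, norm_pow, norm_neg, mul_comm]
        push_cast; rfl
    _ ≤ (1 / 2) ^ n * (n + 1) := by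
        gcongr
        exact norm_natCast_le_half hq
    _ = (n : ℝ) ^ 1 * (1 / 2) ^ n + (n : ℝ) ^ 0 * (1 / 2) ^ n := by ring

end Coefficients
section Formal

open PowerSeries

variable {A : Type*} [CommRing A] {q : A} {c : ℕ → A} {L : A⟦X⟧}

theorem derivative_sum_exp_coeff_mul_pow (hc : ∀ n : ℕ, c (n + 1) * (n + 1) = q * c n) (M : ℕ) :
    d⁄dX A (∑ n ∈ Finset.range (M + 1), C (c n) * L ^ n) =
      C q * (∑ n ∈ Finset.range M, C (c n) * L ^ n) * d⁄dX A L := by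
  rw [Finset.sum_range_succ', map_add, map_sum, Finset.mul_sum, Finset.sum_mul]
  have h0 : d⁄dX A (C (c 0) * L ^ 0) = 0 := by simp
  rw [h0, add_zero]
  refine Finset.sum_congr rfl fun n _ ↦ ?_
  rw [Derivation.leibniz, Derivation.leibniz_pow, derivative_C, smul_zero, add_zero,
    Nat.add_sub_cancel, smul_eq_mul, smul_eq_mul, nsmul_eq_mul]
  have hcn : C (c (n + 1)) * ((n + 1 : ℕ) : A⟦X⟧) = C q * C (c n) := by
    rw [← map_mul, ← hc n, map_mul]; simp
  linear_combination L ^ n * d⁄dX A L * hcn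

theorem coeff_sum_exp_coeff_mul_log_pow [IsDomain A] [CharZero A] (hc0 : c 0 = 1)
    (hc : ∀ n : ℕ, c (n + 1) * (n + 1) = q * c n)
    (hL0 : constantCoeff L = 0) (hL : (1 + C q * X) * d⁄dX A L = 1) {M m : ℕ} (hm : m ≤ M) :
    coeff m (∑ n ∈ Finset.range (M + 1), C (c n) * L ^ n) = coeff m (1 + C q * X) := by
  set S := ∑ n ∈ Finset.range (M + 1), C (c n) * L ^ n with hS
  have hode : (1 + C q * X) * d⁄dX A S = C q * S - C q * (C (c M) * L ^ M) := by
    rw [derivative_sum_exp_coeff_mul_pow hc, hS, Finset.sum_range_succ]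
    linear_combination C q * (∑ n ∈ Finset.range M, C (c n) * L ^ n) * hL
  have hLM : ∀ j < M, coeff j (L ^ M) = 0 := fun j hj ↦
    coeff_of_lt_order _ <| (Nat.cast_lt.mpr hj).trans_le <|
      le_order_pow_of_constantCoeff_eq_zero M hL0
  have h0 : coeff 0 S = 1 := by
    simp [hS, Finset.sum_range_succ', hL0, hc0]
  have hrec : ∀ j < M, coeff (j + 1) S * (j + 1) = q * (1 - j) * coeff j S := by
    intro j hj
    have h := congrArg (coeff j) hode
    rw [map_sub, coeff_C_mul, coeff_C_mul, coeff_C_mul, hLM j hj, add_mul, one_mul, map_add,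
      mul_assoc, coeff_C_mul, coeff_derivative] at h
    cases j with
    | zero => simpa using h
    | succ j =>
      rw [coeff_succ_X_mul, coeff_derivative] at h
      push_cast at h ⊢
      linear_combination h
  have h1 : 1 ≤ M → coeff 1 S = q := by
    intro hM
    simpa [h0] using hrec 0 hM
  have h2 : ∀ j, j + 2 ≤ M → coeff (j + 2) S = 0 := by
    intro j
    induction j with
    | zero =>
      intro hM
      have := hrec 1 hM
      rw [Nat.cast_one, sub_self, mul_zero, zero_mul] at this
      exact (mul_eq_zero.mp this).resolve_right (by rw [one_add_one_eq_two]; exact two_ne_zero)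
    | succ j ih =>
      intro hM
      have := hrec (j + 2) hM
      rw [ih (by omega), mul_zero] at this
      exact (mul_eq_zero.mp this).resolve_right (Nat.cast_add_one_ne_zero _)
  match m with
  | 0 => simp [h0]
  | 1 => simp [h1 hm]
  | j + 2 => simp [h2 j hm, coeff_one]

end Formal

section Evaluation

open PowerSeries

/-- The ideal of power series over `ℤ_[p]` whose coefficients all have norm at most `δ`. -/
def coeffNormLEIdeal (p : ℕ) [Fact p.Prime] (δ : ℝ) (hδ : 0 ≤ δ) : Ideal ℤ_[p]⟦X⟧ where
  carrier := {f | ∀ m, ‖coeff m f‖ ≤ δ}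
  zero_mem' m := by simpa using hδ
  add_mem' {f g} hf hg m := by
    rw [map_add]
    exact (IsUltrametricDist.norm_add_le_max _ _).trans (max_le (hf m) (hg m))
  smul_mem' f g hg m := by
    rw [smul_eq_mul, coeff_mul]
    refine IsUltrametricDist.norm_sum_le_of_forall_le_of_nonneg hδ fun x _ ↦ ?_
    rw [norm_mul]
    exact (mul_le_of_le_one_left (norm_nonneg _) (PadicInt.norm_le_one _)).trans (hg _)

theorem mem_coeffNormLEIdeal {p : ℕ} [Fact p.Prime] {δ : ℝ} {hδ : 0 ≤ δ} {f : ℤ_[p]⟦X⟧} :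
    f ∈ coeffNormLEIdeal p δ hδ ↔ ∀ m, ‖coeff m f‖ ≤ δ :=
  Iff.rfl

/-- The ideal of elements of norm at most `δ` in an ultrametric ring bounded by `1`. -/
def normLEIdeal {R : Type*} [NormedCommRing R] [IsUltrametricDist R] (hbd : ∀ x : R, ‖x‖ ≤ 1)
    (δ : ℝ) (hδ : 0 ≤ δ) : Ideal R where
  carrier := {x | ‖x‖ ≤ δ}
  zero_mem' := by simpa using hδ
  add_mem' {x y} hx hy := (IsUltrametricDist.norm_add_le_max _ _).trans (max_le hx hy)
  smul_mem' x y hy := (norm_mul_le _ _).trans <|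
    (mul_le_of_le_one_left (norm_nonneg _) (hbd x)).trans hy

theorem mem_normLEIdeal {R : Type*} [NormedCommRing R] [IsUltrametricDist R]
    {hbd : ∀ x : R, ‖x‖ ≤ 1} {δ : ℝ} {hδ : 0 ≤ δ} {x : R} :
    x ∈ normLEIdeal hbd δ hδ ↔ ‖x‖ ≤ δ :=
  Iff.rfl

theorem Ideal.pow_sub_pow_mem {R : Type*} [CommRing R] (I : Ideal R) {x y : R}
    (h : x - y ∈ I) (n : ℕ) : x ^ n - y ^ n ∈ I :=
  I.mem_of_dvd (sub_dvd_pow_sub_pow x y n) h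

theorem norm_tsum_sub_sum_range_le {M : Type*} [SeminormedAddCommGroup M] [T2Space M]
    [IsUltrametricDist M] {f : ℕ → M} (hf : Summable f) {δ : ℝ} (hδ : 0 ≤ δ) {N : ℕ}
    (h : ∀ n, N ≤ n → ‖f n‖ ≤ δ) : ‖∑' n, f n - ∑ n ∈ Finset.range N, f n‖ ≤ δ := by
  rw [← hf.sum_add_tsum_nat_add N, add_sub_cancel_left]
  exact IsUltrametricDist.norm_tsum_le_of_forall_le_of_nonneg hδ fun n ↦ h _ (Nat.le_add_left _ _)

variable {p : ℕ} [Fact p.Prime] {R : Type*} [NormedCommRing R] [Algebra ℤ_[p] R]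
  (hbd : ∀ x : R, ‖x‖ ≤ 1) (hmap : ∀ c : ℤ_[p], ‖algebraMap ℤ_[p] R c‖ ≤ ‖c‖)

include hbd hmap

theorem norm_smul_le_norm_coeff (c : ℤ_[p]) (x : R) : ‖c • x‖ ≤ ‖c‖ := by
  rw [Algebra.smul_def]
  exact (norm_mul_le _ _).trans <|
    (mul_le_of_le_one_right (norm_nonneg _) (hbd x)).trans (hmap c)

theorem summable_norm_smul {c : ℕ → ℤ_[p]} (hc : Summable fun n ↦ ‖c n‖) (x : ℕ → R) :
    Summable fun n ↦ ‖c n • x n‖ :=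
  Summable.of_nonneg_of_le (fun _ ↦ norm_nonneg _)
    (fun _ ↦ norm_smul_le_norm_coeff hbd hmap _ _) hc

theorem continuous_tsum_smul_pow [CompleteSpace R] {c : ℕ → ℤ_[p]}
    (hc : Summable fun n ↦ ‖c n‖) : Continuous fun x : R ↦ ∑' n, c n • x ^ n := by
  refine continuous_tsum (fun n ↦ ?_) hc fun n x ↦ norm_smul_le_norm_coeff hbd hmap _ _
  simp_rw [Algebra.smul_def]
  fun_prop

theorem tsum_exp_add [CompleteSpace R] {c : ℕ → ℤ_[p]} (hc : Summable fun n ↦ ‖c n‖)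
    (hmul : ∀ i j, c i * c j = (i + j).choose i * c (i + j)) (x y : R) :
    ∑' n, c n • (x + y) ^ n = (∑' n, c n • x ^ n) * ∑' n, c n • y ^ n := by
  rw [tsum_mul_tsum_eq_tsum_sum_antidiagonal_of_summable_norm
    (summable_norm_smul hbd hmap hc _) (summable_norm_smul hbd hmap hc _)]
  refine tsum_congr fun n ↦ ?_
  rw [(Commute.all x y).add_pow', Finset.smul_sum]
  refine Finset.sum_congr rfl fun ij hij ↦ ?_
  obtain rfl := Finset.HasAntidiagonal.mem_antidiagonal.mp hij
  rw [smul_mul_smul_comm, hmul, mul_smul, Nat.cast_smul_eq_nsmul, smul_comm]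

theorem norm_aeval_le [IsUltrametricDist R] {P : Polynomial ℤ_[p]} {δ : ℝ} (hδ : 0 ≤ δ)
    (hP : ∀ m, ‖P.coeff m‖ ≤ δ) (x : R) : ‖Polynomial.aeval x P‖ ≤ δ := by
  rw [Polynomial.aeval_eq_sum_range]
  exact IsUltrametricDist.norm_sum_le_of_forall_le_of_nonneg hδ fun m _ ↦
    (norm_smul_le_norm_coeff hbd hmap _ _).trans (hP m)

/-- If, over `ℤ_[p]`, the partial sums of the composition of the power series `∑ c n Xⁿ` with
`∑ l n Xⁿ⁺¹` stabilize coefficientwise to the polynomial `Q`, then the composition takes the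
value `Q(x)` at every `x`. -/
theorem tsum_comp_tsum_eq_aeval [IsUltrametricDist R] [CompleteSpace R] {c l : ℕ → ℤ_[p]}
    (hc : Summable fun n ↦ ‖c n‖) (hl : Summable fun n ↦ ‖l n‖) {Q : Polynomial ℤ_[p]}
    (hQ : ∀ m M, m ≤ M →
      coeff m (∑ n ∈ Finset.range (M + 1), C (c n) * (X * mk l) ^ n) = Q.coeff m) (x : R) :
    ∑' n, c n • (∑' m, l m • x ^ (m + 1)) ^ n = Polynomial.aeval x Q := by
  rw [← sub_eq_zero, ← norm_le_zero_iff]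
  refine le_of_forall_pos_le_add fun δ hδ ↦ ?_
  rw [zero_add]
  obtain ⟨N, hN⟩ := Filter.eventually_atTop.mp <|
    (hc.tendsto_atTop_zero.eventually_le_const hδ).and
      (hl.tendsto_atTop_zero.eventually_le_const hδ)
  set Lp : Polynomial ℤ_[p] := Polynomial.X * trunc N (mk l) with hLp
  set P : Polynomial ℤ_[p] := ∑ n ∈ Finset.range N, Polynomial.C (c n) * Lp ^ n with hP
  set y := ∑' m, l m • x ^ (m + 1) with hy
  let I := normLEIdeal hbd δ hδ.le
  let J := coeffNormLEIdeal p δ hδ.le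
  have hyLp : y - Polynomial.aeval x Lp ∈ I := by
    have hLpx : Polynomial.aeval x Lp = ∑ m ∈ Finset.range N, l m • x ^ (m + 1) := by
      rw [hLp, map_mul, Polynomial.aeval_X, Polynomial.aeval_def, eval₂_trunc_eq_sum_range,
        Finset.mul_sum]
      refine Finset.sum_congr rfl fun m _ ↦ ?_
      rw [coeff_mk, Algebra.smul_def]
      ring
    rw [hLpx]
    exact norm_tsum_sub_sum_range_le (summable_norm_smul hbd hmap hl _).of_norm hδ.le
      fun n hn ↦ (norm_smul_le_norm_coeff hbd hmap _ _).trans (hN n hn).2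
  have hyP : ∑' n, c n • y ^ n - Polynomial.aeval x P ∈ I := by
    have hPx : Polynomial.aeval x P =
        ∑ n ∈ Finset.range N, c n • (Polynomial.aeval x Lp) ^ n := by
      simp [hP, Algebra.smul_def]
    have h1 : ∑' n, c n • y ^ n - ∑ n ∈ Finset.range N, c n • y ^ n ∈ I :=
      norm_tsum_sub_sum_range_le (summable_norm_smul hbd hmap hc _).of_norm hδ.le
        fun n hn ↦ (norm_smul_le_norm_coeff hbd hmap _ _).trans (hN n hn).1
    have h2 : ∑ n ∈ Finset.range N, c n • y ^ n - Polynomial.aeval x P ∈ I := by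
      rw [hPx, ← Finset.sum_sub_distrib]
      refine I.sum_mem fun n _ ↦ ?_
      rw [← smul_sub, Algebra.smul_def]
      exact I.mul_mem_left _ (I.pow_sub_pow_mem hyLp n)
    simpa using I.add_mem h1 h2
  have hLpL : (Lp : ℤ_[p]⟦X⟧) - X * mk l ∈ J := by
    rw [hLp, Polynomial.coe_mul, Polynomial.coe_X, ← mul_sub]
    refine J.mul_mem_left _ fun m ↦ ?_
    rw [map_sub, Polynomial.coeff_coe, coeff_trunc, coeff_mk]
    split_ifs with hm
    · simpa using hδ.le
    · rw [zero_sub, norm_neg]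
      exact (hN m (not_lt.mp hm)).2
  have hPL : (P : ℤ_[p]⟦X⟧) - ∑ n ∈ Finset.range N, C (c n) * (X * mk l) ^ n ∈ J := by
    have hcoe : (P : ℤ_[p]⟦X⟧) = ∑ n ∈ Finset.range N, C (c n) * (Lp : ℤ_[p]⟦X⟧) ^ n := by
      rw [hP, ← Polynomial.coeToPowerSeries.ringHom_apply, map_sum]
      simp
    rw [hcoe, ← Finset.sum_sub_distrib]
    refine J.sum_mem fun n _ ↦ ?_
    rw [← mul_sub]
    exact J.mul_mem_left _ (J.pow_sub_pow_mem hLpL n)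
  have hPQ : ∀ m, ‖(P - Q).coeff m‖ ≤ δ := by
    intro m
    have htail : ∑ n ∈ Finset.range N, C (c n) * (X * mk l) ^ n -
        ∑ n ∈ Finset.range (N + m + 1), C (c n) * (X * mk l) ^ n ∈ J := by
      rw [← J.neg_mem_iff, neg_sub, ← Finset.sum_Ico_eq_sub _ (by omega)]
      refine J.sum_mem fun n hn ↦ J.mul_mem_right _ fun j ↦ ?_
      rw [coeff_C]
      split_ifs
      · exact (hN n (Finset.mem_Ico.mp hn).1).1
      · simpa using hδ.le
    have h := mem_coeffNormLEIdeal.mp (J.add_mem hPL htail) m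
    rw [sub_add_sub_cancel, map_sub, hQ m (N + m) (Nat.le_add_left _ _)] at h
    simpa using h
  have h := I.add_mem hyP (mem_normLEIdeal.mpr <| norm_aeval_le hbd hmap hδ.le hPQ x)
  rw [map_sub, sub_add_sub_cancel] at h
  exact h

end Evaluation

section Logarithm

open PowerSeries

variable {A : Type*} [CommRing A]

theorem one_add_C_mul_X_mul_derivative_log {q : A} {l : ℕ → A}
    (hl : ∀ n, l n * ((n + 1 : ℕ) : A) = (-q) ^ n) :
    (1 + C q * X) * d⁄dX A (X * mk l) = 1 := by
  have hd : d⁄dX A (X * mk l) = mk fun n ↦ (-q) ^ n := by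
    ext n
    rw [coeff_derivative, coeff_succ_X_mul, coeff_mk, coeff_mk, ← hl n, Nat.cast_succ]
  rw [hd]
  ext n
  rw [add_mul, one_mul, map_add, mul_assoc, coeff_C_mul]
  cases n with
  | zero => simp
  | succ n => simp [coeff_one, coeff_succ_X_mul, pow_succ']

end Logarithm

section Padic

variable {p : ℕ} [Fact p.Prime] {q : ℕ} (hq : q = if p = 2 then 4 else p)
  {R : Type*} [NormedCommRing R] [CompleteSpace R] [Algebra ℤ_[p] R]
  (hbd : ∀ x : R, ‖x‖ ≤ 1) (hmap : ∀ c : ℤ_[p], ‖algebraMap ℤ_[p] R c‖ ≤ ‖c‖)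
  {cl ce : ℕ → ℤ_[p]}
  (hcl : ∀ n, cl (n + 1) * ((n + 1 : ℕ) : ℤ_[p]) = (-(q : ℤ_[p])) ^ n)
  (hce : ∀ n, ce n * (n.factorial : ℤ_[p]) = (q : ℤ_[p]) ^ n)

include hce in
theorem exp_coeff_mul (i j : ℕ) : ce i * ce j = (i + j).choose i * ce (i + j) := by
  have hne : ((i.factorial * j.factorial : ℕ) : ℤ_[p]) ≠ 0 := by
    exact_mod_cast mul_ne_zero i.factorial_ne_zero j.factorial_ne_zero
  refine mul_right_cancel₀ hne ?_
  have h : (((i + j).choose i : ℕ) : ℤ_[p]) * i.factorial * j.factorial =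
      (i + j).factorial := by
    rw [Nat.choose_symm_add]
    exact_mod_cast Nat.add_choose_mul_factorial_mul_factorial i j
  have hij := hce (i + j)
  rw [← h, pow_add, ← hce i, ← hce j] at hij
  push_cast
  linear_combination -hij

include hce in
theorem exp_coeff_succ (n : ℕ) : ce (n + 1) * (n + 1) = q * ce n := by
  have hne : (n.factorial : ℤ_[p]) ≠ 0 := by exact_mod_cast n.factorial_ne_zero
  refine mul_right_cancel₀ hne ?_
  have h := hce (n + 1)
  rw [pow_succ, ← hce n, Nat.factorial_succ] at h
  push_cast at h
  linear_combination h

include hq hbd hmap hcl hce in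
/-- The identity `exp (log (1 + q x)) = 1 + q x`. -/
theorem tsum_exp_tsum_log [IsUltrametricDist R] (x : R) :
    ∑' n, ce n • (∑' m, cl (m + 1) • x ^ (m + 1)) ^ n = 1 + (q : R) * x := by
  rw [tsum_comp_tsum_eq_aeval hbd hmap (summable_norm_exp_coeff hq hce)
    (summable_norm_log_coeff hq hcl)
    (Q := 1 + Polynomial.C (q : ℤ_[p]) * Polynomial.X) (fun m M hm ↦ ?_) x]
  · simp
  · rw [coeff_sum_exp_coeff_mul_log_pow (q := (q : ℤ_[p])) (by simpa using hce 0)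
      (exp_coeff_succ hce) (by simp) (one_add_C_mul_X_mul_derivative_log hcl) hm,
      ← Polynomial.coeff_coe, Polynomial.coe_add, Polynomial.coe_one, Polynomial.coe_mul,
      Polynomial.coe_C, Polynomial.coe_X]

/-- The exponential `y ↦ ∑ ce n • yⁿ` as a homomorphism from the additive group to the units. -/
noncomputable def expUnits (hbd : ∀ x : R, ‖x‖ ≤ 1)
    (hmap : ∀ c : ℤ_[p], ‖algebraMap ℤ_[p] R c‖ ≤ ‖c‖)
    (hq : q = if p = 2 then 4 else p)
    (hce : ∀ n, ce n * (n.factorial : ℤ_[p]) = (q : ℤ_[p]) ^ n) : Multiplicative R →* Rˣ :=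
  MonoidHom.toHomUnits
    { toFun := fun y ↦ ∑' n, ce n • y.toAdd ^ n
      map_one' := by
        rw [tsum_eq_single 0 fun n hn ↦ by simp [hn]]
        have h0 : ce 0 = 1 := by simpa using hce 0
        simp [h0]
      map_mul' := fun x y ↦
        tsum_exp_add hbd hmap (summable_norm_exp_coeff hq hce) (exp_coeff_mul hce) _ _ }

theorem coe_expUnits (y : R) :
    (expUnits hbd hmap hq hce (.ofAdd y) : R) = ∑' n, ce n • y ^ n :=
  rfl

theorem coe_expUnits_sum_intCast_smul {k : ℕ} (z : Fin k → ℤ) (y : Fin k → R) :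
    (∑' n, ce n • (∑ j, (z j : ℤ_[p]) • y j) ^ n) =
      ((∏ j, expUnits hbd hmap hq hce (.ofAdd (y j)) ^ z j : Rˣ) : R) := by
  rw [← coe_expUnits hq hbd hmap hce, ofAdd_sum, map_prod]
  simp_rw [Int.cast_smul_eq_zsmul, ofAdd_zsmul, map_zpow]

end Padic

/-- Let `p` be a prime, `q = 4` if `p = 2` and `q = p` otherwise, and let `R` be a complete
nonarchimedean commutative normed ring with `‖x‖ ≤ 1` for all `x`, which is a `ℤ_[p]`-algebra
whose structure map is norm-nonincreasing. Let `ε_1, …, ε_k` be units of `R`, and let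
`E_1, …, E_k` be positive integers and `s_1, …, s_k ∈ R` with `ε_j^{E_j} = 1 + q*s_j`.
For each tuple `i = (i_1, …, i_k)` with `0 ≤ i_j < E_j`, define
`f_i(t_1, …, t_k) = (Π_j ε_j^{i_j}) · exp(q·(t_1·ℓ(s_1) + ⋯ + t_k·ℓ(s_k)))`, where
`ℓ(s) = Σ_{n≥1} (-1)^{n+1} (q^{n-1}/n) s^n` and `exp(q*y) = Σ_{n≥0} (q^n/n!) y^n`. Then the
topological closure in `R` of `Y_0 = {ε_1^{e_1} ⋯ ε_k^{e_k} : e_j ∈ ℤ}` equals the union over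
all such tuples `i` of the images `f_i(ℤ_p^k)`. -/
theorem closure_of_unit_powers (p : ℕ) [Fact p.Prime] (q : ℕ)
    (hq : q = if p = 2 then 4 else p)
    (R : Type*) [NormedCommRing R] [CompleteSpace R] [Algebra ℤ_[p] R]
    (hna : ∀ x y : R, ‖x + y‖ ≤ max ‖x‖ ‖y‖)
    (hbd : ∀ x : R, ‖x‖ ≤ 1)
    (hmap : ∀ c : ℤ_[p], ‖algebraMap ℤ_[p] R c‖ ≤ ‖c‖)
    (cl ce : ℕ → ℤ_[p])
    (hcl : ∀ n : ℕ, 1 ≤ n →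
      ((cl n : ℚ_[p])) = (-1) ^ (n + 1) * (q : ℚ_[p]) ^ (n - 1) / (n : ℚ_[p]))
    (hce : ∀ n : ℕ, ((ce n : ℚ_[p])) = (q : ℚ_[p]) ^ n / (n.factorial : ℚ_[p]))
    (k : ℕ) (ε : Fin k → Rˣ) (E : Fin k → ℕ) (hE : ∀ j, 0 < E j)
    (s : Fin k → R) (hs : ∀ j, ((ε j : R)) ^ (E j) = 1 + (q : R) * s j) :
    closure {x : R | ∃ e : Fin k → ℤ, x = ((∏ j, ε j ^ e j : Rˣ) : R)} =
      ⋃ i ∈ {i : Fin k → ℕ | ∀ j, i j < E j},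
        Set.range (fun t : Fin k → ℤ_[p] =>
          (∏ j, ((ε j : R)) ^ (i j)) *
            ∑' n : ℕ, ce n •
              (∑ j, t j • (∑' m : ℕ, cl (m + 1) • (s j) ^ (m + 1))) ^ n) := by
  have : IsUltrametricDist R :=
    IsUltrametricDist.isUltrametricDist_of_forall_norm_add_le_max_norm hna
  have hcl' : ∀ n, cl (n + 1) * ((n + 1 : ℕ) : ℤ_[p]) = (-(q : ℤ_[p])) ^ n := by
    intro n
    have hne : ((n + 1 : ℕ) : ℚ_[p]) ≠ 0 := by exact_mod_cast n.succ_ne_zero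
    apply PadicInt.ext
    rw [PadicInt.coe_mul, hcl (n + 1) (Nat.le_add_left _ _), PadicInt.coe_natCast,
      div_mul_cancel₀ _ hne, Nat.add_sub_cancel, PadicInt.coe_pow, PadicInt.coe_neg,
      PadicInt.coe_natCast, neg_pow (q : ℚ_[p])]
    ring
  have hce' : ∀ n, ce n * (n.factorial : ℤ_[p]) = (q : ℤ_[p]) ^ n := by
    intro n
    have hne : (n.factorial : ℚ_[p]) ≠ 0 := by exact_mod_cast n.factorial_ne_zero
    apply PadicInt.ext
    rw [PadicInt.coe_mul, hce, PadicInt.coe_natCast, div_mul_cancel₀ _ hne, PadicInt.coe_pow,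
      PadicInt.coe_natCast]
  set y : Fin k → R := fun j ↦ ∑' m : ℕ, cl (m + 1) • (s j) ^ (m + 1) with hy
  set F : (Fin k → ℕ) → (Fin k → ℤ_[p]) → R := fun i t ↦
    (∏ j, ((ε j : R)) ^ (i j)) * ∑' n : ℕ, ce n • (∑ j, t j • y j) ^ n with hF
  have hεE : ∀ j, expUnits hbd hmap hq hce' (.ofAdd (y j)) = ε j ^ E j := by
    intro j
    ext
    rw [coe_expUnits, tsum_exp_tsum_log hq hbd hmap hcl' hce', ← hs, Units.val_pow_eq_pow_val]
  have hFint : ∀ (i : Fin k → ℕ) (z : Fin k → ℤ), F i (fun j ↦ (z j : ℤ_[p])) =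
      ((∏ j, ε j ^ ((i j : ℤ) + E j * z j) : Rˣ) : R) := by
    intro i z
    simp only [hF]
    rw [coe_expUnits_sum_intCast_smul hq hbd hmap hce']
    simp_rw [hεE, zpow_add, zpow_mul, zpow_natCast, Finset.prod_mul_distrib, Units.val_mul]
    simp
  have hFcont : ∀ i, Continuous (F i) := by
    have halg : Continuous (algebraMap ℤ_[p] R) :=
      AddMonoidHomClass.continuous_of_bound (algebraMap ℤ_[p] R) 1 fun c ↦ by
        simpa using hmap c
    intro i
    refine continuous_const.mul <|
      (continuous_tsum_smul_pow hbd hmap (summable_norm_exp_coeff hq hce')).comp ?_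
    simp_rw [Algebra.smul_def]
    fun_prop
  apply subset_antisymm
  · refine closure_minimal ?_ (IsCompact.isClosed ?_)
    · rintro _ ⟨e, rfl⟩
      have hE' : ∀ j, (0 : ℤ) < E j := fun j ↦ by exact_mod_cast hE j
      refine Set.mem_iUnion₂.mpr ⟨fun j ↦ (e j % E j).toNat, fun j ↦ ?_,
        fun j ↦ ((e j / E j : ℤ) : ℤ_[p]), ?_⟩
      · have := Int.emod_lt_of_pos (e j) (hE' j)
        show (e j % E j).toNat < E j
        have := hE j
        omega
      · refine (hFint _ _).trans ?_
        simp_rw [Int.toNat_of_nonneg (Int.emod_nonneg _ (hE' _).ne'), Int.emod_add_mul_ediv]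
    · refine Set.Finite.isCompact_biUnion ?_ fun i _ ↦ isCompact_range (hFcont i)
      exact (Set.finite_Iic E).subset fun i hi j ↦ (hi j).le
  · refine Set.iUnion₂_subset fun i _ ↦ ?_
    have hdense : DenseRange (Pi.map fun (_ : Fin k) (z : ℤ) ↦ (z : ℤ_[p])) :=
      DenseRange.piMap fun _ ↦ PadicInt.denseRange_intCast
    refine ((hFcont i).range_subset_closure_image_dense hdense).trans (closure_mono ?_)
    rintro _ ⟨_, ⟨z, rfl⟩, rfl⟩
    exact ⟨_, hFint i z⟩
end

section
/- Let b be a nonzero integer. Then the polynomial X^5 + 4*b^4*X - 1 is irreducible over the rational numbers. -/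
open Polynomial

theorem monic_quintic (a : ℤ) : (X ^ 5 + C a * X - 1 : ℤ[X]).Monic := by
  monicity!

theorem natDegree_quintic (a : ℤ) : (X ^ 5 + C a * X - 1 : ℤ[X]).natDegree = 5 := by
  compute_degree!

/-- The trinomial `X^5 + a*X - 1` is irreducible over `ℤ` unless `a ∈ {-2, 0, 1}`. -/
theorem irreducible_quintic_int {a : ℤ} (h0 : a ≠ 0) (h1 : a ≠ 1) (h2 : a ≠ -2) :
    Irreducible (X ^ 5 + C a * X - 1 : ℤ[X]) := by
  have hm := monic_quintic a
  have hd := natDegree_quintic a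
  have hne : (X ^ 5 + C a * X - 1 : ℤ[X]) ≠ 1 := fun h => by
    rw [h, natDegree_one] at hd
    omega
  refine hm.irreducible_iff_natDegree'.2 ⟨hne, ?_⟩
  intro f g hf hg hfg hmem
  have hdeg : f.natDegree + g.natDegree = 5 := by rw [← hf.natDegree_mul hg, hfg, hd]
  rw [hd, Finset.mem_Ioc] at hmem
  have hg_cases : g.natDegree = 1 ∨ g.natDegree = 2 := by omega
  rcases hg_cases with hg_deg | hg_deg
  · have hroot : g.eval (-g.coeff 0) = 0 := by
      rw [hg.eq_X_add_C hg_deg]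
      simp
    have heval := congrArg (eval (-g.coeff 0)) hfg
    simp only [eval_mul, hroot, mul_zero, eval_sub, eval_add, eval_pow, eval_X, eval_C,
      eval_one] at heval
    have hunit : IsUnit (g.coeff 0) :=
      isUnit_of_dvd_one ⟨-g.coeff 0 ^ 4 - a, by linear_combination heval⟩
    rcases Int.isUnit_iff.1 hunit with h | h <;> rw [h] at heval
    · exact h2 (by linarith)
    · exact h0 (by linarith)
  · have hf_deg : f.natDegree = 3 := by omega
    have hg2 : g.coeff 2 = 1 := hg_deg ▸ hg.coeff_natDegree
    have hf3 : f.coeff 3 = 1 := hf_deg ▸ hf.coeff_natDegree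
    have hg_zero (n : ℕ) (hn : 2 < n) : g.coeff n = 0 :=
      coeff_eq_zero_of_natDegree_lt (hg_deg ▸ hn)
    have hf_zero (n : ℕ) (hn : 3 < n) : f.coeff n = 0 :=
      coeff_eq_zero_of_natDegree_lt (hf_deg ▸ hn)
    have e (n : ℕ) := congrArg (fun p => coeff p n) hfg
    have e0 := e 0
    have e1 := e 1
    have e2 := e 2
    have e3 := e 3
    have e4 := e 4
    simp [-eq_intCast, coeff_C, coeff_mul, Finset.Nat.antidiagonal_succ, coeff_X, coeff_one, hg2, hf3, hg_zero,
      hf_zero] at e0 e1 e2 e3 e4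
    generalize g.coeff 0 = q at *
    generalize g.coeff 1 = p at *
    generalize f.coeff 0 = t at *
    generalize f.coeff 1 = s at *
    generalize f.coeff 2 = r at *
    have hr : r = -p := by linarith
    subst hr
    have hs : s = p ^ 2 - q := by linarith
    subst hs
    have hq : IsUnit q := isUnit_of_dvd_one ⟨-t, by linarith⟩
    rcases Int.isUnit_iff.1 hq with rfl | rfl
    · have ht : t = -1 := by linarith
      subst ht
      have hp : IsUnit p := isUnit_of_dvd_one ⟨p ^ 2 - 2, by linarith⟩
      rcases Int.isUnit_iff.1 hp with rfl | rfl <;> omega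
    · have ht : t = 1 := by linarith
      subst ht
      have hp : IsUnit p := isUnit_of_dvd_one ⟨-p ^ 2 - 2, by linarith⟩
      rcases Int.isUnit_iff.1 hp with rfl | rfl <;> omega

/-- Let `b` be a nonzero integer. The polynomial `X^5 + 4*b^4*X - 1` is irreducible over `ℚ`. -/
theorem quintic_irreducible (b : ℤ) (hb : b ≠ 0) :
    Irreducible (X ^ 5 + C (4 * (b : ℚ) ^ 4) * X - 1 : ℚ[X]) := by
  have hpos : 0 < b ^ 4 := by positivity
  have h := irreducible_quintic_int (a := 4 * b ^ 4) (by omega) (by omega) (by omega)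
  rw [(monic_quintic _).irreducible_iff_irreducible_map_fraction_map (K := ℚ)] at h
  simpa [-eq_intCast, -map_mul, -map_pow] using h
end

section
/- Let b be a nonzero integer and let K = Q[X]/(X^5 + 4*b^4*X - 1), which is a number field of degree 5 over Q since X^5 + 4*b^4*X - 1 is irreducible over Q. Then K has exactly one real infinite place and exactly two complex infinite places. -/
open Polynomial

/-- A quintic `x ^ 5 + a * x - 1` with `a ≥ 0` has at most one real root. -/
theorem eq_of_pow_five_add_mul_eq {a x y : ℝ} (ha : 0 ≤ a)
    (h : x ^ 5 + a * x = y ^ 5 + a * y) : x = y := by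
  have hmono : StrictMono fun t : ℝ => t ^ 5 + a * t :=
    (Odd.strictMono_pow (by decide : Odd 5)).add_monotone fun _ _ hst =>
      mul_le_mul_of_nonneg_left hst ha
  exact hmono.injective h

/-- If `f` has at most one real root, then `ℚ[X]/(f)` has at most one real infinite place. -/
theorem NumberField.InfinitePlace.nrRealPlaces_adjoinRoot_le_one {f : ℚ[X]}
    [Fact (Irreducible f)]
    (hf : ∀ x y : ℝ, aeval x f = 0 → aeval y f = 0 → x = y) :
    nrRealPlaces (AdjoinRoot f) ≤ 1 := by
  classical
  rw [← card_real_embeddings, Fintype.card_le_one_iff]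
  rintro ⟨φ, hφ⟩ ⟨ψ, hψ⟩
  have hroot (σ : AdjoinRoot f →+* ℝ) : aeval (σ (AdjoinRoot.root f)) f = 0 := by
    rw [aeval_def, Subsingleton.elim (algebraMap ℚ ℝ) (σ.comp (AdjoinRoot.of f)), ← hom_eval₂,
      AdjoinRoot.eval₂_root, map_zero]
  have h : φ (AdjoinRoot.root f) = ψ (AdjoinRoot.root f) := by
    rw [← hφ.coe_embedding_apply, ← hψ.coe_embedding_apply,
      hf _ _ (hroot hφ.embedding) (hroot hψ.embedding)]
  refine Subtype.ext (RingHom.ext fun x => ?_)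
  induction x using AdjoinRoot.induction_on with
  | ih p =>
    rw [← AdjoinRoot.aeval_eq, aeval_def, hom_eval₂, hom_eval₂, h]
    congr 1
    exact Subsingleton.elim _ _



/-- If `f` is a quintic with at most one real root, then `ℚ[X]/(f)` has one real and two complex
infinite places. -/
theorem NumberField.InfinitePlace.card_places_adjoinRoot_of_natDegree_eq_five {f : ℚ[X]}
    [hirr : Fact (Irreducible f)] (hdeg : f.natDegree = 5)
    (hf : ∀ x y : ℝ, aeval x f = 0 → aeval y f = 0 → x = y) :
    Nat.card {w : InfinitePlace (AdjoinRoot f) // w.IsReal} = 1 ∧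
      Nat.card {w : InfinitePlace (AdjoinRoot f) // w.IsComplex} = 2 := by
  have hrank : Module.finrank ℚ (AdjoinRoot f) = 5 := by
    rw [(AdjoinRoot.powerBasis hirr.out.ne_zero).finrank, AdjoinRoot.powerBasis_dim, hdeg]
  have hle := nrRealPlaces_adjoinRoot_le_one hf
  have hsum := card_add_two_mul_card_eq_rank (AdjoinRoot f)
  rw [hrank] at hsum
  simp only [nrRealPlaces, nrComplexPlaces, ← Nat.card_eq_fintype_card] at hle hsum
  omega

/-- Let `b` be a nonzero integer and let `K = ℚ[X]/(X^5 + 4*b^4*X - 1)`, a number field of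
degree 5 over `ℚ` since `X^5 + 4*b^4*X - 1` is irreducible over `ℚ` (taken as a hypothesis).
Then `K` has exactly one real infinite place and exactly two complex infinite places. -/
theorem quintic_field_places (b : ℤ) (hb : b ≠ 0)
    [hirr : Fact (Irreducible (X ^ 5 + C (4 * (b : ℚ) ^ 4) * X - 1 : ℚ[X]))] :
    Nat.card {w : NumberField.InfinitePlace
        (AdjoinRoot (X ^ 5 + C (4 * (b : ℚ) ^ 4) * X - 1 : ℚ[X])) // w.IsReal} = 1 ∧
      Nat.card {w : NumberField.InfinitePlace
        (AdjoinRoot (X ^ 5 + C (4 * (b : ℚ) ^ 4) * X - 1 : ℚ[X])) // w.IsComplex} = 2 := by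
  refine NumberField.InfinitePlace.card_places_adjoinRoot_of_natDegree_eq_five
    (by compute_degree!) fun x y hx hy => ?_
  simp only [map_sub, map_add, map_mul, map_pow, aeval_X, aeval_C, map_one] at hx hy
  refine eq_of_pow_five_add_mul_eq (a := algebraMap ℚ ℝ (4 * (b : ℚ) ^ 4)) ?_ ?_
  · simp only [eq_ratCast]
    positivity
  · simp only [map_mul, map_pow]
    linarith
end
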